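/- There exists a constant b₃ > 0 such that for every δ > 0 one has ∫₁^T R_H(2πt)³ dt = b₃·T^{13/4} + O_δ(T^{45/14+δ}) as T → ∞. -/

import Mathlib

open scoped Classical
open Real MeasureTheory

/-- Counting function of the type II eigenvalues `2πc(c+2k+1)`, counted with multiplicity `2c`. -/
noncomputable def NH (t : ℝ) : ℝ :=
  ∑' p : ℕ × ℕ,
    if 2 * π * (p.1 + 1 : ℝ) * ((p.1 + 1 : ℝ) + 2 * (p.2 : ℝ) + 1) ≤ t then
      2 * (p.1 + 1 : ℝ) else 0

/-- The remainder of the type II counting function: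
`R_H(2πt) = N_H(2πt) − (2/3) t^{3/2} + (1/2) t`. -/
noncomputable def RHtwoPi (t : ℝ) : ℝ :=
  NH (2 * π * t) - (2 / 3) * t ^ ((3 : ℝ) / 2) + (1 / 2) * t

/-- The additive character `x ↦ e^{2πix}` of the real line. -/
noncomputable def cis (x : ℝ) : ℂ := Complex.exp ((2 * π * x : ℝ) * Complex.I)

lemma norm_cis (x : ℝ) : ‖cis x‖ = 1 := Complex.norm_exp_ofReal_mul_I _

lemma cis_add (x y : ℝ) : cis (x + y) = cis x * cis y := by
  simp only [cis, ← Complex.exp_add]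
  congr 1
  push_cast
  ring

lemma cis_zero : cis 0 = 1 := by simp [cis]

lemma cis_neg (x : ℝ) : cis (-x) = (starRingEnd ℂ) (cis x) := by
  simp only [cis, ← Complex.exp_conj, map_mul, Complex.conj_I, Complex.conj_ofReal]
  congr 1
  push_cast
  ring

lemma cis_re (x : ℝ) : (cis x).re = Real.cos (2 * π * x) := Complex.exp_ofReal_mul_I_re _

lemma cis_im (x : ℝ) : (cis x).im = Real.sin (2 * π * x) := Complex.exp_ofReal_mul_I_im _

lemma cis_int (n : ℤ) : cis n = 1 := by
  rw [cis, Complex.exp_eq_one_iff]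
  exact ⟨n, by push_cast; ring⟩

lemma cis_add_int (x : ℝ) (n : ℤ) : cis (x + n) = cis x := by
  rw [cis_add, cis_int, mul_one]

lemma cis_nat_mul (n : ℕ) (x : ℝ) : cis (n * x) = cis x ^ n := by
  simp only [cis, ← Complex.exp_nat_mul]
  congr 1
  push_cast
  ring

lemma cis_half : cis (1 / 2) = -1 := by
  rw [cis, ← Complex.exp_pi_mul_I]
  congr 1
  push_cast
  ring

@[fun_prop]
lemma continuous_cis : Continuous cis := by
  unfold cis
  fun_prop

lemma HasDerivAt.cis {φ : ℝ → ℝ} {φ' x : ℝ} (h : HasDerivAt φ φ' x) :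
    HasDerivAt (fun y => _root_.cis (φ y)) (2 * π * Complex.I * φ' * _root_.cis (φ x)) x := by
  have h1 : HasDerivAt (fun y => ((2 * π * φ y : ℝ) : ℂ) * Complex.I)
      (((2 * π * φ' : ℝ) : ℂ) * Complex.I) x :=
    ((h.const_mul (2 * π)).ofReal_comp).mul_const _
  have h2 := h1.cexp
  unfold _root_.cis
  convert h2 using 1
  push_cast
  ring

/-- First derivative test: partial integration against a phase, with a monotone amplitude. -/
theorem norm_integral_mul_cis_le {a b : ℝ} (hab : a ≤ b) {φ φ' r r' : ℝ → ℝ}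
    (hφ : ∀ x ∈ Set.Icc a b, HasDerivAt φ (φ' x) x)
    (hr : ∀ x ∈ Set.Icc a b, HasDerivAt r (r' x) x)
    (hφ' : ContinuousOn φ' (Set.Icc a b)) (hr' : ContinuousOn r' (Set.Icc a b))
    (hpos : ∀ x ∈ Set.Icc a b, 0 ≤ r' x) :
    ‖∫ x in a..b, ((r x * φ' x : ℝ) : ℂ) * cis (φ x)‖ ≤
      (|r a| + |r b| + (r b - r a)) / (2 * π) := by
  have hu : Set.uIcc a b = Set.Icc a b := Set.uIcc_of_le hab
  have hφc : ContinuousOn φ (Set.Icc a b) := fun x hx => (hφ x hx).continuousAt.continuousWithinAt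
  have hrc : ContinuousOn r (Set.Icc a b) := fun x hx => (hr x hx).continuousAt.continuousWithinAt
  have hcc : ContinuousOn (fun x => cis (φ x)) (Set.Icc a b) :=
    continuous_cis.comp_continuousOn hφc
  have i1 : IntervalIntegrable (fun x => ((r' x : ℝ) : ℂ) * cis (φ x)) volume a b :=
    ContinuousOn.intervalIntegrable (by
      rw [hu]; exact (Complex.continuous_ofReal.comp_continuousOn hr').mul hcc)
  have i2 : IntervalIntegrable (fun x => ((r x * φ' x : ℝ) : ℂ) * cis (φ x)) volume a b :=
    ContinuousOn.intervalIntegrable (by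
      rw [hu]; exact (Complex.continuous_ofReal.comp_continuousOn (hrc.mul hφ')).mul hcc)
  have ftc := intervalIntegral.integral_eq_sub_of_hasDerivAt
    (f := fun x => (r x : ℂ) * cis (φ x))
    (f' := fun x => ((r' x : ℝ) : ℂ) * cis (φ x) +
      2 * π * Complex.I * (((r x * φ' x : ℝ) : ℂ) * cis (φ x))) (a := a) (b := b)
    (fun x hx => by
      rw [hu] at hx
      have := ((hr x hx).ofReal_comp).mul ((hφ x hx).cis)
      refine this.congr_deriv ?_
      push_cast
      ring) (i1.add (i2.const_mul _))
  rw [intervalIntegral.integral_add i1 (i2.const_mul _), intervalIntegral.integral_const_mul] at ftc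
  have e1 : ‖∫ x in a..b, ((r' x : ℝ) : ℂ) * cis (φ x)‖ ≤ r b - r a := by
    have hint : IntervalIntegrable r' volume a b :=
      ContinuousOn.intervalIntegrable (by rwa [hu])
    calc ‖∫ x in a..b, ((r' x : ℝ) : ℂ) * cis (φ x)‖ ≤ ∫ x in a..b, r' x := by
          apply intervalIntegral.norm_integral_le_of_norm_le hab _ hint
          refine Filter.Eventually.of_forall fun x hx => ?_
          rw [norm_mul, norm_cis, mul_one, Complex.norm_real, Real.norm_eq_abs,
            abs_of_nonneg (hpos x (Set.Ioc_subset_Icc_self hx))]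
      _ = r b - r a := intervalIntegral.integral_eq_sub_of_hasDerivAt
          (fun x hx => hr x (by rwa [hu] at hx)) hint
  have e2 : ∀ x, ‖(r x : ℂ) * cis (φ x)‖ = |r x| := fun x => by
    rw [norm_mul, norm_cis, mul_one, Complex.norm_real, Real.norm_eq_abs]
  set J := ∫ x in a..b, ((r x * φ' x : ℝ) : ℂ) * cis (φ x)
  set K := ∫ x in a..b, ((r' x : ℝ) : ℂ) * cis (φ x)
  have e3 : 2 * π * Complex.I * J = (r b : ℂ) * cis (φ b) - (r a : ℂ) * cis (φ a) - K := by
    rw [← ftc]; ring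
  have e4 : ‖2 * π * Complex.I * J‖ = 2 * π * ‖J‖ := by
    simp [abs_of_pos Real.pi_pos]
  rw [le_div_iff₀ (by positivity), mul_comm, ← e4, e3]
  calc _ ≤ ‖(r b : ℂ) * cis (φ b)‖ + ‖(r a : ℂ) * cis (φ a)‖ + ‖K‖ :=
        (norm_sub_le _ _).trans (add_le_add_left (norm_sub_le _ _) _)
    _ ≤ _ := by rw [e2, e2]; linarith

/-- First derivative test for a nonnegative increasing amplitude. -/
theorem norm_integral_mul_cis_le_of_nonneg {a b : ℝ} (hab : a ≤ b) {φ φ' r r' : ℝ → ℝ}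
    (hφ : ∀ x ∈ Set.Icc a b, HasDerivAt φ (φ' x) x)
    (hr : ∀ x ∈ Set.Icc a b, HasDerivAt r (r' x) x)
    (hφ' : ContinuousOn φ' (Set.Icc a b)) (hr' : ContinuousOn r' (Set.Icc a b))
    (hpos : ∀ x ∈ Set.Icc a b, 0 ≤ r' x) (ha : 0 ≤ r a) :
    ‖∫ x in a..b, ((r x * φ' x : ℝ) : ℂ) * cis (φ x)‖ ≤ r b / π := by
  have hmono : r a ≤ r b := by
    have hd : MonotoneOn r (Set.Icc a b) := by
      apply monotoneOn_of_deriv_nonneg (convex_Icc a b)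
        (fun x hx => (hr x hx).continuousAt.continuousWithinAt)
        (fun x hx => ((hr x (interior_subset hx)).differentiableAt).differentiableWithinAt)
      intro x hx
      rw [(hr x (interior_subset hx)).deriv]
      exact hpos x (interior_subset hx)
    exact hd (Set.left_mem_Icc.2 hab) (Set.right_mem_Icc.2 hab) hab
  refine (norm_integral_mul_cis_le hab hφ hr hφ' hr' hpos).trans (le_of_eq ?_)
  rw [abs_of_nonneg ha, abs_of_nonneg (ha.trans hmono)]
  field_simp
  ring

lemma norm_integral_gaussian_tail_le {b : ℂ} (hb : 0 < b.re) {U V : ℝ} (hU : 0 < U) (hUV : U ≤ V) :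
    ‖∫ u in U..V, Complex.exp (-b * (u : ℂ) ^ 2)‖ ≤ 1 / (‖b‖ * U) := by
  have hb0 : b ≠ 0 := by rintro rfl; simp at hb
  have hV : 0 < V := hU.trans_le hUV
  have hnb : 0 < ‖b‖ := norm_pos_iff.2 hb0
  have hu : Set.uIcc U V = Set.Icc U V := Set.uIcc_of_le hUV
  have hpos : ∀ x ∈ Set.Icc U V, 0 < x := fun x hx => hU.trans_le hx.1
  have hne : ∀ x ∈ Set.Icc U V, (x : ℂ) ≠ 0 := fun x hx =>
    Complex.ofReal_ne_zero.2 (hpos x hx).ne'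
  have hn : ∀ x : ℝ, ‖Complex.exp (-b * (x : ℂ) ^ 2)‖ ≤ 1 := fun x => by
    rw [Complex.norm_exp, Real.exp_le_one_iff]
    have : (-b * (x : ℂ) ^ 2).re = -(b.re * x ^ 2) := by
      rw [← Complex.ofReal_pow, Complex.re_mul_ofReal]; simp
    rw [this]
    have := mul_nonneg hb.le (sq_nonneg x)
    linarith
  have hc1 : ContinuousOn (fun x : ℝ => Complex.exp (-b * (x : ℂ) ^ 2)) (Set.Icc U V) :=
    Continuous.continuousOn (by fun_prop)
  have hc2 : ContinuousOn (fun x : ℝ => Complex.exp (-b * (x : ℂ) ^ 2) / (2 * b * (x : ℂ) ^ 2))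
      (Set.Icc U V) := by
    apply hc1.div (Continuous.continuousOn (by fun_prop))
    intro x hx
    simp [hb0, hne x hx]
  have i1 : IntervalIntegrable (fun x : ℝ => Complex.exp (-b * (x : ℂ) ^ 2)) volume U V :=
    ContinuousOn.intervalIntegrable (by rwa [hu])
  have i2 : IntervalIntegrable
      (fun x : ℝ => Complex.exp (-b * (x : ℂ) ^ 2) / (2 * b * (x : ℂ) ^ 2)) volume U V :=
    ContinuousOn.intervalIntegrable (by rwa [hu])
  have ftc := intervalIntegral.integral_eq_sub_of_hasDerivAt
    (f := fun x : ℝ => Complex.exp (-b * (x : ℂ) ^ 2) / (-2 * b * (x : ℂ)))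
    (f' := fun x : ℝ => Complex.exp (-b * (x : ℂ) ^ 2) +
      Complex.exp (-b * (x : ℂ) ^ 2) / (2 * b * (x : ℂ) ^ 2)) (a := U) (b := V)
    (fun x hx => by
      rw [hu] at hx
      have h0 := hne x hx
      have hx1 : HasDerivAt (fun y : ℝ => (y : ℂ)) 1 x := Complex.ofRealCLM.hasDerivAt
      have h1 : HasDerivAt (fun y : ℝ => Complex.exp (-b * (y : ℂ) ^ 2)) _ x :=
        ((hx1.pow 2).const_mul (-b)).cexp
      have h2 : HasDerivAt (fun y : ℝ => -2 * b * (y : ℂ)) _ x := hx1.const_mul (-2 * b)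
      refine (h1.div h2 (by simp [hb0, h0])).congr_deriv ?_
      field_simp
      simp
      ring) (i1.add i2)
  rw [intervalIntegral.integral_add i1 i2] at ftc
  have e1 : ‖∫ x in U..V, Complex.exp (-b * (x : ℂ) ^ 2) / (2 * b * (x : ℂ) ^ 2)‖ ≤
      (1 / U - 1 / V) / (2 * ‖b‖) := by
    have hint : IntervalIntegrable (fun x : ℝ => 1 / (2 * ‖b‖) * (1 / x ^ 2)) volume U V :=
      ContinuousOn.intervalIntegrable (by
        rw [hu]
        apply ContinuousOn.mul continuousOn_const
        apply ContinuousOn.div continuousOn_const (by fun_prop)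
        intro x hx
        have := hpos x hx
        positivity)
    calc _ ≤ ∫ x in U..V, 1 / (2 * ‖b‖) * (1 / x ^ 2) := by
          apply intervalIntegral.norm_integral_le_of_norm_le hUV _ hint
          refine Filter.Eventually.of_forall fun x hx => ?_
          have h0 := hpos x (Set.Ioc_subset_Icc_self hx)
          rw [norm_div, norm_mul, norm_mul, norm_pow, Complex.norm_real, Real.norm_of_nonneg h0.le]
          rw [div_mul_div_comm, one_mul]
          simp only [Complex.norm_ofNat]
          gcongr
          exact hn x
      _ = 1 / (2 * ‖b‖) * (-1 / V) - 1 / (2 * ‖b‖) * (-1 / U) :=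
          intervalIntegral.integral_eq_sub_of_hasDerivAt
            (f := fun x => 1 / (2 * ‖b‖) * (-1 / x))
            (fun x hx => by
              rw [hu] at hx
              have h0 := (hpos x hx).ne'
              refine (((hasDerivAt_const x (-1 : ℝ)).div (hasDerivAt_id x) h0).const_mul
                (1 / (2 * ‖b‖))).congr_deriv ?_
              simp) hint
      _ = _ := by field_simp; ring
  have e2 : ∀ x : ℝ, 0 < x → ‖Complex.exp (-b * (x : ℂ) ^ 2) / (-2 * b * (x : ℂ))‖ ≤
      1 / (2 * ‖b‖ * x) := fun x hx => by
    rw [norm_div, norm_mul, norm_mul, Complex.norm_real, Real.norm_of_nonneg hx.le]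
    simp only [norm_neg, Complex.norm_ofNat]
    gcongr
    exact hn x
  rw [← eq_sub_iff_add_eq] at ftc
  rw [ftc]
  calc _ ≤ 1 / (2 * ‖b‖ * V) + 1 / (2 * ‖b‖ * U) + (1 / U - 1 / V) / (2 * ‖b‖) :=
        (norm_sub_le _ _).trans (add_le_add ((norm_sub_le _ _).trans
          (add_le_add (e2 V hV) (e2 U hU))) e1)
    _ = _ := by field_simp; ring

lemma norm_integral_gaussian_sub_le {b : ℂ} (hb : 0 < b.re) {U : ℝ} (hU : 0 < U) :
    ‖(∫ u in (0 : ℝ)..U, Complex.exp (-b * (u : ℂ) ^ 2)) - (π / b) ^ (1 / 2 : ℂ) / 2‖ ≤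
      1 / (‖b‖ * U) := by
  have hint : IntegrableOn (fun u : ℝ => Complex.exp (-b * (u : ℂ) ^ 2)) (Set.Ioi 0) :=
    (integrable_cexp_neg_mul_sq hb).integrableOn
  have lim := intervalIntegral_tendsto_integral_Ioi 0 hint Filter.tendsto_id
  rw [integral_gaussian_complex_Ioi hb] at lim
  have lim2 := (lim.const_sub (∫ u in (0 : ℝ)..U, Complex.exp (-b * (u : ℂ) ^ 2))).norm
  refine le_of_tendsto lim2 ?_
  filter_upwards [Filter.eventually_ge_atTop U] with V hV
  have hi : ∀ x y : ℝ, IntervalIntegrable (fun u : ℝ => Complex.exp (-b * (u : ℂ) ^ 2))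
    volume x y :=
    fun x y => (Continuous.intervalIntegrable (by fun_prop) _ _)
  rw [id, ← intervalIntegral.integral_add_adjacent_intervals (hi 0 U) (hi U V)]
  rw [sub_add_cancel_left, norm_neg]
  exact norm_integral_gaussian_tail_le hb hU hV

/-- The Fresnel integral with an explicit bound for its tail. -/
theorem norm_fresnel_sub_le {U : ℝ} (hU : 0 < U) :
    ‖(∫ u in (0 : ℝ)..U, cis (u ^ 2)) - cis (1 / 8) / (2 * Real.sqrt 2 : ℝ)‖ ≤ 1 / U := by
  set b : ℝ → ℂ := fun η => (η : ℂ) - 2 * π * Complex.I with hbdef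
  have hbc : Continuous b := by fun_prop
  have hre : ∀ η, (b η).re = η := fun η => by simp [b]
  have him : ∀ η, (b η).im = -(2 * π) := fun η => by simp [b]
  have hb1 : ∀ η, 1 ≤ ‖b η‖ := fun η => by
    have := Complex.abs_im_le_norm (b η)
    rw [him, abs_neg, abs_of_pos (by positivity)] at this
    linarith [Real.pi_gt_three]
  have h0 : π / b 0 = ((1 / 2 : ℝ) : ℂ) * Complex.I := by
    have : (π : ℂ) ≠ 0 := Complex.ofReal_ne_zero.2 Real.pi_ne_zero
    simp only [b, Complex.ofReal_zero, zero_sub]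
    rw [div_eq_iff (by simp [this])]
    push_cast
    linear_combination (π : ℂ) * Complex.I_sq
  have hval : (π / b 0) ^ (1 / 2 : ℂ) / 2 = cis (1 / 8) / (2 * Real.sqrt 2 : ℝ) := by
    have h2 : (((1 / 2 : ℝ) : ℂ) * Complex.I) ^ (1 / 2 : ℂ) =
        ((1 / 2 : ℝ) : ℂ) ^ (1 / 2 : ℂ) * Complex.I ^ (1 / 2 : ℂ) := by
      rw [Complex.cpow_def_of_ne_zero (by simp), Complex.log_ofReal_mul (by norm_num)
        Complex.I_ne_zero, add_mul, Complex.exp_add, Complex.cpow_def_of_ne_zero Complex.I_ne_zero,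
        Complex.cpow_def_of_ne_zero (by simp), Complex.ofReal_log (by norm_num)]
    have h3 : ((1 / 2 : ℝ) : ℂ) ^ (1 / 2 : ℂ) = ((Real.sqrt 2)⁻¹ : ℝ) := by
      rw [← Real.sqrt_inv, Real.sqrt_eq_rpow, Complex.ofReal_cpow (by norm_num)]
      norm_num
    have h4 : Complex.I ^ (1 / 2 : ℂ) = cis (1 / 8) := by
      rw [Complex.cpow_def_of_ne_zero Complex.I_ne_zero, Complex.log_I, cis]
      congr 1
      push_cast
      ring
    rw [h0, h2, h3, h4]
    push_cast
    field_simp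
  have hlim1 : Filter.Tendsto (fun η => ∫ u in (0 : ℝ)..U, Complex.exp (-b η * (u : ℂ) ^ 2))
      (nhdsWithin 0 (Set.Ioi 0)) (nhds (∫ u in (0 : ℝ)..U, Complex.exp (-b 0 * (u : ℂ) ^ 2))) := by
    have : Continuous (fun η => ∫ u in (0 : ℝ)..U, Complex.exp (-b η * (u : ℂ) ^ 2)) := by
      apply intervalIntegral.continuous_parametric_intervalIntegral_of_continuous'
      fun_prop
    exact this.continuousAt.tendsto.mono_left nhdsWithin_le_nhds
  have hlim2 : Filter.Tendsto (fun η => (π / b η) ^ (1 / 2 : ℂ) / 2)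
      (nhdsWithin 0 (Set.Ioi 0)) (nhds ((π / b 0) ^ (1 / 2 : ℂ) / 2)) := by
    have hb0 : b 0 ≠ 0 := by
      intro h; have := hb1 0; rw [h] at this; simp at this; linarith
    have : ContinuousAt (fun η => (π / b η) ^ (1 / 2 : ℂ) / 2) 0 := by
      apply ContinuousAt.div_const
      apply ContinuousAt.cpow _ continuousAt_const
      · rw [h0, Complex.mem_slitPlane_iff]; right; simp
      · exact continuousAt_const.div hbc.continuousAt hb0
    exact this.tendsto.mono_left nhdsWithin_le_nhds
  have hcis : ∀ u : ℝ, cis (u ^ 2) = Complex.exp (-b 0 * (u : ℂ) ^ 2) := fun u => by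
    rw [cis]
    congr 1
    simp only [b]
    push_cast
    ring
  simp_rw [hcis]
  rw [← hval]
  refine le_of_tendsto (hlim1.sub hlim2).norm ?_
  filter_upwards [self_mem_nhdsWithin] with η hη
  have hη' : 0 < (b η).re := by rw [hre]; exact hη
  refine (norm_integral_gaussian_sub_le hη' hU).trans ?_
  apply one_div_le_one_div_of_le hU
  nlinarith [hb1 η]

/-- The truncated Fresnel integral. -/
noncomputable def fresnel (U : ℝ) : ℂ := ∫ u in (0 : ℝ)..U, cis (u ^ 2)

/-- The complete Fresnel integral `∫₀^∞ e^{2πiu²} du`. -/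
noncomputable def fresnelConst : ℂ := cis (1 / 8) / (2 * Real.sqrt 2 : ℝ)

lemma hasDerivAt_fresnel (U : ℝ) : HasDerivAt fresnel (cis (U ^ 2)) U := by
  have hc : Continuous fun u : ℝ => cis (u ^ 2) := by fun_prop
  exact intervalIntegral.integral_hasDerivAt_right (hc.intervalIntegrable _ _)
    (hc.stronglyMeasurableAtFilter _ _) hc.continuousAt

lemma fresnel_zero : fresnel 0 = 0 := by simp [fresnel]

lemma fresnel_neg (U : ℝ) : fresnel (-U) = -fresnel U := by
  have := intervalIntegral.integral_comp_neg (a := 0) (b := U) (fun u : ℝ => cis (u ^ 2))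
  simp only [neg_sq, neg_zero] at this
  rw [fresnel, fresnel, this, intervalIntegral.integral_symm]

lemma norm_fresnel_sub_const_le {U : ℝ} (hU : 0 < U) : ‖fresnel U - fresnelConst‖ ≤ 1 / U :=
  norm_fresnel_sub_le hU

lemma hasDerivAt_sub_one_div {s : ℝ} (hs : s ≠ 0) :
    HasDerivAt (fun s : ℝ => s - 1 / s) (1 + 1 / s ^ 2) s := by
  refine ((hasDerivAt_id s).sub ((hasDerivAt_const s (1 : ℝ)).div
    (hasDerivAt_id s) hs)).congr_deriv ?_
  simp
  ring

/-- Normalized stationary phase integral: the stationary point is `s = 1`. -/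
theorem norm_integral_cube_mul_cis_sub_le {D a S : ℝ} (hD : 0 < D) (ha : 0 < a) (ha1 : a < 1)
    (hS : 1 ≤ S) :
    ‖(∫ s in a..S, ((s ^ 3 : ℝ) : ℂ) * cis (D * (s - 1 / s) ^ 2)) -
      ((1 / (2 * Real.sqrt D) : ℝ) : ℂ) * (fresnel (Real.sqrt D * (S - 1 / S)) + fresnelConst)‖ ≤
      1 / (2 * D * (1 / a - a)) + S ^ 2 / (2 * π * D) := by
  have haS : a ≤ S := ha1.le.trans hS
  have hu : Set.uIcc a S = Set.Icc a S := Set.uIcc_of_le haS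
  have hpos : ∀ s ∈ Set.Icc a S, 0 < s := fun s hs => ha.trans_le hs.1
  have hsD : 0 < Real.sqrt D := Real.sqrt_pos.2 hD
  have hsD2 : Real.sqrt D ^ 2 = D := Real.sq_sqrt hD.le
  have hva : 0 < 1 / a - a := by
    have : 1 < 1 / a := by rw [lt_div_iff₀ ha]; linarith
    linarith
  set k : ℝ → ℝ := fun s => (2 * s ^ 5 + 2 * s ^ 4 + 2 * s ^ 3 + s ^ 2 + s) /
    (2 * (s ^ 3 + s ^ 2 + s + 1)) with hk
  set k' : ℝ → ℝ := fun s => (4 * s ^ 7 + 8 * s ^ 6 + 12 * s ^ 5 + 17 * s ^ 4 + 10 * s ^ 3 +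
    6 * s ^ 2 + 2 * s + 1) / (2 * (s ^ 3 + s ^ 2 + s + 1) ^ 2) with hk'
  have hkd : ∀ s ∈ Set.Icc a S, HasDerivAt k (k' s) s := by
    intro s hs
    have h0 := hpos s hs
    have hden : 2 * (s ^ 3 + s ^ 2 + s + 1) ≠ 0 := by positivity
    have h1 : HasDerivAt (fun s : ℝ => 2 * s ^ 5 + 2 * s ^ 4 + 2 * s ^ 3 + s ^ 2 + s)
        (10 * s ^ 4 + 8 * s ^ 3 + 6 * s ^ 2 + 2 * s + 1) s := by
      refine ((((((hasDerivAt_pow 5 s).const_mul 2).add ((hasDerivAt_pow 4 s).const_mul 2)).add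
        ((hasDerivAt_pow 3 s).const_mul 2)).add (hasDerivAt_pow 2 s)).add
        (hasDerivAt_id s)).congr_deriv ?_
      norm_num
      ring
    have h2 : HasDerivAt (fun s : ℝ => 2 * (s ^ 3 + s ^ 2 + s + 1))
        (2 * (3 * s ^ 2 + 2 * s + 1)) s := by
      refine (((((hasDerivAt_pow 3 s).add (hasDerivAt_pow 2 s)).add
        (hasDerivAt_id s)).add_const 1).const_mul 2).congr_deriv ?_
      norm_num
    refine (h1.div h2 hden).congr_deriv ?_
    simp only [k']
    field_simp
    ring
  have hvd : ∀ s ∈ Set.Icc a S, HasDerivAt (fun s : ℝ => s - 1 / s) (1 + 1 / s ^ 2) s :=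
    fun s hs => hasDerivAt_sub_one_div (hpos s hs).ne'
  have hvc : ContinuousOn (fun s : ℝ => s - 1 / s) (Set.Icc a S) :=
    fun s hs => (hvd s hs).continuousAt.continuousWithinAt
  have hkc : ContinuousOn k (Set.Icc a S) :=
    fun s hs => (hkd s hs).continuousAt.continuousWithinAt
  have hv'c : ContinuousOn (fun s : ℝ => 1 + 1 / s ^ 2) (Set.Icc a S) := by
    apply continuousOn_const.add
    apply continuousOn_const.div (by fun_prop)
    intro s hs
    have := hpos s hs
    positivity
  have hk'c : ContinuousOn k' (Set.Icc a S) := by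
    apply ContinuousOn.div (by fun_prop) (by fun_prop)
    intro s hs
    have := hpos s hs
    positivity
  set φ : ℝ → ℝ := fun s => D * (s - 1 / s) ^ 2 with hφ
  set φ' : ℝ → ℝ := fun s => D * (2 * (s - 1 / s) * (1 + 1 / s ^ 2)) with hφ'
  have hφd : ∀ s ∈ Set.Icc a S, HasDerivAt φ (φ' s) s := fun s hs => by
    refine (((hvd s hs).pow 2).const_mul D).congr_deriv ?_
    simp [φ']
  have hφc : ContinuousOn (fun s => cis (φ s)) (Set.Icc a S) :=
    continuous_cis.comp_continuousOn (fun s hs => (hφd s hs).continuousAt.continuousWithinAt)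
  have hφ'c : ContinuousOn φ' (Set.Icc a S) := (continuousOn_const.mul
    ((continuousOn_const.mul hvc).mul hv'c))
  have key := norm_integral_mul_cis_le_of_nonneg haS (r := fun s => k s / (2 * D))
    (r' := fun s => k' s / (2 * D)) hφd (fun s hs => (hkd s hs).div_const _) hφ'c
    (hk'c.div_const _) (fun s hs => by have := hpos s hs; positivity) (by positivity)
  have i1 : IntervalIntegrable (fun s => ((1 + 1 / s ^ 2 : ℝ) : ℂ) * cis (φ s)) volume a S :=
    ContinuousOn.intervalIntegrable (by
      rw [hu]; exact (Complex.continuous_ofReal.comp_continuousOn hv'c).mul hφc)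
  have i2 : IntervalIntegrable (fun s => ((k s / (2 * D) * φ' s : ℝ) : ℂ) * cis (φ s))
      volume a S :=
    ContinuousOn.intervalIntegrable (by
      rw [hu]
      exact (Complex.continuous_ofReal.comp_continuousOn ((hkc.div_const _).mul hφ'c)).mul hφc)
  have split : (∫ s in a..S, ((s ^ 3 : ℝ) : ℂ) * cis (φ s)) =
      ((1 / 2 : ℝ) : ℂ) * (∫ s in a..S, ((1 + 1 / s ^ 2 : ℝ) : ℂ) * cis (φ s)) +
      ∫ s in a..S, ((k s / (2 * D) * φ' s : ℝ) : ℂ) * cis (φ s) := by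
    rw [← intervalIntegral.integral_const_mul, ← intervalIntegral.integral_add (i1.const_mul _) i2]
    apply intervalIntegral.integral_congr
    intro s hs
    rw [hu] at hs
    have h0 := hpos s hs
    have : s ^ 3 = 1 / 2 * (1 + 1 / s ^ 2) + k s / (2 * D) * φ' s := by
      simp only [k, φ']
      field_simp
      ring
    simp only
    rw [this]
    push_cast
    ring
  have ftc : (∫ s in a..S, ((1 + 1 / s ^ 2 : ℝ) : ℂ) * cis (φ s)) =
      ((1 / Real.sqrt D : ℝ) : ℂ) * fresnel (Real.sqrt D * (S - 1 / S)) -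
      ((1 / Real.sqrt D : ℝ) : ℂ) * fresnel (Real.sqrt D * (a - 1 / a)) := by
    apply intervalIntegral.integral_eq_sub_of_hasDerivAt
      (f := fun s => ((1 / Real.sqrt D : ℝ) : ℂ) * fresnel (Real.sqrt D * (s - 1 / s))) _ i1
    intro s hs
    rw [hu] at hs
    have h1 := (hasDerivAt_fresnel (Real.sqrt D * (s - 1 / s))).scomp s
      ((hvd s hs).const_mul (Real.sqrt D))
    refine (h1.const_mul ((1 / Real.sqrt D : ℝ) : ℂ)).congr_deriv ?_
    have e1 : (Real.sqrt D * (s - 1 / s)) ^ 2 = φ s := by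
      simp only [φ]; rw [mul_pow, hsD2]
    rw [e1, Complex.real_smul, ← mul_assoc, ← Complex.ofReal_mul]
    congr 2
    field_simp
  have hk1 : k S ≤ S ^ 2 := by
    simp only [k]
    rw [div_le_iff₀ (by positivity)]
    nlinarith
  have tail : ‖fresnel (Real.sqrt D * (a - 1 / a)) + fresnelConst‖ ≤
      1 / (Real.sqrt D * (1 / a - a)) := by
    have := norm_fresnel_sub_const_le (U := Real.sqrt D * (1 / a - a)) (by positivity)
    rwa [← norm_neg, neg_sub, sub_eq_add_neg, ← fresnel_neg, add_comm,
      show -(Real.sqrt D * (1 / a - a)) = Real.sqrt D * (a - 1 / a) by ring] at this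
  rw [split, ftc]
  have e5 : ∀ P Q R c : ℂ, ((1 / 2 : ℝ) : ℂ) * (((1 / Real.sqrt D : ℝ) : ℂ) * P -
      ((1 / Real.sqrt D : ℝ) : ℂ) * Q) + R - ((1 / (2 * Real.sqrt D) : ℝ) : ℂ) * (P + c) =
      R - ((1 / (2 * Real.sqrt D) : ℝ) : ℂ) * (Q + c) := by
    intro P Q R c
    have : ((1 / (2 * Real.sqrt D) : ℝ) : ℂ) = ((1 / 2 : ℝ) : ℂ) * ((1 / Real.sqrt D : ℝ) : ℂ) := by
      rw [← Complex.ofReal_mul]; congr 1; field_simp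
    rw [this]
    ring
  rw [e5]
  refine (norm_sub_le _ _).trans ?_
  rw [add_comm]
  apply add_le_add
  · rw [norm_mul, Complex.norm_real, Real.norm_of_nonneg (by positivity)]
    calc _ ≤ 1 / (2 * Real.sqrt D) * (1 / (Real.sqrt D * (1 / a - a))) := by gcongr
      _ = 1 / (2 * (Real.sqrt D) ^ 2 * (1 / a - a)) := by
          rw [div_mul_div_comm, one_mul]; congr 1; ring
      _ = _ := by rw [hsD2]
  · refine key.trans ?_
    rw [div_div, div_le_div_iff₀ (by positivity) (by positivity)]
    nlinarith [mul_le_mul_of_nonneg_right hk1 (show 0 ≤ 2 * π * D by positivity)]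

lemma continuous_two_mul_mul_cis (A B : ℝ) :
    Continuous fun x : ℝ => ((2 * x : ℝ) : ℂ) * cis (A / x + B * x) := by
  rw [continuous_iff_continuousAt]
  intro x
  by_cases hx : x = 0
  · subst hx
    have h1 : Filter.Tendsto (fun x : ℝ => ((2 * x : ℝ) : ℂ) * cis (A / x + B * x))
        (nhds 0) (nhds 0) := by
      apply squeeze_zero_norm (a := fun x : ℝ => ‖((2 * x : ℝ) : ℂ)‖)
      · intro x
        rw [norm_mul, norm_cis, mul_one]
      · have : Continuous fun x : ℝ => ‖((2 * x : ℝ) : ℂ)‖ := by fun_prop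
        simpa using this.tendsto 0
    simpa [ContinuousAt] using h1
  · apply ContinuousAt.mul (by fun_prop)
    apply continuous_cis.continuousAt.comp
    exact (continuousAt_const.div continuousAt_id hx).add (by fun_prop)

/-- Stationary phase for `∫₀^X 2x e^{2πi(A/x+Bx)} dx` with the stationary point in range. -/
theorem norm_integral_two_mul_mul_cis_sub_le {A B X x₀ D S : ℝ} (hB : 0 < B)
    (hx₀ : 0 < x₀) (hA : A = x₀ ^ 2 * B) (hD : D = x₀ * B) (hS : 1 ≤ S) (hX : X = x₀ * S ^ 2) :
    ‖(∫ x in (0 : ℝ)..X, ((2 * x : ℝ) : ℂ) * cis (A / x + B * x)) -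
      ((2 * x₀ ^ 2 / Real.sqrt D : ℝ) : ℂ) * cis (2 * D) *
        (fresnel (Real.sqrt D * (S - 1 / S)) + fresnelConst)‖ ≤ X / B := by
  have hDpos : 0 < D := by rw [hD]; positivity
  set g : ℝ → ℂ := fun x => ((2 * x : ℝ) : ℂ) * cis (A / x + B * x) with hg
  have hgc : Continuous g := continuous_two_mul_mul_cis A B
  set W : ℂ := ((2 * x₀ ^ 2 / Real.sqrt D : ℝ) : ℂ) * cis (2 * D) *
        (fresnel (Real.sqrt D * (S - 1 / S)) + fresnelConst) with hW
  have main : ∀ a : ℝ, 0 < a → a < 1 → ‖(∫ x in (x₀ * a ^ 2)..X, g x) - W‖ ≤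
      4 * x₀ ^ 2 * (a / (2 * D * (1 - a ^ 2)) + S ^ 2 / (2 * π * D)) := by
    intro a ha ha1
    have sub : (∫ x in (x₀ * a ^ 2)..X, g x) = ∫ s in a..S,
        (((4 * x₀ ^ 2 : ℝ) : ℂ) * cis (2 * D)) *
          (((s ^ 3 : ℝ) : ℂ) * cis (D * (s - 1 / s) ^ 2)) := by
      have := intervalIntegral.integral_deriv_smul_comp (a := a) (b := S)
        (f := fun s => x₀ * s ^ 2) (f' := fun s => x₀ * (2 * s)) (g := g)
        (fun s _ => by simpa using (hasDerivAt_pow 2 s).const_mul x₀)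
        (by fun_prop) hgc
      rw [hX, ← this]
      apply intervalIntegral.integral_congr
      intro s hs
      have hs0 : 0 < s := by
        rw [Set.uIcc_of_le (ha1.le.trans hS)] at hs
        exact ha.trans_le hs.1
      simp only [Function.comp, g, Complex.real_smul]
      have e : A / (x₀ * s ^ 2) + B * (x₀ * s ^ 2) = 2 * D + D * (s - 1 / s) ^ 2 := by
        rw [hA, hD]; field_simp; ring
      rw [e, cis_add]
      push_cast
      ring
    have h1 := norm_integral_cube_mul_cis_sub_le hDpos ha ha1 hS
    have e2 : (∫ x in (x₀ * a ^ 2)..X, g x) - W = (((4 * x₀ ^ 2 : ℝ) : ℂ) * cis (2 * D)) *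
        ((∫ s in a..S, ((s ^ 3 : ℝ) : ℂ) * cis (D * (s - 1 / s) ^ 2)) -
      ((1 / (2 * Real.sqrt D) : ℝ) : ℂ) *
        (fresnel (Real.sqrt D * (S - 1 / S)) + fresnelConst)) := by
      rw [sub, intervalIntegral.integral_const_mul, hW]
      have : ((2 * x₀ ^ 2 / Real.sqrt D : ℝ) : ℂ) =
          ((4 * x₀ ^ 2 : ℝ) : ℂ) * ((1 / (2 * Real.sqrt D) : ℝ) : ℂ) := by
        rw [← Complex.ofReal_mul]; congr 1; field_simp; ring
      rw [this]
      ring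
    rw [e2, norm_mul, norm_mul, norm_cis, Complex.norm_real, Real.norm_of_nonneg (by positivity),
      mul_one]
    have e3 : 1 / (2 * D * (1 / a - a)) = a / (2 * D * (1 - a ^ 2)) := by
      have : 1 / a - a = (1 - a ^ 2) / a := by field_simp
      rw [this, mul_div_assoc', one_div_div]
    rw [← e3]
    gcongr
  have lim1 : Filter.Tendsto (fun a : ℝ => ‖(∫ x in (x₀ * a ^ 2)..X, g x) - W‖)
      (nhdsWithin 0 (Set.Ioi 0)) (nhds ‖(∫ x in (0 : ℝ)..X, g x) - W‖) := by
    have hc : Continuous fun a : ℝ => ‖(∫ x in (x₀ * a ^ 2)..X, g x) - W‖ := by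
      have h1 : Continuous fun y : ℝ => ∫ x in y..X, g x := by
        have := intervalIntegral.continuous_primitive (μ := volume)
          (fun a b => hgc.intervalIntegrable a b) X
        simp_rw [fun y : ℝ => intervalIntegral.integral_symm (f := g) (μ := volume) X y]
        exact this.neg
      have h2 := h1.comp (show Continuous fun a : ℝ => x₀ * a ^ 2 by fun_prop)
      exact (h2.sub continuous_const).norm
    have := hc.tendsto 0
    simp only [ne_eq, OfNat.ofNat_ne_zero, not_false_eq_true, zero_pow, mul_zero] at this
    exact this.mono_left nhdsWithin_le_nhds
  have lim2 : Filter.Tendsto (fun a : ℝ => 4 * x₀ ^ 2 *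
      (a / (2 * D * (1 - a ^ 2)) + S ^ 2 / (2 * π * D)))
      (nhdsWithin 0 (Set.Ioi 0)) (nhds (4 * x₀ ^ 2 * (0 + S ^ 2 / (2 * π * D)))) := by
    have hc : ContinuousAt (fun a : ℝ => 4 * x₀ ^ 2 *
      (a / (2 * D * (1 - a ^ 2)) + S ^ 2 / (2 * π * D))) 0 := by
      apply ContinuousAt.mul (by fun_prop)
      apply ContinuousAt.add _ (by fun_prop)
      apply ContinuousAt.div (by fun_prop) (by fun_prop)
      simp [hDpos.ne']
    have := hc.tendsto
    simp only [zero_div] at this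
    exact this.mono_left nhdsWithin_le_nhds
  have lim := le_of_tendsto_of_tendsto lim1 lim2 (by
    filter_upwards [Ioo_mem_nhdsGT (show (0 : ℝ) < 1 by norm_num)] with a ha
    exact main a ha.1 ha.2)
  refine lim.trans ?_
  rw [hD, hX, zero_add, mul_div_assoc', div_le_div_iff₀ (by positivity) hB]
  nlinarith [Real.two_le_pi, show 0 < x₀ ^ 2 * S ^ 2 * B by positivity]

/-- The stationary phase main term. -/
noncomputable def statMain (h k : ℕ) (t : ℝ) : ℂ :=
  ((2 * (h : ℝ) ^ (3 / 4 : ℝ) * t ^ (3 / 4 : ℝ) * (k : ℝ) ^ (-(5 / 4) : ℝ) : ℝ) : ℂ) *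
    cis (1 / 8) * cis (Real.sqrt (h * k * t))

/-- The weight of a stationary point, one half if it sits at the end of the range. -/
noncomputable def endWeight (m : ℕ) : ℝ := if m = 0 then 1 / 2 else 1

/-- The oscillatory integral attached to the frequencies `(h, m)`. -/
noncomputable def phaseInt (t : ℝ) (h : ℕ) (m : ℤ) : ℂ :=
  ∫ x in (0 : ℝ)..Real.sqrt t, ((2 * x : ℝ) : ℂ) *
    cis ((h * t / 2 : ℝ) / x + (h / 2 + m : ℝ) * x)

theorem norm_phaseInt_sub_le {t : ℝ} (ht : 0 < t) {h : ℕ} (hh : 1 ≤ h) (m : ℕ) :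
    ‖phaseInt t h m - endWeight m * statMain h (h + 2 * m) t‖ ≤
      5 * Real.sqrt t / max (m : ℝ) 1 := by
  have hh1 : (1 : ℝ) ≤ h := by exact_mod_cast hh
  have hh0 : (0 : ℝ) < h := by linarith
  have hm0 : (0 : ℝ) ≤ m := Nat.cast_nonneg m
  set k : ℝ := h + 2 * m with hk
  have hk0 : 0 < k := by positivity
  have hX0 : 0 < Real.sqrt t := Real.sqrt_pos.2 ht
  have hXX : Real.sqrt t ^ 2 = t := Real.sq_sqrt ht.le
  set q : ℝ := k / h with hq
  have hq1 : 1 ≤ q := by rw [hq, le_div_iff₀ hh0]; linarith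
  have hq0 : 0 < q := by linarith
  set S : ℝ := q ^ (1 / 4 : ℝ) with hS
  have hS1 : 1 ≤ S := Real.one_le_rpow hq1 (by norm_num)
  have hS0 : 0 < S := by linarith
  have hS4 : S ^ 4 = q := by
    rw [hS, ← Real.rpow_natCast, ← Real.rpow_mul hq0.le]; norm_num
  set x₀ : ℝ := Real.sqrt t / S ^ 2 with hx₀
  have hx₀0 : 0 < x₀ := by positivity
  set B : ℝ := h / 2 + m with hB
  have hBk : B = k / 2 := by rw [hB, hk]; ring
  have hB0 : 0 < B := by rw [hBk]; positivity
  have hkS : k = h * S ^ 4 := by rw [hS4, hq]; field_simp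
  have hA : h * t / 2 = x₀ ^ 2 * B := by
    rw [hx₀, div_pow, hXX, hBk, hkS]; field_simp
  have hD0 : 0 < x₀ * B := by positivity
  have key := norm_integral_two_mul_mul_cis_sub_le (X := Real.sqrt t) hB0 hx₀0 hA rfl hS1
    (by rw [hx₀]; field_simp)
  set D : ℝ := x₀ * B with hD
  clear_value D
  have hDS : 2 * D = Real.sqrt t * (h * S ^ 2) := by
    rw [hD, hx₀, hBk, hkS]; field_simp
  have hDsq : 2 * D = Real.sqrt (h * k * t) := by
    symm
    rw [Real.sqrt_eq_iff_mul_self_eq (by positivity) (by positivity), hDS, hkS]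
    rw [show Real.sqrt t * (h * S ^ 2) * (Real.sqrt t * (h * S ^ 2)) =
      Real.sqrt t ^ 2 * (h * S ^ 2) ^ 2 by ring, hXX]
    ring
  have hamp : 2 * x₀ ^ 2 / Real.sqrt D * (1 / (2 * Real.sqrt 2)) =
      (h : ℝ) ^ (3 / 4 : ℝ) * t ^ (3 / 4 : ℝ) * k ^ (-(5 / 4) : ℝ) := by
    have e1 : 2 * x₀ ^ 2 / Real.sqrt D * (1 / (2 * Real.sqrt 2)) = x₀ ^ 2 / Real.sqrt (2 * D) := by
      rw [Real.sqrt_mul (zero_le_two) D]; field_simp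
    have e2 : x₀ ^ 2 = t * h / k := by
      rw [hx₀, div_pow, hXX, hkS]; field_simp
    have e3 : Real.sqrt (2 * D) = (h : ℝ) ^ (1 / 4 : ℝ) * k ^ (1 / 4 : ℝ) * t ^ (1 / 4 : ℝ) := by
      rw [hDsq, Real.sqrt_eq_rpow, Real.sqrt_eq_rpow, ← Real.rpow_mul (by positivity),
        Real.mul_rpow (by positivity) ht.le, Real.mul_rpow hh0.le hk0.le]
      norm_num
    rw [e1, e2, e3, show (3 / 4 : ℝ) = 1 - 1 / 4 by norm_num, show -(5 / 4 : ℝ) = -1 - 1 / 4 by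
      norm_num, Real.rpow_sub hh0, Real.rpow_sub ht, Real.rpow_sub hk0, Real.rpow_one,
      Real.rpow_one, Real.rpow_neg_one]
    field_simp
  have hmain : statMain h (h + 2 * m) t = ((2 * x₀ ^ 2 / Real.sqrt D : ℝ) : ℂ) * cis (2 * D) *
      (2 * fresnelConst) := by
    have e4 : fresnelConst = cis (1 / 8) * ((1 / (2 * Real.sqrt 2) : ℝ) : ℂ) := by
      rw [fresnelConst, div_eq_mul_inv, ← Complex.ofReal_inv, one_div, one_div]
    have e5 : ((2 * x₀ ^ 2 / Real.sqrt D : ℝ) : ℂ) * cis (2 * D) * (2 * fresnelConst) =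
      2 * ((2 * x₀ ^ 2 / Real.sqrt D * (1 / (2 * Real.sqrt 2)) : ℝ) : ℂ) * cis (1 / 8) *
        cis (2 * D) := by
      rw [e4]; push_cast; ring
    rw [e5, hamp, hDsq, statMain]
    push_cast
    rw [hk]
    ring
  clear_value B x₀ S q
  have hJ : phaseInt t h m = ∫ x in (0 : ℝ)..Real.sqrt t, ((2 * x : ℝ) : ℂ) *
      cis (h * t / 2 / x + B * x) := by
    simp [phaseInt, hB]
  rw [hJ]
  rcases Nat.eq_zero_or_pos m with rfl | hm
  · have hS_one : S = 1 := by
      rw [hS, hq, hk]; simp [hh0.ne']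
    rw [hS_one] at key
    simp only [endWeight, if_true] 
    rw [hmain]
    refine le_trans (le_of_eq ?_) (key.trans ?_)
    · congr 2
      simp [fresnel_zero]
      ring
    · rw [hBk, hk]
      simp only [CharP.cast_eq_zero, mul_zero, add_zero]
      rw [max_eq_right (by norm_num), div_div_eq_mul_div, div_le_div_iff₀ hh0 (by norm_num)]
      nlinarith
  · have hm1 : (1 : ℝ) ≤ m := by exact_mod_cast hm
    rw [max_eq_left hm1]
    have hSgt : 0 < S - 1 / S := by
      have : 1 < S := by
        rw [hS]
        refine Real.one_lt_rpow ?_ (by norm_num)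
        rw [hq, lt_div_iff₀ hh0]; linarith
      have : 1 / S < 1 := by rw [div_lt_one hS0]; exact this
      linarith
    have tail := norm_fresnel_sub_const_le (U := Real.sqrt D * (S - 1 / S))
      (mul_pos (Real.sqrt_pos.2 hD0) hSgt)
    have hw : endWeight m = 1 := by simp [endWeight, hm.ne']
    rw [hmain, hw]
    set J := ∫ x in (0 : ℝ)..Real.sqrt t, ((2 * x : ℝ) : ℂ) * cis (h * t / 2 / x + B * x)
    set F := fresnel (Real.sqrt D * (S - 1 / S))
    set P := ((2 * x₀ ^ 2 / Real.sqrt D : ℝ) : ℂ) * cis (2 * D) with hP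
    have hPn : ‖P‖ = 2 * x₀ ^ 2 / Real.sqrt D := by
      rw [hP, norm_mul, norm_cis, Complex.norm_real, Real.norm_of_nonneg (by positivity), mul_one]
    have e6 : J - (1 : ℝ) * (P * (2 * fresnelConst)) =
        (J - P * (F + fresnelConst)) + P * (F - fresnelConst) := by
      push_cast; ring
    rw [e6]
    refine (norm_add_le _ _).trans ?_
    have b1 : Real.sqrt t / B ≤ Real.sqrt t / m := by
      gcongr
      rw [hB]; linarith
    have b2 : ‖P * (F - fresnelConst)‖ ≤ 4 * Real.sqrt t / m := by
      rw [norm_mul, hPn]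
      calc _ ≤ 2 * x₀ ^ 2 / Real.sqrt D * (1 / (Real.sqrt D * (S - 1 / S))) := by gcongr
        _ = 2 * x₀ ^ 2 / (D * (S - 1 / S)) := by
            rw [div_mul_div_comm, mul_one, ← mul_assoc, Real.mul_self_sqrt hD0.le]
        _ ≤ 4 * Real.sqrt t / m := by
            have e7 : S - 1 / S = (S ^ 2 - 1) / S := by field_simp
            have e8 : (m : ℝ) = h * (S ^ 2 - 1) * (S ^ 2 + 1) / 2 := by
              have : k = h + 2 * m := hk
              rw [hkS] at this
              linarith
            have hSm : 0 < S ^ 2 - 1 := by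
              rw [e7] at hSgt
              by_contra hcon
              push Not at hcon
              exact absurd hSgt (not_lt.2 (div_nonpos_of_nonpos_of_nonneg hcon hS0.le))
            have e9 : 2 * x₀ ^ 2 / (D * (S - 1 / S)) =
                4 * Real.sqrt t / (h * S ^ 5 * (S ^ 2 - 1)) := by
              have : D = x₀ * B := hD
              rw [e7, this, hBk, hkS, hx₀]; field_simp; ring
            rw [e9, e8]
            have : S ^ 2 + 1 ≤ 2 * S ^ 5 := by
              have h2 : S ^ 2 ≤ S ^ 5 := pow_le_pow_right₀ hS1 (by norm_num)
              have h3 : 1 ≤ S ^ 5 := one_le_pow₀ hS1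
              linarith
            gcongr
            nlinarith [mul_pos hh0 hSm]
    calc _ ≤ Real.sqrt t / m + 4 * Real.sqrt t / m := add_le_add (key.trans b1) b2
      _ = _ := by ring

theorem norm_integral_two_mul_mul_cis_le {A B X : ℝ} (hX : 0 < X) (hA : 0 < A)
    (hAB : B * X ^ 2 < A) :
    ‖∫ x in (0 : ℝ)..X, ((2 * x : ℝ) : ℂ) * cis (A / x + B * x)‖ ≤
      2 * X ^ 3 / (A - B * X ^ 2) := by
  apply le_of_forall_pos_le_add
  intro ε hε
  set g : ℝ → ℂ := fun x => ((2 * x : ℝ) : ℂ) * cis (A / x + B * x) with hg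
  have hgc : Continuous g := continuous_two_mul_mul_cis A B
  set a : ℝ := min X (min 1 ε) with ha
  have ha0 : 0 < a := lt_min hX (lt_min one_pos hε)
  have haX : a ≤ X := min_le_left _ _
  have ha1 : a ≤ 1 := (min_le_right _ _).trans (min_le_left _ _)
  have haε : a ≤ ε := (min_le_right _ _).trans (min_le_right _ _)
  have h1 : ‖∫ x in (0 : ℝ)..a, g x‖ ≤ ∫ x in (0 : ℝ)..a, 2 * x := by
    refine intervalIntegral.norm_integral_le_of_norm_le ha0.le ?_
      ((by fun_prop : Continuous fun x : ℝ => 2 * x).intervalIntegrable _ _)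
    filter_upwards with x hx
    rw [norm_mul, norm_cis, mul_one, Complex.norm_real, Real.norm_of_nonneg (by linarith [hx.1])]
  have h2 : ∫ x in (0 : ℝ)..a, 2 * x = a ^ 2 := by
    rw [intervalIntegral.integral_const_mul, integral_id]; ring
  have hneg : ∀ x ∈ Set.Icc a X, 0 < A - B * x ^ 2 := by
    intro x hx
    have hx0 : 0 < x := ha0.trans_le hx.1
    have : x ^ 2 ≤ X ^ 2 := by gcongr; exact hx.2
    rcases le_or_gt 0 B with hB | hB
    · nlinarith
    · nlinarith [sq_nonneg x]
  set φ : ℝ → ℝ := fun x => -(A / x + B * x) with hφ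
  set φ' : ℝ → ℝ := fun x => (A - B * x ^ 2) / x ^ 2 with hφ'
  have hφd : ∀ x ∈ Set.Icc a X, HasDerivAt φ (φ' x) x := by
    intro x hx
    have hx0 : x ≠ 0 := (ha0.trans_le hx.1).ne'
    refine (((hasDerivAt_const x A).div (hasDerivAt_id x) hx0).add
      ((hasDerivAt_id x).const_mul B)).neg.congr_deriv ?_
    simp [φ']
    field_simp
    ring
  have hrd : ∀ x ∈ Set.Icc a X, HasDerivAt (fun x => 2 * x ^ 3 / (A - B * x ^ 2))
      ((6 * A * x ^ 2 - 2 * B * x ^ 4) / (A - B * x ^ 2) ^ 2) x := by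
    intro x hx
    refine (((hasDerivAt_pow 3 x).const_mul 2).div (((hasDerivAt_pow 2 x).const_mul B).const_sub A)
      (hneg x hx).ne').congr_deriv ?_
    congr 1
    norm_num
    ring
  have key := norm_integral_mul_cis_le_of_nonneg haX hφd hrd
    (ContinuousOn.div (by fun_prop) (by fun_prop)
      fun x hx => (pow_pos (ha0.trans_le hx.1) 2).ne')
    (ContinuousOn.div (by fun_prop) (by fun_prop) fun x hx => (pow_pos (hneg x hx) 2).ne')
    (fun x hx => by
      have := hneg x hx
      have hx0 : 0 < x := ha0.trans_le hx.1
      have : 0 ≤ 6 * A * x ^ 2 - 2 * B * x ^ 4 := by nlinarith [pow_pos hx0 2]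
      positivity)
    (by have := hneg a ⟨le_rfl, haX⟩; positivity)
  have e : ‖∫ x in a..X, g x‖ = ‖∫ x in a..X, ((2 * x ^ 3 / (A - B * x ^ 2) * φ' x : ℝ) : ℂ) *
      cis (φ x)‖ := by
    rw [← RCLike.norm_conj (∫ x in a..X, g x)]
    congr 1
    rw [intervalIntegral.integral_of_le haX, ← integral_conj, ← intervalIntegral.integral_of_le haX]
    apply intervalIntegral.integral_congr
    intro x hx
    rw [Set.uIcc_of_le haX] at hx
    have hx0 : 0 < x := ha0.trans_le hx.1
    have hne : A - B * x ^ 2 ≠ 0 := (hneg x hx).ne'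
    simp only [g, φ, cis_neg, map_mul, Complex.conj_ofReal]
    congr 2
    simp only [φ']
    rw [div_mul_div_comm, eq_div_iff (mul_ne_zero hne (pow_ne_zero 2 hx0.ne'))]
    ring
  have hsum : ∫ x in (0 : ℝ)..X, g x = (∫ x in (0 : ℝ)..a, g x) + ∫ x in a..X, g x :=
    (intervalIntegral.integral_add_adjacent_intervals (hgc.intervalIntegrable _ _)
      (hgc.intervalIntegrable _ _)).symm
  rw [hsum]
  refine (norm_add_le _ _).trans ?_
  rw [add_comm, e]
  apply add_le_add
  · refine key.trans (div_le_self ?_ (by linarith [Real.two_le_pi]))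
    have := hneg X ⟨haX, le_rfl⟩
    positivity
  · refine h1.trans ?_
    rw [h2]
    nlinarith

theorem norm_phaseInt_neg_le {t : ℝ} (ht : 0 < t) {h : ℕ} (hh : 1 ≤ h) {m : ℕ} (hm : 1 ≤ m) :
    ‖phaseInt t h (-m)‖ ≤ 2 * Real.sqrt t / m := by
  have hh1 : (1 : ℝ) ≤ h := by exact_mod_cast hh
  have hm1 : (1 : ℝ) ≤ m := by exact_mod_cast hm
  have hX0 : 0 < Real.sqrt t := Real.sqrt_pos.2 ht
  have hXX : Real.sqrt t ^ 2 = t := Real.sq_sqrt ht.le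
  have key := norm_integral_two_mul_mul_cis_le (A := h * t / 2) (B := h / 2 + (-(m : ℤ) : ℤ)) hX0
    (by positivity) (by
      rw [hXX]; push_cast; nlinarith)
  refine key.trans (le_of_eq ?_)
  rw [hXX]
  have : (h : ℝ) * t / 2 - (h / 2 + (-(m : ℤ) : ℤ)) * t = m * Real.sqrt t ^ 2 := by
    rw [hXX]; push_cast; ring
  rw [this]
  field_simp

lemma sum_range_sum_range_int_sub (f : ℤ → ℂ) (M : ℕ) :
    ∑ i ∈ Finset.range M, ∑ j ∈ Finset.range M, f ((i : ℤ) - j) =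
      ∑ m ∈ Finset.range M, ((M : ℂ) - m) * f m +
        ∑ m ∈ Finset.range M, ((M : ℂ) - (m + 1)) * f (-((m + 1 : ℕ) : ℤ)) := by
  induction M with
  | zero => simp
  | succ M ih =>
    have h1 : ∑ j ∈ Finset.range (M + 1), f ((M : ℤ) - j) = ∑ m ∈ Finset.range (M + 1), f m := by
      rw [← Finset.sum_range_reflect]
      apply Finset.sum_congr rfl
      intro j hj
      have := Finset.mem_range.1 hj
      congr 1
      omega
    have h2 : ∑ i ∈ Finset.range M, f ((i : ℤ) - M) =
        ∑ m ∈ Finset.range M, f (-((m + 1 : ℕ) : ℤ)) := by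
      rw [← Finset.sum_range_reflect]
      apply Finset.sum_congr rfl
      intro j hj
      have := Finset.mem_range.1 hj
      congr 1
      omega
    rw [Finset.sum_range_succ, h1]
    simp_rw [Finset.sum_range_succ (fun j => f ((_ : ℤ) - j)) M]
    rw [Finset.sum_add_distrib, ih, h2]
    have h3 : ∑ m ∈ Finset.range (M + 1), (((M + 1 : ℕ) : ℂ) - m) * f m =
        ∑ m ∈ Finset.range M, ((M : ℂ) - m) * f m + ∑ m ∈ Finset.range (M + 1), f m := by
      have : ∑ m ∈ Finset.range M, ((M : ℂ) - m) * f m =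
          ∑ m ∈ Finset.range (M + 1), ((M : ℂ) - m) * f m := by
        rw [Finset.sum_range_succ]; simp
      rw [this, ← Finset.sum_add_distrib]
      apply Finset.sum_congr rfl
      intro m _
      push_cast
      ring
    have h4 : ∑ m ∈ Finset.range (M + 1),
        (((M + 1 : ℕ) : ℂ) - (m + 1)) * f (-((m + 1 : ℕ) : ℤ)) =
        ∑ m ∈ Finset.range M, ((M : ℂ) - (m + 1)) * f (-((m + 1 : ℕ) : ℤ)) +
          ∑ m ∈ Finset.range M, f (-((m + 1 : ℕ) : ℤ)) := by
      rw [Finset.sum_range_succ, ← Finset.sum_add_distrib]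
      have : ∀ z : ℂ, (((M + 1 : ℕ) : ℂ) - (M + 1)) * z = 0 := by
        intro z; push_cast; ring
      rw [this, add_zero]
      apply Finset.sum_congr rfl
      intro m _
      push_cast
      ring
    rw [h3, h4]
    ring

/-- The Fejér kernel of period one. -/
noncomputable def fejer (M : ℕ) (x : ℝ) : ℝ :=
  ‖∑ j ∈ Finset.range M, cis (j * x)‖ ^ 2 / M

lemma fejer_nonneg (M : ℕ) (x : ℝ) : 0 ≤ fejer M x := by unfold fejer; positivity

@[fun_prop]
lemma continuous_fejer (M : ℕ) : Continuous (fejer M) := by unfold fejer; fun_prop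

lemma fejer_sub_nat (M : ℕ) (x : ℝ) (n : ℕ) : fejer M (x - n) = fejer M x := by
  unfold fejer
  congr 3
  apply Finset.sum_congr rfl
  intro j _
  rw [show (j : ℝ) * (x - n) = j * x + ((-(j * n : ℕ) : ℤ) : ℝ) by push_cast; ring, cis_add_int]

lemma fejer_eq (M : ℕ) (x : ℝ) : (fejer M x : ℂ) =
    (∑ i ∈ Finset.range M, ∑ j ∈ Finset.range M, cis (((i : ℤ) - j : ℤ) * x)) / M := by
  rw [fejer]
  push_cast
  congr 1
  rw [← Complex.mul_conj', map_sum, Finset.sum_mul_sum]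
  refine Finset.sum_congr rfl fun i _ => Finset.sum_congr rfl fun j _ => ?_
  rw [← cis_neg, ← cis_add]
  congr 1
  ring

lemma integral_cis_int_mul (m : ℤ) (a : ℝ) :
    ∫ x in a..(a + 1), cis (m * x) = if m = 0 then 1 else 0 := by
  split_ifs with hm
  · simp [hm, cis_zero]
  · have hne : (2 * π * Complex.I * (m : ℂ)) ≠ 0 := by
      have : (m : ℂ) ≠ 0 := by exact_mod_cast hm
      have hp : (π : ℂ) ≠ 0 := by exact_mod_cast Real.pi_ne_zero
      simp [this, hp]
    rw [intervalIntegral.integral_eq_sub_of_hasDerivAt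
      (f := fun x => cis (m * x) / (2 * π * Complex.I * (m : ℂ)))]
    · rw [mul_add, mul_one, cis_add_int, sub_self]
    · intro x _
      refine ((HasDerivAt.cis ((hasDerivAt_id x).const_mul (m : ℝ))).div_const _).congr_deriv ?_
      rw [div_eq_iff hne]
      simp only [id]
      push_cast
      ring
    · exact (by fun_prop : Continuous fun x : ℝ => cis (m * x)).intervalIntegrable _ _

lemma integral_fejer {M : ℕ} (hM : 1 ≤ M) (a : ℝ) : ∫ x in a..(a + 1), fejer M x = 1 := by
  have hM0 : (M : ℂ) ≠ 0 := by
    have : M ≠ 0 := by omega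
    exact_mod_cast this
  have : (((∫ x in a..(a + 1), fejer M x) : ℝ) : ℂ) = 1 := by
    rw [← intervalIntegral.integral_ofReal]
    simp_rw [fejer_eq]
    rw [intervalIntegral.integral_div, intervalIntegral.integral_finsetSum]
    · have : ∀ i ∈ Finset.range M, (∫ x in a..(a + 1), ∑ j ∈ Finset.range M,
          cis (((i : ℤ) - j : ℤ) * x)) = 1 := by
        intro i hi
        rw [intervalIntegral.integral_finsetSum]
        · simp_rw [integral_cis_int_mul]
          rw [Finset.sum_eq_single i]
          · simp
          · intro j _ hj
            rw [if_neg]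
            intro h
            apply hj
            omega
          · exact fun h => absurd hi h
        · intro j _
          exact (by fun_prop : Continuous fun x : ℝ =>
            cis (((i : ℤ) - j : ℤ) * x)).intervalIntegrable _ _
      rw [Finset.sum_congr rfl this]
      simp [hM0]
    · intro i _
      exact (by fun_prop : Continuous fun x : ℝ => ∑ j ∈ Finset.range M,
        cis (((i : ℤ) - j : ℤ) * x)).intervalIntegrable _ _
  exact_mod_cast this

lemma norm_cis_sub_one (x : ℝ) : ‖cis x - 1‖ = 2 * |Real.sin (π * x)| := by
  have h1 : ‖cis x - 1‖ ^ 2 = (2 * |Real.sin (π * x)|) ^ 2 := by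
    rw [← Complex.normSq_eq_norm_sq, Complex.normSq_apply, Complex.sub_re, Complex.sub_im, cis_re,
      cis_im, mul_pow, sq_abs, Complex.one_re, Complex.one_im]
    rw [show 2 * π * x = 2 * (π * x) by ring, Real.cos_two_mul, Real.sin_two_mul]
    nlinarith [Real.sin_sq_add_cos_sq (π * x)]
  exact (pow_left_inj₀ (norm_nonneg _) (by positivity) two_ne_zero).1 h1

lemma sq_mul_fejer_le {M : ℕ} (hM : 1 ≤ M) {x : ℝ} (hx : |x| ≤ 1 / 2) :
    x ^ 2 * fejer M x ≤ 1 / (4 * M) := by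
  have hM0 : (0 : ℝ) < M := by exact_mod_cast hM
  set Z := ∑ j ∈ Finset.range M, cis (j * x) with hZ
  have hsin : 2 * |x| ≤ |Real.sin (π * x)| := by
    have h1 : 2 / π * (π * |x|) ≤ Real.sin (π * |x|) :=
      Real.mul_le_sin (by positivity) (by nlinarith [Real.pi_pos])
    have h2 : 2 / π * (π * |x|) = 2 * |x| := by field_simp
    rw [h2] at h1
    refine h1.trans ?_
    rcases abs_cases x with h | h
    · rw [h.1]; exact le_abs_self _
    · rw [h.1, mul_neg, Real.sin_neg]; exact neg_le_abs _
  have hgeom : Z * (cis x - 1) = cis (M * x) - 1 := by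
    simp_rw [hZ, cis_nat_mul]
    exact geom_sum_mul _ _
  have hn : ‖Z‖ * (2 * |Real.sin (π * x)|) ≤ 2 := by
    rw [← norm_cis_sub_one, ← norm_mul, hgeom]
    refine (norm_sub_le _ _).trans ?_
    rw [norm_cis, norm_one]
    norm_num
  have h3 : ‖Z‖ * |x| ≤ 1 / 2 := by
    nlinarith [norm_nonneg Z]
  have h4 : (‖Z‖ * |x|) ^ 2 ≤ (1 / 2) ^ 2 := by gcongr
  rw [mul_pow, sq_abs] at h4
  rw [fejer, ← hZ, mul_div_assoc', div_le_div_iff₀ hM0 (by positivity)]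
  nlinarith

lemma integral_abs_mul_fejer_le {M : ℕ} (hM : 1 ≤ M) :
    ∫ x in (-(1 / 2) : ℝ)..(1 / 2), |x| * fejer M x ≤ 1 / Real.sqrt M := by
  have hM0 : (0 : ℝ) < M := by exact_mod_cast hM
  have hs : 0 < Real.sqrt M := Real.sqrt_pos.2 hM0
  have hss : Real.sqrt M ^ 2 = M := Real.sq_sqrt hM0.le
  have hone : ∫ x in (-(1 / 2) : ℝ)..(1 / 2), fejer M x = 1 := by
    have := integral_fejer hM (-(1 / 2))
    norm_num at this ⊢
    exact this
  calc ∫ x in (-(1 / 2) : ℝ)..(1 / 2), |x| * fejer M x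
      ≤ ∫ x in (-(1 / 2) : ℝ)..(1 / 2), ((1 / (2 * Real.sqrt M)) * fejer M x +
          1 / (8 * Real.sqrt M)) := by
        apply intervalIntegral.integral_mono_on (by norm_num)
        · exact (by fun_prop : Continuous fun x => |x| * fejer M x).intervalIntegrable _ _
        · exact (by fun_prop : Continuous fun x => (1 / (2 * Real.sqrt M)) * fejer M x +
            1 / (8 * Real.sqrt M)).intervalIntegrable _ _
        · intro x hx
          have h1 := sq_mul_fejer_le hM (abs_le.2 hx)
          have h2 : |x| ≤ 1 / (2 * Real.sqrt M) + Real.sqrt M / 2 * x ^ 2 := by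
            have : 0 ≤ (1 - Real.sqrt M * |x|) ^ 2 / (2 * Real.sqrt M) := by positivity
            have e : (1 - Real.sqrt M * |x|) ^ 2 / (2 * Real.sqrt M) =
                1 / (2 * Real.sqrt M) + Real.sqrt M / 2 * |x| ^ 2 - |x| := by
              field_simp; ring
            rw [e, sq_abs] at this
            linarith
          calc |x| * fejer M x ≤ (1 / (2 * Real.sqrt M) + Real.sqrt M / 2 * x ^ 2) * fejer M x :=
                mul_le_mul_of_nonneg_right h2 (fejer_nonneg M x)
            _ = 1 / (2 * Real.sqrt M) * fejer M x + Real.sqrt M / 2 * (x ^ 2 * fejer M x) := by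
                ring
            _ ≤ 1 / (2 * Real.sqrt M) * fejer M x + Real.sqrt M / 2 * (1 / (4 * M)) := by
                gcongr
            _ = _ := by
                congr 1
                nth_rewrite 2 [← hss]
                field_simp
                norm_num
    _ ≤ 1 / Real.sqrt M := by
        rw [intervalIntegral.integral_add, intervalIntegral.integral_const_mul, hone]
        · simp only [intervalIntegral.integral_const, smul_eq_mul]
          rw [show (1 : ℝ) / 2 - -(1 / 2) = 1 by norm_num, one_mul, mul_one]
          rw [div_add_div _ _ (by positivity) (by positivity), div_le_div_iff₀ (by positivity) hs]
          nlinarith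
        · exact (by fun_prop : Continuous fun x => (1 / (2 * Real.sqrt M)) *
            fejer M x).intervalIntegrable _ _
        · exact continuous_const.intervalIntegrable _ _

lemma norm_integral_mul_fejer_sub_le {g : ℝ → ℂ} (hg : Continuous g) {M : ℕ} (hM : 1 ≤ M)
    (c : ℕ) {L : ℝ} (hL : ∀ x ∈ Set.Icc ((c : ℝ) - 1 / 2) (c + 1 / 2), ‖g x - g c‖ ≤ L * |x - c|) :
    ‖(∫ x in ((c : ℝ) - 1 / 2)..(c + 1 / 2), g x * (fejer M x : ℂ)) - g c‖ ≤
      L / Real.sqrt M := by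
  have hone : ∫ x in ((c : ℝ) - 1 / 2)..(c + 1 / 2), (fejer M x : ℂ) = 1 := by
    rw [intervalIntegral.integral_ofReal]
    have := integral_fejer hM ((c : ℝ) - 1 / 2)
    rw [show (c : ℝ) - 1 / 2 + 1 = c + 1 / 2 by ring] at this
    rw [this, Complex.ofReal_one]
  have hF : Continuous fun x : ℝ => (fejer M x : ℂ) :=
    Complex.continuous_ofReal.comp (continuous_fejer M)
  have e1 : (∫ x in ((c : ℝ) - 1 / 2)..(c + 1 / 2), g x * (fejer M x : ℂ)) - g c =
      ∫ x in ((c : ℝ) - 1 / 2)..(c + 1 / 2), (g x - g c) * (fejer M x : ℂ) := by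
    simp_rw [sub_mul]
    rw [intervalIntegral.integral_sub
      ((by fun_prop : Continuous fun x => g x * (fejer M x : ℂ)).intervalIntegrable _ _)
      ((by fun_prop : Continuous fun x => g c * (fejer M x : ℂ)).intervalIntegrable _ _),
      intervalIntegral.integral_const_mul, hone,
      mul_one]
  have hL0 : 0 ≤ L := by
    have := (norm_nonneg _).trans (hL (c + 1 / 2) ⟨by linarith, le_rfl⟩)
    rw [show (c : ℝ) + 1 / 2 - c = 1 / 2 by ring, abs_of_pos (by norm_num)] at this
    linarith
  rw [e1]
  have hle : (c : ℝ) - 1 / 2 ≤ c + 1 / 2 := by linarith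
  have b : ‖∫ x in ((c : ℝ) - 1 / 2)..(c + 1 / 2), (g x - g c) * (fejer M x : ℂ)‖ ≤
      ∫ x in ((c : ℝ) - 1 / 2)..(c + 1 / 2), L * (|x - c| * fejer M x) := by
    apply intervalIntegral.norm_integral_le_of_norm_le hle
    · filter_upwards with x hx
      rw [norm_mul, Complex.norm_real, Real.norm_of_nonneg (fejer_nonneg M x), ← mul_assoc]
      exact mul_le_mul_of_nonneg_right (hL x ⟨hx.1.le, hx.2⟩) (fejer_nonneg M x)
    · exact (by fun_prop : Continuous fun x : ℝ =>
        L * (|x - c| * fejer M x)).intervalIntegrable _ _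
  refine b.trans ?_
  rw [intervalIntegral.integral_const_mul]
  have e2 : ∫ x in ((c : ℝ) - 1 / 2)..(c + 1 / 2), |x - c| * fejer M x =
      ∫ x in (-(1 / 2) : ℝ)..(1 / 2), |x| * fejer M x := by
    have := intervalIntegral.integral_comp_sub_right (a := (c : ℝ) - 1 / 2) (b := c + 1 / 2)
      (fun x => |x| * fejer M x) c
    rw [show (c : ℝ) - 1 / 2 - c = -(1 / 2) by ring,
      show (c : ℝ) + 1 / 2 - c = 1 / 2 by ring] at this
    rw [← this]
    simp_rw [fejer_sub_nat]
  rw [e2, div_eq_mul_one_div L]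
  exact mul_le_mul_of_nonneg_left (integral_abs_mul_fejer_le hM) hL0

/-- Poisson summation against the Fejér kernel. -/
theorem norm_sum_sub_integral_mul_fejer_le {g : ℝ → ℂ} (hg : Continuous g)
    (hg2 : ∀ x, ‖g x‖ ≤ 2 * |x|) {M : ℕ} (hM : 1 ≤ M) {X L : ℝ} (hX : 1 ≤ X)
    (hL : ∀ c : ℕ, 1 ≤ c → (c : ℝ) ≤ X →
      ∀ x ∈ Set.Icc ((c : ℝ) - 1 / 2) (c + 1 / 2), ‖g x - g c‖ ≤ L * |x - c|)
    (hLM : L ≤ Real.sqrt M) :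
    ‖(∑ c ∈ Finset.range ⌊X⌋₊, g ((c + 1 : ℕ) : ℝ)) -
      ∫ x in (0 : ℝ)..X, g x * (fejer M x : ℂ)‖ ≤ 7 * X := by
  have hM0 : (0 : ℝ) < M := by exact_mod_cast hM
  have hs : 0 < Real.sqrt M := Real.sqrt_pos.2 hM0
  have hs1 : 1 ≤ Real.sqrt M := by
    rw [Real.one_le_sqrt]; exact_mod_cast hM
  set N := ⌊X⌋₊ with hN
  have hNX : (N : ℝ) ≤ X := Nat.floor_le (by linarith)
  have hXN : X < N + 1 := Nat.lt_floor_add_one X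
  set G : ℝ → ℂ := fun x => g x * (fejer M x : ℂ) with hG
  have hF : Continuous fun x : ℝ => (fejer M x : ℂ) :=
    Complex.continuous_ofReal.comp (continuous_fejer M)
  have hGc : Continuous G := hg.mul hF
  have hGi : ∀ a b, IntervalIntegrable G volume a b := fun a b => hGc.intervalIntegrable a b
  have hadj := intervalIntegral.sum_integral_adjacent_intervals (f := G) (μ := volume)
    (a := fun k : ℕ => (k : ℝ) + 1 / 2) (n := N) (fun k _ => hGi _ _)
  have hstart : ‖∫ x in (0 : ℝ)..(1 / 2), G x‖ ≤ 2 := by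
    have b1 : ‖∫ x in (0 : ℝ)..(1 / 2), G x‖ ≤ ∫ x in (0 : ℝ)..(1 / 2), 2 * (|x| * fejer M x) := by
      apply intervalIntegral.norm_integral_le_of_norm_le (by norm_num)
      · filter_upwards with x hx
        rw [norm_mul, Complex.norm_real, Real.norm_of_nonneg (fejer_nonneg M x), ← mul_assoc]
        exact mul_le_mul_of_nonneg_right (hg2 x) (fejer_nonneg M x)
      · exact (by fun_prop : Continuous fun x => 2 * (|x| * fejer M x)).intervalIntegrable _ _
    have b2 : ∫ x in (0 : ℝ)..(1 / 2), |x| * fejer M x ≤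
        ∫ x in (-(1 / 2) : ℝ)..(1 / 2), |x| * fejer M x := by
      apply intervalIntegral.integral_mono_interval (by norm_num) (by norm_num) le_rfl
      · filter_upwards with x
        have := fejer_nonneg M x
        simp only [Pi.zero_apply]
        positivity
      · exact (by fun_prop : Continuous fun x => |x| * fejer M x).intervalIntegrable _ _
    rw [intervalIntegral.integral_const_mul] at b1
    have b3 : 1 / Real.sqrt M ≤ 1 := by rw [div_le_one hs]; exact hs1
    linarith [integral_abs_mul_fejer_le hM]
  have hend : ‖∫ x in X..((N : ℝ) + 1 / 2), G x‖ ≤ 4 * X := by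
    have b1 : ‖∫ x in X..((N : ℝ) + 1 / 2), G x‖ ≤
        |∫ x in X..((N : ℝ) + 1 / 2), 4 * X * fejer M x| := by
      apply intervalIntegral.norm_integral_le_abs_of_norm_le
      · refine (ae_restrict_iff' measurableSet_uIoc).2 ?_
        filter_upwards with x hx
        have hx2 : x ∈ Set.uIcc X ((N : ℝ) + 1 / 2) := Set.uIoc_subset_uIcc hx
        have hx3 : |x| ≤ 2 * X := by
          have h1 := Set.uIcc_subset_Icc
            (show X ∈ Set.Icc 0 (2 * X) from ⟨by linarith, by linarith⟩)
            (show (N : ℝ) + 1 / 2 ∈ Set.Icc 0 (2 * X) from ⟨by positivity, by linarith⟩) hx2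
          rw [abs_of_nonneg h1.1]; exact h1.2
        rw [norm_mul, Complex.norm_real, Real.norm_of_nonneg (fejer_nonneg M x)]
        exact mul_le_mul_of_nonneg_right ((hg2 x).trans (by linarith)) (fejer_nonneg M x)
      · exact (by fun_prop : Continuous fun x => 4 * X * fejer M x).intervalIntegrable _ _
    refine b1.trans ?_
    rw [intervalIntegral.integral_const_mul, abs_mul, abs_of_nonneg (by linarith : 0 ≤ 4 * X)]
    have hone : ∫ x in (N : ℝ)..(N + 1), fejer M x = 1 := integral_fejer hM N
    have b2 : |∫ x in X..((N : ℝ) + 1 / 2), fejer M x| ≤ |∫ x in (N : ℝ)..(N + 1), fejer M x| := by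
      apply intervalIntegral.abs_integral_mono_interval
      · rw [Set.uIoc_of_le (by linarith : (N : ℝ) ≤ N + 1)]
        rintro x ⟨h1, h2⟩
        have h3 : (N : ℝ) ≤ min X (N + 1 / 2) := le_min hNX (by linarith)
        have h4 : max X ((N : ℝ) + 1 / 2) ≤ N + 1 := max_le hXN.le (by linarith)
        exact ⟨by linarith, by linarith⟩
      · filter_upwards with x using fejer_nonneg M x
      · exact (continuous_fejer M).intervalIntegrable _ _
    rw [hone, abs_one] at b2
    nlinarith
  have hdecomp : ∫ x in (0 : ℝ)..X, G x = (∫ x in (0 : ℝ)..(1 / 2), G x) +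
      (∑ k ∈ Finset.range N, ∫ x in ((k : ℝ) + 1 / 2)..((k + 1 : ℕ) + 1 / 2), G x) -
      ∫ x in X..((N : ℝ) + 1 / 2), G x := by
    rw [hadj]
    simp only [CharP.cast_eq_zero, zero_add]
    rw [intervalIntegral.integral_add_adjacent_intervals (hGi _ _) (hGi _ _),
      ← intervalIntegral.integral_add_adjacent_intervals (hGi 0 X) (hGi X (N + 1 / 2)),
      add_sub_cancel_right]
  have hmid : ∀ k ∈ Finset.range N, ‖g ((k + 1 : ℕ) : ℝ) -
      ∫ x in ((k : ℝ) + 1 / 2)..((k + 1 : ℕ) + 1 / 2), G x‖ ≤ 1 := by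
    intro k hk
    have hkN : ((k + 1 : ℕ) : ℝ) ≤ N := by exact_mod_cast Finset.mem_range.1 hk
    have := norm_integral_mul_fejer_sub_le hg hM (k + 1) (hL (k + 1) (by omega) (hkN.trans hNX))
    rw [norm_sub_rev, show ((k : ℝ) + 1 / 2) = ((k + 1 : ℕ) : ℝ) - 1 / 2 by push_cast; ring]
    refine this.trans ?_
    rw [div_le_one hs]
    exact hLM
  rw [hdecomp]
  have e : ∀ a b c d : ℂ, a - (b + c - d) = (a - c) - b + d := by intros; ring
  rw [e, ← Finset.sum_sub_distrib]
  have h1 := norm_sum_le_of_le _ hmid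
  simp only [Finset.sum_const, Finset.card_range, nsmul_eq_mul, mul_one] at h1
  refine (norm_add_le _ _).trans ?_
  have h2 := norm_sub_le (∑ k ∈ Finset.range N, (g ((k + 1 : ℕ) : ℝ) -
      ∫ x in ((k : ℝ) + 1 / 2)..((k + 1 : ℕ) + 1 / 2), G x)) (∫ x in (0 : ℝ)..(1 / 2), G x)
  linarith

/-- The exponential sum `∑_{c ≤ √t} 2c e^{πih(t/c+c)}`. -/
noncomputable def hypSum (t : ℝ) (h : ℕ) : ℂ :=
  ∑ c ∈ Finset.range ⌊Real.sqrt t⌋₊, ((2 * (c + 1 : ℕ) : ℝ) : ℂ) *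
    cis ((h * t / 2 : ℝ) / (c + 1 : ℕ) + (h / 2 : ℝ) * (c + 1 : ℕ))

lemma integral_mul_fejer_eq (t : ℝ) (h M : ℕ) :
    ∫ x in (0 : ℝ)..Real.sqrt t, (((2 * x : ℝ) : ℂ) *
      cis ((h * t / 2 : ℝ) / x + (h / 2 : ℝ) * x)) * (fejer M x : ℂ) =
    (∑ m ∈ Finset.range M, ((M : ℂ) - m) * phaseInt t h m +
        ∑ m ∈ Finset.range M, ((M : ℂ) - (m + 1)) * phaseInt t h (-((m + 1 : ℕ) : ℤ))) / M := by
  rw [← sum_range_sum_range_int_sub]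
  have hc : ∀ m : ℤ, IntervalIntegrable (fun x : ℝ => ((2 * x : ℝ) : ℂ) *
      cis ((h * t / 2 : ℝ) / x + (h / 2 + m : ℝ) * x)) volume 0 (Real.sqrt t) := fun m =>
    (continuous_two_mul_mul_cis _ _).intervalIntegrable _ _
  have hc2 : ∀ i : ℕ, IntervalIntegrable (fun x : ℝ => ∑ j ∈ Finset.range M,
      ((2 * x : ℝ) : ℂ) * cis ((h * t / 2 : ℝ) / x + (h / 2 + ((i : ℤ) - j : ℤ) : ℝ) * x))
      volume 0 (Real.sqrt t) := fun i =>
    (continuous_finsetSum _ fun j _ => continuous_two_mul_mul_cis _ _).intervalIntegrable _ _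
  have e : ∀ x : ℝ, (((2 * x : ℝ) : ℂ) * cis ((h * t / 2 : ℝ) / x + (h / 2 : ℝ) * x)) *
      (fejer M x : ℂ) = (∑ i ∈ Finset.range M, ∑ j ∈ Finset.range M,
      ((2 * x : ℝ) : ℂ) * cis ((h * t / 2 : ℝ) / x + (h / 2 + ((i : ℤ) - j : ℤ) : ℝ) * x)) / M := by
    intro x
    rw [fejer_eq, mul_div_assoc', Finset.mul_sum]
    congr 1
    refine Finset.sum_congr rfl fun i _ => ?_
    rw [Finset.mul_sum]
    refine Finset.sum_congr rfl fun j _ => ?_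
    rw [mul_assoc, ← cis_add]
    congr 2
    ring
  simp_rw [e]
  rw [intervalIntegral.integral_div, intervalIntegral.integral_finsetSum fun i _ => hc2 i]
  congr 1
  refine Finset.sum_congr rfl fun i _ => ?_
  exact intervalIntegral.integral_finsetSum (f := fun (j : ℕ) (x : ℝ) => ((2 * x : ℝ) : ℂ) *
    cis ((h * t / 2 : ℝ) / x + (h / 2 + ((i : ℤ) - j : ℤ) : ℝ) * x))
    fun j _ => hc ((i : ℤ) - j)

lemma norm_two_mul_mul_cis_sub_le {t : ℝ} (ht : 1 ≤ t) {h : ℕ} (hh : 1 ≤ h) {c : ℝ} (hc : 1 ≤ c)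
    (hcX : c ≤ Real.sqrt t) {x : ℝ} (hx : x ∈ Set.Icc (c - 1 / 2) (c + 1 / 2)) :
    ‖((2 * x : ℝ) : ℂ) * cis ((h * t / 2 : ℝ) / x + (h / 2 : ℝ) * x) -
      ((2 * c : ℝ) : ℂ) * cis ((h * t / 2 : ℝ) / c + (h / 2 : ℝ) * c)‖ ≤ 28 * h * t * |x - c| := by
  have hh1 : (1 : ℝ) ≤ h := by exact_mod_cast hh
  have hXX : Real.sqrt t ^ 2 = t := Real.sq_sqrt (by linarith)
  have hX1 : 1 ≤ Real.sqrt t := hc.trans hcX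
  have hXt : Real.sqrt t ≤ t := by nlinarith
  have hht : 1 ≤ h * t := by nlinarith
  set A : ℝ := h * t / 2 with hA
  set B : ℝ := h / 2 with hB
  have hd : ∀ y ∈ Set.Icc (c - 1 / 2) (c + 1 / 2), HasDerivAt
      (fun y : ℝ => ((2 * y : ℝ) : ℂ) * cis (A / y + B * y))
      (((2 : ℝ) : ℂ) * cis (A / y + B * y) + ((2 * y : ℝ) : ℂ) *
        (2 * π * Complex.I * ((-(A / y ^ 2) + B : ℝ) : ℂ) * cis (A / y + B * y))) y := by
    intro y hy
    have hy0 : y ≠ 0 := by have := hy.1; intro h0; rw [h0] at this; linarith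
    have h1 : HasDerivAt (fun y : ℝ => ((2 * y : ℝ) : ℂ)) ((2 : ℝ) : ℂ) y := by
      have := ((hasDerivAt_id y).const_mul 2).ofReal_comp
      simpa using this
    have h2 : HasDerivAt (fun y : ℝ => A / y + B * y) (-(A / y ^ 2) + B) y := by
      refine (((hasDerivAt_const y A).div (hasDerivAt_id y) hy0).add
        ((hasDerivAt_id y).const_mul B)).congr_deriv ?_
      simp
      ring
    exact h1.mul h2.cis
  have key := (convex_Icc (c - 1 / 2) (c + 1 / 2)).norm_image_sub_le_of_norm_hasDerivWithin_le
    (C := 28 * h * t) (fun y hy => (hd y hy).hasDerivWithinAt) (fun y hy => ?_)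
    (show c ∈ Set.Icc (c - 1 / 2) (c + 1 / 2) from ⟨by linarith, by linarith⟩) hx
  · exact key
  · have hy0 : 1 / 2 ≤ y := by have := hy.1; linarith
    have hy2 : y ≤ 2 * t := by have := hy.2; linarith
    refine (norm_add_le _ _).trans ?_
    simp only [norm_mul, norm_cis, mul_one, Complex.norm_real, Complex.norm_I, Complex.norm_ofNat]
    rw [Real.norm_of_nonneg (by norm_num : (0 : ℝ) ≤ 2), Real.norm_of_nonneg Real.pi_pos.le,
      Real.norm_of_nonneg (by linarith : 0 ≤ y)]
    have hAy : A / y ^ 2 * y ≤ h * t := by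
      rw [show A / y ^ 2 * y = A / y by field_simp, div_le_iff₀ (by linarith), hA]
      nlinarith
    have hBy : B * y ≤ h * t := by rw [hB]; nlinarith
    have h3 : y * ‖-(A / y ^ 2) + B‖ ≤ 2 * (h * t) := by
      have : ‖-(A / y ^ 2) + B‖ ≤ A / y ^ 2 + B := by
        refine (norm_add_le _ _).trans ?_
        rw [norm_neg, Real.norm_of_nonneg (by positivity), Real.norm_of_nonneg (by positivity)]
      calc _ ≤ y * (A / y ^ 2 + B) := by gcongr
        _ ≤ _ := by linarith
    have hpi : π < 3.15 := Real.pi_lt_d2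
    have h4 : 2 * y * (2 * π * ‖-(A / y ^ 2) + B‖) = 4 * π * (y * ‖-(A / y ^ 2) + B‖) := by ring
    rw [h4]
    nlinarith [mul_le_mul_of_nonneg_left h3 (by positivity : 0 ≤ 4 * π)]

theorem norm_hypSum_sub_le {t : ℝ} (ht : 1 ≤ t) {h M : ℕ} (hh : 1 ≤ h) (hM : 1 ≤ M)
    (hL : 28 * h * t ≤ Real.sqrt M) :
    ‖hypSum t h - ∑ m ∈ Finset.range M, ((1 - m / M : ℝ) : ℂ) *
      (endWeight m * statMain h (h + 2 * m) t)‖ ≤ 19 * Real.sqrt t * (1 + Real.log M) := by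
  have ht0 : 0 < t := by linarith
  have hM0 : (0 : ℝ) < M := by exact_mod_cast hM
  have hMne : (M : ℂ) ≠ 0 := by exact_mod_cast hM0.ne'
  have hX1 : 1 ≤ Real.sqrt t := Real.one_le_sqrt.2 ht
  have hX0 : 0 < Real.sqrt t := by linarith
  have h1 := norm_sum_sub_integral_mul_fejer_le
    (continuous_two_mul_mul_cis (h * t / 2 : ℝ) (h / 2 : ℝ))
    (fun x => by
      rw [norm_mul, norm_cis, mul_one, Complex.norm_real, norm_mul, Real.norm_eq_abs,
        Real.norm_eq_abs, abs_of_pos (by norm_num : (0 : ℝ) < 2)]) hM hX1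
    (fun c hc hcX x hx => norm_two_mul_mul_cis_sub_le ht hh (by exact_mod_cast hc) hcX hx) hL
  rw [integral_mul_fejer_eq] at h1
  change ‖hypSum t h - _‖ ≤ _ at h1
  have harm : ∑ m ∈ Finset.range M, (1 : ℝ) / ((m + 1 : ℕ) : ℝ) ≤ 1 + Real.log M := by
    have := harmonic_le_one_add_log M
    simp only [harmonic, Rat.cast_sum, Rat.cast_inv, Rat.cast_natCast] at this
    simpa [one_div] using this
  have e : hypSum t h - ∑ m ∈ Finset.range M, ((1 - m / M : ℝ) : ℂ) *
      (endWeight m * statMain h (h + 2 * m) t) =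
      (hypSum t h - (∑ m ∈ Finset.range M, ((M : ℂ) - m) * phaseInt t h m +
        ∑ m ∈ Finset.range M, ((M : ℂ) - (m + 1)) * phaseInt t h (-((m + 1 : ℕ) : ℤ))) / M) +
      ∑ m ∈ Finset.range M, ((1 - m / M : ℝ) : ℂ) *
        (phaseInt t h m - endWeight m * statMain h (h + 2 * m) t) +
      ∑ m ∈ Finset.range M, ((1 - (m + 1) / M : ℝ) : ℂ) * phaseInt t h (-((m + 1 : ℕ) : ℤ)) := by
    have e1 : ∀ m : ℕ, ((1 - m / M : ℝ) : ℂ) = ((M : ℂ) - m) / M := by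
      intro m; push_cast; field_simp
    have e2 : ∀ m : ℕ, ((1 - (m + 1) / M : ℝ) : ℂ) = ((M : ℂ) - (m + 1)) / M := by
      intro m; push_cast; field_simp
    simp_rw [e1, e2, mul_sub, Finset.sum_sub_distrib, add_div, Finset.sum_div,
      mul_div_right_comm]
    ring
  rw [e]
  have w1 : ∀ m ∈ Finset.range M, ‖((1 - m / M : ℝ) : ℂ)‖ ≤ 1 := by
    intro m hm
    have hmM : (m : ℝ) ≤ M := by exact_mod_cast (Finset.mem_range.1 hm).le
    have h3 : (m : ℝ) / M ≤ 1 := (div_le_one hM0).2 hmM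
    have h4 : 0 ≤ (m : ℝ) / M := by positivity
    rw [Complex.norm_real, Real.norm_eq_abs, abs_le]
    constructor <;> linarith
  have w2 : ∀ m ∈ Finset.range M, ‖((1 - (m + 1) / M : ℝ) : ℂ)‖ ≤ 1 := by
    intro m hm
    have hmM : (m : ℝ) + 1 ≤ M := by exact_mod_cast Finset.mem_range.1 hm
    have h3 : ((m : ℝ) + 1) / M ≤ 1 := (div_le_one hM0).2 hmM
    have h4 : 0 ≤ ((m : ℝ) + 1) / M := by positivity
    rw [Complex.norm_real, Real.norm_eq_abs, abs_le]
    constructor <;> linarith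
  have b1 : ‖∑ m ∈ Finset.range M, ((1 - m / M : ℝ) : ℂ) *
        (phaseInt t h m - endWeight m * statMain h (h + 2 * m) t)‖ ≤
      ∑ m ∈ Finset.range M, 10 * Real.sqrt t * (1 / ((m + 1 : ℕ) : ℝ)) := by
    apply norm_sum_le_of_le
    intro m hm
    rw [norm_mul]
    calc _ ≤ 1 * (5 * Real.sqrt t / max (m : ℝ) 1) :=
          mul_le_mul (w1 m hm) (norm_phaseInt_sub_le ht0 hh m) (norm_nonneg _) zero_le_one
      _ ≤ _ := by
          rw [one_mul, mul_one_div, div_le_div_iff₀ (by positivity) (by positivity)]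
          push_cast
          nlinarith [le_max_left (m : ℝ) 1, le_max_right (m : ℝ) 1]
  have b2 : ‖∑ m ∈ Finset.range M, ((1 - (m + 1) / M : ℝ) : ℂ) *
        phaseInt t h (-((m + 1 : ℕ) : ℤ))‖ ≤
      ∑ m ∈ Finset.range M, 2 * Real.sqrt t * (1 / ((m + 1 : ℕ) : ℝ)) := by
    apply norm_sum_le_of_le
    intro m hm
    rw [norm_mul]
    calc _ ≤ 1 * (2 * Real.sqrt t / (m + 1 : ℕ)) :=
          mul_le_mul (w2 m hm) (norm_phaseInt_neg_le ht0 hh (by omega)) (norm_nonneg _) zero_le_one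
      _ = _ := by rw [one_mul, mul_one_div]
  rw [← Finset.mul_sum] at b1 b2
  have hlog : 0 ≤ Real.log M := Real.log_nonneg (by exact_mod_cast hM)
  have b3 := mul_le_mul_of_nonneg_left harm (by positivity : 0 ≤ 12 * Real.sqrt t)
  refine (norm_add₃_le).trans ?_
  nlinarith

lemma finite_support_NH (t : ℝ) :
    (Function.support fun p : ℕ × ℕ =>
      if 2 * π * (p.1 + 1 : ℝ) * ((p.1 + 1 : ℝ) + 2 * (p.2 : ℝ) + 1) ≤ t then
      2 * (p.1 + 1 : ℝ) else 0).Finite := by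
  apply (((Finset.range (⌈t⌉₊ + 1)) ×ˢ (Finset.range (⌈t⌉₊ + 1))).finite_toSet).subset
  intro p hp
  simp only [Function.mem_support, ne_eq, ite_eq_right_iff, Classical.not_imp] at hp
  have h := hp.1
  have ht : t ≤ ⌈t⌉₊ := Nat.le_ceil t
  have h1 : (0 : ℝ) ≤ p.1 := Nat.cast_nonneg _
  have h2 : (0 : ℝ) ≤ p.2 := Nat.cast_nonneg _
  have hprod : 0 ≤ (p.1 : ℝ) * p.2 := mul_nonneg h1 h2
  have h4 : (p.1 : ℝ) + p.2 ≤ 2 * π * (p.1 + 1 : ℝ) * ((p.1 + 1 : ℝ) + 2 * (p.2 : ℝ) + 1) := by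
    have : (p.1 : ℝ) + p.2 ≤ (p.1 + 1 : ℝ) * ((p.1 + 1 : ℝ) + 2 * (p.2 : ℝ) + 1) := by nlinarith
    have h5 : 0 ≤ (p.1 + 1 : ℝ) * ((p.1 + 1 : ℝ) + 2 * (p.2 : ℝ) + 1) := by positivity
    nlinarith [Real.two_le_pi]
  simp only [Finset.coe_product, Set.mem_prod, Finset.mem_coe, Finset.mem_range]
  constructor
  · have : (p.1 : ℝ) ≤ ⌈t⌉₊ := by linarith
    have : p.1 ≤ ⌈t⌉₊ := by exact_mod_cast this
    omega
  · have : (p.2 : ℝ) ≤ ⌈t⌉₊ := by linarith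
    have : p.2 ≤ ⌈t⌉₊ := by exact_mod_cast this
    omega

lemma NH_mono : Monotone NH := by
  intro s t hst
  refine Summable.tsum_le_tsum (fun p => ?_) (summable_of_hasFiniteSupport (finite_support_NH s))
    (summable_of_hasFiniteSupport (finite_support_NH t))
  split_ifs with h1 h2
  · exact le_rfl
  · exact absurd (h1.trans hst) h2
  · positivity
  · exact le_rfl

lemma cast_card_filter_le {Y : ℝ} (hY : -1 ≤ Y) {K : ℕ} (hK : Y < K) :
    ((((Finset.range K).filter fun k : ℕ => (k : ℝ) ≤ Y).card : ℕ) : ℝ) = ⌊Y⌋ + 1 := by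
  have hf : -1 ≤ ⌊Y⌋ := Int.le_floor.2 (by exact_mod_cast hY)
  have : (Finset.range K).filter (fun k : ℕ => (k : ℝ) ≤ Y) = Finset.range (⌊Y⌋ + 1).toNat := by
    ext k
    simp only [Finset.mem_filter, Finset.mem_range]
    have h1 : (k : ℝ) ≤ Y ↔ (k : ℤ) ≤ ⌊Y⌋ := by rw [Int.le_floor]; norm_cast
    have h2 : k < (⌊Y⌋ + 1).toNat ↔ (k : ℤ) ≤ ⌊Y⌋ := by omega
    rw [h1, h2]
    constructor
    · exact fun h => h.2
    · intro h
      refine ⟨?_, h⟩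
      have : (k : ℝ) < K := (h1.2 h).trans_lt hK
      exact_mod_cast this
  rw [this, Finset.card_range]
  have h3 : (((⌊Y⌋ + 1).toNat : ℤ) : ℝ) = ((⌊Y⌋ + 1 : ℤ) : ℝ) := by
    rw [Int.toNat_of_nonneg (by omega)]
  push_cast at h3
  exact h3

/-- The argument of the sawtooth function in the counting function. -/
noncomputable def sawArg (t : ℝ) (c : ℕ) : ℝ := (t / (c + 1 : ℕ) - (c + 1 : ℕ) - 1) / 2

lemma NH_eq_sum {t : ℝ} (ht : 0 ≤ t) : NH (2 * π * t) =
    ∑ c ∈ Finset.range ⌊Real.sqrt t⌋₊, 2 * ((c + 1 : ℕ) : ℝ) * (⌊sawArg t c⌋ + 1) := by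
  set N := ⌊Real.sqrt t⌋₊ with hN
  set K := ⌈t⌉₊ + 1 with hK
  have hcond : ∀ c k : ℕ, (2 * π * (c + 1 : ℝ) * ((c + 1 : ℝ) + 2 * (k : ℝ) + 1) ≤ 2 * π * t) ↔
      (k : ℝ) ≤ sawArg t c := by
    intro c k
    have hc : (0 : ℝ) < c + 1 := by positivity
    rw [mul_assoc (2 * π), mul_le_mul_iff_right₀ (by positivity), sawArg, le_div_iff₀ two_pos,
      mul_comm, ← le_div_iff₀ hc]
    push_cast
    constructor <;> intro h <;> linarith
  have htK : t < K := by
    have := Nat.le_ceil t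
    rw [hK]; push_cast; linarith
  have hYK : ∀ c : ℕ, sawArg t c < K := by
    intro c
    have hc : (1 : ℝ) ≤ (c + 1 : ℕ) := by push_cast; linarith [Nat.cast_nonneg (α := ℝ) c]
    have : t / (c + 1 : ℕ) ≤ t := div_le_self ht hc
    rw [sawArg]
    linarith
  have hYneg : ∀ c : ℕ, N ≤ c → sawArg t c < 0 := by
    intro c hc
    have h1 : Real.sqrt t < (c + 1 : ℕ) := by
      have : (N : ℝ) ≤ c := by exact_mod_cast hc
      have h2 := Nat.lt_floor_add_one (Real.sqrt t)
      push_cast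
      linarith
    have h3 : t < ((c + 1 : ℕ) : ℝ) * (c + 1 : ℕ) := by
      rw [Real.sqrt_lt' (by positivity)] at h1
      nlinarith
    have h4 : t / (c + 1 : ℕ) < (c + 1 : ℕ) := by
      rw [div_lt_iff₀ (by positivity)]; exact h3
    rw [sawArg]
    linarith
  rw [NH, tsum_eq_sum (s := Finset.range N ×ˢ Finset.range K)]
  · rw [Finset.sum_product]
    refine Finset.sum_congr rfl fun c hc => ?_
    have hcN : ((c + 1 : ℕ) : ℝ) ≤ Real.sqrt t := by
      have h1 : ((c + 1 : ℕ) : ℝ) ≤ N := by exact_mod_cast Finset.mem_range.1 hc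
      exact h1.trans (Nat.floor_le (Real.sqrt_nonneg _))
    have hY : -1 ≤ sawArg t c := by
      have h1 : ((c + 1 : ℕ) : ℝ) * (c + 1 : ℕ) ≤ t := by
        have := Real.sq_sqrt ht
        nlinarith [Nat.cast_nonneg (α := ℝ) (c + 1)]
      have h2 : ((c + 1 : ℕ) : ℝ) ≤ t / (c + 1 : ℕ) := by
        rw [le_div_iff₀ (by positivity)]; exact h1
      rw [sawArg]
      linarith
    simp_rw [hcond]
    rw [← Finset.sum_filter, Finset.sum_const, nsmul_eq_mul, cast_card_filter_le hY (hYK c)]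
    push_cast
    ring
  · rintro ⟨c, k⟩ hp
    simp only [hcond]
    rw [if_neg]
    intro h
    apply hp
    simp only [Finset.mem_product, Finset.mem_range]
    constructor
    · by_contra hcon
      have := hYneg c (by omega)
      linarith [Nat.cast_nonneg (α := ℝ) k]
    · have : (k : ℝ) < K := h.trans_lt (hYK c)
      exact_mod_cast this

lemma sum_sub_sq_eq (t : ℝ) (N : ℕ) : ∑ c ∈ Finset.range N, (t - ((c + 1 : ℕ) : ℝ) ^ 2) =
    t * N - (2 * (N : ℝ) ^ 3 + 3 * N ^ 2 + N) / 6 := by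
  induction N with
  | zero => simp
  | succ N ih =>
    rw [Finset.sum_range_succ, ih]
    push_cast
    ring

theorem abs_RHtwoPi_add_sum_le {t : ℝ} (ht : 1 ≤ t) :
    |RHtwoPi t + ∑ c ∈ Finset.range ⌊Real.sqrt t⌋₊, 2 * ((c + 1 : ℕ) : ℝ) *
      (Int.fract (sawArg t c) - 1 / 2)| ≤ 2 * Real.sqrt t := by
  have ht0 : 0 ≤ t := by linarith
  set X := Real.sqrt t with hX
  have hX1 : 1 ≤ X := Real.one_le_sqrt.2 ht
  have hXX : t = X ^ 2 := (Real.sq_sqrt ht0).symm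
  have h32 : t ^ ((3 : ℝ) / 2) = X ^ 3 := by
    rw [hX, Real.sqrt_eq_rpow, ← Real.rpow_natCast, ← Real.rpow_mul ht0]; norm_num
  set N := ⌊X⌋₊ with hN
  have hNX : (N : ℝ) ≤ X := Nat.floor_le (by linarith)
  have hXN : X < N + 1 := Nat.lt_floor_add_one X
  have e : RHtwoPi t + ∑ c ∈ Finset.range N, 2 * ((c + 1 : ℕ) : ℝ) *
      (Int.fract (sawArg t c) - 1 / 2) =
      (t * N - (2 * (N : ℝ) ^ 3 + 3 * N ^ 2 + N) / 6) - 2 / 3 * X ^ 3 + 1 / 2 * t := by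
    rw [← sum_sub_sq_eq, RHtwoPi, NH_eq_sum ht0, h32]
    have : ∀ c ∈ Finset.range N, 2 * ((c + 1 : ℕ) : ℝ) * (⌊sawArg t c⌋ + 1) =
        (t - ((c + 1 : ℕ) : ℝ) ^ 2) - 2 * ((c + 1 : ℕ) : ℝ) *
          (Int.fract (sawArg t c) - 1 / 2) := by
      intro c _
      have hc : ((c + 1 : ℕ) : ℝ) ≠ 0 := by positivity
      rw [Int.fract]
      have : 2 * ((c + 1 : ℕ) : ℝ) * sawArg t c =
          t - ((c + 1 : ℕ) : ℝ) ^ 2 - ((c + 1 : ℕ) : ℝ) := by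
        rw [sawArg]; field_simp
      linear_combination this
    rw [Finset.sum_congr rfl this, Finset.sum_sub_distrib]
    ring
  rw [e, hXX]
  obtain ⟨f, hf⟩ : ∃ f, f = X - N := ⟨_, rfl⟩
  have hNf : (N : ℝ) = X - f := by linarith
  have hf0 : 0 ≤ f := by linarith
  have hf1 : f ≤ 1 := by linarith
  rw [hNf]
  have hf2 : f ^ 2 ≤ f := by nlinarith
  have hf3 : f ^ 3 ≤ f ^ 2 := by nlinarith [sq_nonneg f]
  have e2 : X ^ 2 * (X - f) - (2 * (X - f) ^ 3 + 3 * (X - f) ^ 2 + (X - f)) / 6 - 2 / 3 * X ^ 3 +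
      1 / 2 * X ^ 2 = X * (f - f ^ 2) + f ^ 3 / 3 - f ^ 2 / 2 - (X - f) / 6 := by ring
  rw [e2, abs_le]
  have hp : 0 ≤ X * (f - f ^ 2) := by nlinarith
  have hp2 : X * (f - f ^ 2) ≤ X * 1 := by gcongr; nlinarith
  have hf30 : 0 ≤ f ^ 3 := by positivity
  constructor <;> nlinarith [sq_nonneg f]

/-- The periodized second Bernoulli polynomial. -/
noncomputable def perBern (x : ℝ) : ℝ := Int.fract x ^ 2 - Int.fract x + 1 / 6

lemma hasSum_perBern (x : ℝ) :
    HasSum (fun n : ℕ => 1 / (n : ℝ) ^ 2 * Real.cos (2 * π * n * x)) (π ^ 2 * perBern x) := by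
  have hx : Int.fract x ∈ Set.Icc (0 : ℝ) 1 := ⟨Int.fract_nonneg x, (Int.fract_lt_one x).le⟩
  have h := hasSum_one_div_nat_pow_mul_cos (k := 1) one_ne_zero hx
  convert h using 1
  · ext n
    congr 1
    have : 2 * π * n * x = 2 * π * n * Int.fract x + ((n * ⌊x⌋ : ℤ) : ℝ) * (2 * π) := by
      nth_rewrite 1 [← Int.fract_add_floor x]
      push_cast
      ring
    rw [this, Real.cos_add_int_mul_two_pi]
  · have : (Polynomial.map (algebraMap ℚ ℝ) (Polynomial.bernoulli (2 * 1))).eval (Int.fract x) =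
        perBern x := by
      simp [Polynomial.bernoulli, Finset.sum_range_succ, bernoulli_eq_bernoulli'_of_ne_one,
        ← Polynomial.C_mul_X_pow_eq_monomial, perBern]
      ring
    rw [this, show Nat.factorial (2 * 1) = 2 from rfl]
    push_cast
    ring

/-- The truncated Fourier series of the periodized second Bernoulli polynomial. -/
lemma abs_perBern_sub_le (x : ℝ) {H : ℕ} (hH : 1 ≤ H) :
    |π ^ 2 * perBern x - ∑ h ∈ Finset.range H,
      1 / ((h + 1 : ℕ) : ℝ) ^ 2 * Real.cos (2 * π * (h + 1 : ℕ) * x)| ≤ 1 / (H : ℝ) := by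
  have hs := ((hasSum_perBern x).tendsto_sum_nat.sub_const (∑ h ∈ Finset.range H,
      1 / ((h + 1 : ℕ) : ℝ) ^ 2 * Real.cos (2 * π * (h + 1 : ℕ) * x))).abs
  refine le_of_tendsto hs ?_
  filter_upwards [Filter.eventually_ge_atTop (H + 1)] with K hK
  have e : ∑ h ∈ Finset.range H,
      1 / ((h + 1 : ℕ) : ℝ) ^ 2 * Real.cos (2 * π * (h + 1 : ℕ) * x) =
      ∑ n ∈ Finset.range (H + 1), 1 / (n : ℝ) ^ 2 * Real.cos (2 * π * n * x) := by
    rw [Finset.sum_range_succ']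
    simp
  rw [e, ← Finset.sum_Ico_eq_sub _ hK]
  have hIco : Finset.Ico (H + 1) K = Finset.Ioc H (K - 1) := by
    ext n; simp only [Finset.mem_Ico, Finset.mem_Ioc]; omega
  rw [hIco]
  calc _ ≤ ∑ n ∈ Finset.Ioc H (K - 1), ((n : ℝ) ^ 2)⁻¹ := by
        apply (Finset.abs_sum_le_sum_abs _ _).trans
        apply Finset.sum_le_sum
        intro n _
        rw [abs_mul, one_div, abs_of_nonneg (by positivity : (0 : ℝ) ≤ ((n : ℝ) ^ 2)⁻¹)]
        exact mul_le_of_le_one_right (by positivity) (Real.abs_cos_le_one _)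
    _ ≤ (H : ℝ)⁻¹ - ((K - 1 : ℕ) : ℝ)⁻¹ := sum_Ioc_inv_sq_le_sub (by omega) (by omega)
    _ ≤ 1 / H := by
        rw [one_div]
        have : (0 : ℝ) ≤ ((K - 1 : ℕ) : ℝ)⁻¹ := by positivity
        linarith

/-- Difference quotients of the periodized second Bernoulli polynomial. -/
noncomputable def sawQuot (σ x : ℝ) : ℝ := (perBern (x + σ) - perBern x) / (2 * σ)

lemma sawQuot_le {δ : ℝ} (hδ : 0 < δ) (hδ1 : δ < 1) (x : ℝ) :
    sawQuot δ x ≤ Int.fract x - 1 / 2 + δ := by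
  have h0 := Int.fract_nonneg x
  have h1 := Int.fract_lt_one x
  rw [sawQuot, div_le_iff₀ (by positivity), perBern, perBern]
  rcases lt_or_ge (Int.fract x + δ) 1 with h | h
  · have : Int.fract (x + δ) = Int.fract x + δ := by
      rw [Int.fract_eq_iff]
      exact ⟨by linarith, h, ⌊x⌋, by rw [Int.fract]; ring⟩
    rw [this]
    nlinarith
  · have : Int.fract (x + δ) = Int.fract x + δ - 1 := by
      rw [Int.fract_eq_iff]
      exact ⟨by linarith, by linarith, ⌊x⌋ + 1, by rw [Int.fract]; push_cast; ring⟩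
    rw [this]
    nlinarith

lemma le_sawQuot_neg {δ : ℝ} (hδ : 0 < δ) (hδ1 : δ < 1) (x : ℝ) :
    Int.fract x - 1 / 2 - δ ≤ sawQuot (-δ) x := by
  have h0 := Int.fract_nonneg x
  have h1 := Int.fract_lt_one x
  have e : sawQuot (-δ) x = (perBern x - perBern (x + -δ)) / (2 * δ) := by
    rw [sawQuot]; field_simp; ring
  rw [e, le_div_iff₀ (by positivity), perBern, perBern]
  rcases lt_or_ge (Int.fract x - δ) 0 with h | h
  · have : Int.fract (x + -δ) = Int.fract x - δ + 1 := by
      rw [Int.fract_eq_iff]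
      exact ⟨by linarith, by linarith, ⌊x⌋ - 1, by rw [Int.fract]; push_cast; ring⟩
    rw [this]
    nlinarith
  · have : Int.fract (x + -δ) = Int.fract x - δ := by
      rw [Int.fract_eq_iff]
      exact ⟨by linarith, by linarith, ⌊x⌋, by rw [Int.fract]; ring⟩
    rw [this]
    nlinarith

/-- The Fourier coefficients of the difference quotients, normalized to tend to one. -/
noncomputable def kap (σ : ℝ) (h : ℕ) : ℂ := (cis (h * σ) - 1) / (2 * π * Complex.I * h * σ)

lemma abs_sawQuot_sub_le {σ : ℝ} (hσ : σ ≠ 0) (x : ℝ) {H : ℕ} (hH : 1 ≤ H) :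
    |sawQuot σ x - (∑ h ∈ Finset.range H,
      kap σ (h + 1) * (Complex.I / (π * (h + 1 : ℕ))) * cis ((h + 1 : ℕ) * x)).re| ≤
      1 / (|σ| * H) := by
  have hH0 : (0 : ℝ) < H := by exact_mod_cast hH
  have hp := Real.pi_pos
  have e : (∑ h ∈ Finset.range H,
      kap σ (h + 1) * (Complex.I / (π * (h + 1 : ℕ))) * cis ((h + 1 : ℕ) * x)).re =
      (∑ h ∈ Finset.range H,
        1 / ((h + 1 : ℕ) : ℝ) ^ 2 * Real.cos (2 * π * (h + 1 : ℕ) * (x + σ)) -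
       ∑ h ∈ Finset.range H,
        1 / ((h + 1 : ℕ) : ℝ) ^ 2 * Real.cos (2 * π * (h + 1 : ℕ) * x)) / (2 * σ * π ^ 2) := by
    rw [Complex.re_sum, ← Finset.sum_sub_distrib, Finset.sum_div]
    refine Finset.sum_congr rfl fun h _ => ?_
    have hh : ((h + 1 : ℕ) : ℝ) ≠ 0 := by positivity
    have e1 : kap σ (h + 1) * (Complex.I / (π * (h + 1 : ℕ))) * cis ((h + 1 : ℕ) * x) =
        ((1 / ((h + 1 : ℕ) : ℝ) ^ 2 / (2 * σ * π ^ 2) : ℝ) : ℂ) *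
          (cis ((h + 1 : ℕ) * (x + σ)) - cis ((h + 1 : ℕ) * x)) := by
      have hhc : ((h + 1 : ℕ) : ℂ) ≠ 0 := by exact_mod_cast (Nat.succ_ne_zero h)
      have hpc : (π : ℂ) ≠ 0 := by exact_mod_cast hp.ne'
      have hσc : (σ : ℂ) ≠ 0 := by exact_mod_cast hσ
      rw [mul_add, cis_add, kap]
      simp only [Complex.ofReal_div, Complex.ofReal_mul, Complex.ofReal_pow, Complex.ofReal_one,
        Complex.ofReal_natCast, Complex.ofReal_ofNat]
      have := Complex.I_ne_zero
      field_simp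
    rw [e1, Complex.re_ofReal_mul, Complex.sub_re, cis_re, cis_re, ← mul_assoc, ← mul_assoc]
    ring
  rw [e]
  have h1 := abs_perBern_sub_le x hH
  have h2 := abs_perBern_sub_le (x + σ) hH
  set A := ∑ h ∈ Finset.range H, 1 / ((h + 1 : ℕ) : ℝ) ^ 2 * Real.cos (2 * π * (h + 1 : ℕ) * x)
  set B := ∑ h ∈ Finset.range H,
    1 / ((h + 1 : ℕ) : ℝ) ^ 2 * Real.cos (2 * π * (h + 1 : ℕ) * (x + σ))
  have e2 : sawQuot σ x - (B - A) / (2 * σ * π ^ 2) =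
      ((π ^ 2 * perBern (x + σ) - B) - (π ^ 2 * perBern x - A)) / (2 * σ * π ^ 2) := by
    rw [sawQuot]; field_simp; ring
  rw [e2, abs_div, abs_mul, abs_mul, abs_of_pos (by norm_num : (0 : ℝ) < 2),
    abs_of_pos (by positivity : 0 < π ^ 2)]
  have hσ0 : 0 < |σ| := abs_pos.2 hσ
  rw [div_le_div_iff₀ (by positivity) (by positivity)]
  have h3 := (abs_sub (π ^ 2 * perBern (x + σ) - B)
    (π ^ 2 * perBern x - A)).trans (add_le_add h2 h1)
  have h4 := mul_le_mul_of_nonneg_right h3 (by positivity : 0 ≤ |σ| * H)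
  have h5 : (1 / (H : ℝ) + 1 / H) * (|σ| * H) = 2 * |σ| := by field_simp; ring
  rw [h5] at h4
  have h6 : 1 ≤ π ^ 2 := by nlinarith [Real.two_le_pi]
  nlinarith

lemma norm_kap_eq (σ : ℝ) (h : ℕ) : ‖kap σ h‖ =
    2 * |Real.sin (π * (h * σ))| / (2 * π * h * |σ|) := by
  rw [kap, norm_div, norm_cis_sub_one]
  simp [abs_of_pos Real.pi_pos]

lemma norm_kap_le_one (σ : ℝ) (h : ℕ) : ‖kap σ h‖ ≤ 1 := by
  rw [norm_kap_eq]
  apply div_le_one_of_le₀ _ (by positivity)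
  have h1 : |Real.sin (π * (h * σ))| ≤ |π * (h * σ)| := Real.abs_sin_le_abs
  rw [abs_mul, abs_mul, abs_of_pos Real.pi_pos, Nat.abs_cast] at h1
  linarith

lemma norm_kap_le {σ : ℝ} (hσ : σ ≠ 0) {h : ℕ} (hh : 1 ≤ h) : ‖kap σ h‖ ≤ 1 / (|σ| * h) := by
  rw [norm_kap_eq]
  have h0 : (0 : ℝ) < h := by exact_mod_cast hh
  have hσ0 : 0 < |σ| := abs_pos.2 hσ
  have h1 : |Real.sin (π * (h * σ))| ≤ 1 := Real.abs_sin_le_one _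
  rw [div_le_div_iff₀ (by positivity) (by positivity)]
  have h2 : 0 < |σ| * h := by positivity
  have := Real.two_le_pi
  nlinarith [mul_le_mul_of_nonneg_right h1 h2.le]

/-- The amplitude of the oscillating term attached to the frequencies `(h, m)`. -/
noncomputable def ampl (h m : ℕ) : ℂ :=
  (((-1) ^ h * (endWeight m * (2 / π * ((h : ℝ) ^ (-(1 / 4) : ℝ) *
    ((h + 2 * m : ℕ) : ℝ) ^ (-(5 / 4) : ℝ)))) : ℝ) : ℂ) * cis (-(1 / 8))

/-- The truncated trigonometric sum approximating the remainder. -/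
noncomputable def trigSum (σ : ℝ) (H M : ℕ) (t : ℝ) : ℂ :=
  ∑ j ∈ Finset.range H, ∑ m ∈ Finset.range M, kap σ (j + 1) * ((1 - m / M : ℝ) : ℂ) *
    ampl (j + 1) m * cis (Real.sqrt ((((j + 1) * (j + 1 + 2 * m) : ℕ) : ℝ) * t))

lemma cis_neg_eighth : cis (-(1 / 8)) = -Complex.I * cis (1 / 8) := by
  have : cis (-(1 / 4)) = -Complex.I := by
    apply Complex.ext
    · rw [cis_re, show 2 * π * (-(1 / 4)) = -(π / 2) by ring]; simp
    · rw [cis_im, show 2 * π * (-(1 / 4)) = -(π / 2) by ring]; simp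
  rw [← this, ← cis_add]
  norm_num

lemma cis_mul_sawArg (t : ℝ) (h c : ℕ) : cis (h * sawArg t c) =
    ((-1 : ℝ) ^ h : ℝ) * cis ((h * t / 2 : ℝ) / (c + 1 : ℕ) + (h / 2 : ℝ) * (c + 1 : ℕ)) := by
  have e : (h : ℝ) * sawArg t c = h * (1 / 2) +
      ((h * t / 2 : ℝ) / (c + 1 : ℕ) + (h / 2 : ℝ) * (c + 1 : ℕ)) +
      ((-(h * (c + 1) + h) : ℤ) : ℝ) := by
    rw [sawArg]; push_cast; field_simp; ring
  rw [e, cis_add_int, cis_add, cis_nat_mul, cis_half]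
  push_cast
  rfl

lemma sum_two_mul_le {t : ℝ} (ht : 1 ≤ t) :
    ∑ c ∈ Finset.range ⌊Real.sqrt t⌋₊, 2 * ((c + 1 : ℕ) : ℝ) ≤ 2 * t := by
  have h1 : ∀ N : ℕ, ∑ c ∈ Finset.range N, 2 * ((c + 1 : ℕ) : ℝ) = N * (N + 1) := by
    intro N
    induction N with
    | zero => simp
    | succ N ih => rw [Finset.sum_range_succ, ih]; push_cast; ring
  rw [h1]
  have h2 : (⌊Real.sqrt t⌋₊ : ℝ) ≤ Real.sqrt t := Nat.floor_le (Real.sqrt_nonneg t)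
  have h3 : (1 : ℝ) ≤ ⌊Real.sqrt t⌋₊ := by
    exact_mod_cast (Nat.one_le_floor_iff _).2 (Real.one_le_sqrt.2 ht)
  have h4 := Real.sq_sqrt (by linarith : 0 ≤ t)
  nlinarith

lemma kap_mul_statMain {t : ℝ} (σ : ℝ) (j m M : ℕ) :
    kap σ (j + 1) * (Complex.I / (π * (j + 1 : ℕ))) * (((-1 : ℝ) ^ (j + 1) : ℝ) : ℂ) *
      (((1 - m / M : ℝ) : ℂ) * (endWeight m * statMain (j + 1) (j + 1 + 2 * m) t)) =
    -(((t ^ (3 / 4 : ℝ) : ℝ) : ℂ) * (kap σ (j + 1) * ((1 - m / M : ℝ) : ℂ) *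
      ampl (j + 1) m * cis (Real.sqrt ((((j + 1) * (j + 1 + 2 * m) : ℕ) : ℝ) * t)))) := by
  have hj : (0 : ℝ) < ((j + 1 : ℕ) : ℝ) := by positivity
  have e : ((j + 1 : ℕ) : ℝ) ^ (3 / 4 : ℝ) =
    ((j + 1 : ℕ) : ℝ) * ((j + 1 : ℕ) : ℝ) ^ (-(1 / 4) : ℝ) := by
    nth_rewrite 2 [← Real.rpow_one ((j + 1 : ℕ) : ℝ)]
    rw [← Real.rpow_add hj]; norm_num
  rw [statMain, ampl, e, cis_neg_eighth, ← Nat.cast_mul]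
  have hp : (π : ℂ) ≠ 0 := by exact_mod_cast Real.pi_ne_zero
  have hjc : ((j + 1 : ℕ) : ℂ) ≠ 0 := by exact_mod_cast (Nat.succ_ne_zero j)
  set a := ((j + 1 : ℕ) : ℝ) ^ (-(1 / 4) : ℝ)
  set b := ((j + 1 + 2 * m : ℕ) : ℝ) ^ (-(5 / 4) : ℝ)
  set u := cis (Real.sqrt ((((j + 1) * (j + 1 + 2 * m) : ℕ) : ℝ) * t))
  set k := kap σ (j + 1)
  simp only [Complex.ofReal_mul, Complex.ofReal_div, Complex.ofReal_natCast, Complex.ofReal_ofNat]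
  field_simp

lemma abs_sum_sawQuot_add_le {t : ℝ} (ht : 1 ≤ t) {σ : ℝ} (hσ : σ ≠ 0) {H M : ℕ} (hH : 1 ≤ H)
    (hM : 1 ≤ M) (hL : 28 * H * t ≤ Real.sqrt M) :
    |∑ c ∈ Finset.range ⌊Real.sqrt t⌋₊, 2 * ((c + 1 : ℕ) : ℝ) * sawQuot σ (sawArg t c) +
      t ^ (3 / 4 : ℝ) * (trigSum σ H M t).re| ≤
      2 * t / (|σ| * H) + 19 * Real.sqrt t * (1 + Real.log M) * (1 + Real.log H) := by
  set N := ⌊Real.sqrt t⌋₊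
  set w : ℕ → ℂ := fun j => kap σ (j + 1) * (Complex.I / (π * (j + 1 : ℕ)))
  have hw : ∀ j, ‖w j‖ ≤ 1 / ((j + 1 : ℕ) : ℝ) := by
    intro j
    simp only [w]
    rw [norm_mul, norm_div, norm_mul, Complex.norm_I, Complex.norm_natCast, Complex.norm_real,
      Real.norm_of_nonneg Real.pi_pos.le]
    calc _ ≤ 1 * (1 / (1 * ((j + 1 : ℕ) : ℝ))) := by
          gcongr
          · exact norm_kap_le_one _ _
          · linarith [Real.two_le_pi]
      _ = _ := by ring
  have hs0 : 0 ≤ Real.sqrt t := Real.sqrt_nonneg t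
  have hlogM : 0 ≤ Real.log M := Real.log_nonneg (by exact_mod_cast hM)
  -- replace the difference quotients by their Fourier sums
  have h1 : |∑ c ∈ Finset.range N, 2 * ((c + 1 : ℕ) : ℝ) * sawQuot σ (sawArg t c) -
      (∑ j ∈ Finset.range H, w j * (((-1 : ℝ) ^ (j + 1) : ℝ) : ℂ) * hypSum t (j + 1)).re| ≤
      2 * t / (|σ| * H) := by
    have e : (∑ j ∈ Finset.range H, w j * (((-1 : ℝ) ^ (j + 1) : ℝ) : ℂ) * hypSum t (j + 1)).re =
        ∑ c ∈ Finset.range N, 2 * ((c + 1 : ℕ) : ℝ) * (∑ h ∈ Finset.range H,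
          kap σ (h + 1) * (Complex.I / (π * (h + 1 : ℕ))) *
            cis ((h + 1 : ℕ) * sawArg t c)).re := by
      simp_rw [hypSum, Finset.mul_sum, ← Complex.re_ofReal_mul]
      rw [← Complex.re_sum, Finset.sum_comm]
      congr 1
      refine Finset.sum_congr rfl fun c _ => ?_
      rw [Finset.mul_sum]
      refine Finset.sum_congr rfl fun j _ => ?_
      rw [cis_mul_sawArg]
      ring
    rw [e, ← Finset.sum_sub_distrib]
    calc _ ≤ ∑ c ∈ Finset.range N, 2 * ((c + 1 : ℕ) : ℝ) * (1 / (|σ| * H)) := by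
          apply (Finset.abs_sum_le_sum_abs _ _).trans
          apply Finset.sum_le_sum
          intro c _
          rw [← mul_sub, abs_mul, abs_of_pos (by positivity)]
          gcongr
          exact abs_sawQuot_sub_le hσ _ hH
      _ ≤ 2 * t * (1 / (|σ| * H)) := by
          rw [← Finset.sum_mul]
          gcongr
          exact sum_two_mul_le ht
      _ = _ := by ring
  -- evaluate the exponential sums
  have h2 : ‖∑ j ∈ Finset.range H, w j * (((-1 : ℝ) ^ (j + 1) : ℝ) : ℂ) * hypSum t (j + 1) +
      ((t ^ (3 / 4 : ℝ) : ℝ) : ℂ) * trigSum σ H M t‖ ≤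
      19 * Real.sqrt t * (1 + Real.log M) * (1 + Real.log H) := by
    have e : ((t ^ (3 / 4 : ℝ) : ℝ) : ℂ) * trigSum σ H M t = -∑ j ∈ Finset.range H,
        w j * (((-1 : ℝ) ^ (j + 1) : ℝ) : ℂ) * ∑ m ∈ Finset.range M,
          ((1 - m / M : ℝ) : ℂ) * (endWeight m * statMain (j + 1) (j + 1 + 2 * m) t) := by
      rw [trigSum, Finset.mul_sum, ← Finset.sum_neg_distrib]
      refine Finset.sum_congr rfl fun j _ => ?_
      rw [Finset.mul_sum, Finset.mul_sum, ← Finset.sum_neg_distrib]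
      refine Finset.sum_congr rfl fun m _ => ?_
      rw [kap_mul_statMain, neg_neg]
    rw [e, ← sub_eq_add_neg, ← Finset.sum_sub_distrib]
    have harm : ∑ j ∈ Finset.range H, (1 : ℝ) / ((j + 1 : ℕ) : ℝ) ≤ 1 + Real.log H := by
      have := harmonic_le_one_add_log H
      rw [harmonic] at this
      push_cast at this
      simpa [one_div] using this
    calc _ ≤ ∑ j ∈ Finset.range H, (1 : ℝ) / ((j + 1 : ℕ) : ℝ) *
          (19 * Real.sqrt t * (1 + Real.log M)) := by
          apply (norm_sum_le _ _).trans
          apply Finset.sum_le_sum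
          intro j hj
          rw [← mul_sub, norm_mul, norm_mul]
          have e3 : ‖(((-1 : ℝ) ^ (j + 1) : ℝ) : ℂ)‖ = 1 := by simp
          rw [e3, mul_one]
          have hjH : j + 1 ≤ H := Finset.mem_range.1 hj
          have hjH' : ((j + 1 : ℕ) : ℝ) ≤ H := by exact_mod_cast hjH
          gcongr
          · exact hw j
          · apply norm_hypSum_sub_le ht (by omega) hM
            refine le_trans ?_ hL
            gcongr
      _ ≤ (1 + Real.log H) * (19 * Real.sqrt t * (1 + Real.log M)) := by
          rw [← Finset.sum_mul]
          gcongr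
      _ = _ := by ring
  have h3 := (Complex.abs_re_le_norm _).trans h2
  rw [Complex.add_re, Complex.re_ofReal_mul] at h3
  rw [abs_le] at *
  constructor <;> linarith [h1.1, h1.2, h3.1, h3.2]

lemma RHtwoPi_le_trigSum {t : ℝ} (ht : 1 ≤ t) {δ : ℝ} (hδ : 0 < δ) (hδ1 : δ < 1) {H M : ℕ}
    (hH : 1 ≤ H) (hM : 1 ≤ M) (hL : 28 * H * t ≤ Real.sqrt M) :
    RHtwoPi t ≤ t ^ (3 / 4 : ℝ) * (trigSum δ H M t).re + (2 * Real.sqrt t + 2 * t * δ +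
      2 * t / (δ * H) + 19 * Real.sqrt t * (1 + Real.log M) * (1 + Real.log H)) := by
  have h1 := abs_sum_sawQuot_add_le ht hδ.ne' hH hM hL
  have h2 := abs_RHtwoPi_add_sum_le ht
  rw [abs_of_pos hδ] at h1
  have h3 : ∑ c ∈ Finset.range ⌊Real.sqrt t⌋₊, 2 * ((c + 1 : ℕ) : ℝ) * sawQuot δ (sawArg t c) ≤
      ∑ c ∈ Finset.range ⌊Real.sqrt t⌋₊, 2 * ((c + 1 : ℕ) : ℝ) *
        (Int.fract (sawArg t c) - 1 / 2) + 2 * t * δ := by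
    calc _ ≤ ∑ c ∈ Finset.range ⌊Real.sqrt t⌋₊, (2 * ((c + 1 : ℕ) : ℝ) *
        (Int.fract (sawArg t c) - 1 / 2) + 2 * ((c + 1 : ℕ) : ℝ) * δ) := by
          apply Finset.sum_le_sum
          intro c _
          rw [← mul_add]
          gcongr
          exact sawQuot_le hδ hδ1 _
      _ ≤ _ := by
          rw [Finset.sum_add_distrib, ← Finset.sum_mul]
          gcongr
          exact sum_two_mul_le ht
  rw [abs_le] at h1 h2
  linarith [h1.1, h2.2]

lemma trigSum_le_RHtwoPi {t : ℝ} (ht : 1 ≤ t) {δ : ℝ} (hδ : 0 < δ) (hδ1 : δ < 1) {H M : ℕ}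
    (hH : 1 ≤ H) (hM : 1 ≤ M) (hL : 28 * H * t ≤ Real.sqrt M) :
    t ^ (3 / 4 : ℝ) * (trigSum (-δ) H M t).re - (2 * Real.sqrt t + 2 * t * δ +
      2 * t / (δ * H) + 19 * Real.sqrt t * (1 + Real.log M) * (1 + Real.log H)) ≤ RHtwoPi t := by
  have h1 := abs_sum_sawQuot_add_le ht (neg_ne_zero.2 hδ.ne') hH hM hL
  have h2 := abs_RHtwoPi_add_sum_le ht
  rw [abs_neg, abs_of_pos hδ] at h1
  have h3 : ∑ c ∈ Finset.range ⌊Real.sqrt t⌋₊, 2 * ((c + 1 : ℕ) : ℝ) *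
        (Int.fract (sawArg t c) - 1 / 2) ≤ ∑ c ∈ Finset.range ⌊Real.sqrt t⌋₊,
        2 * ((c + 1 : ℕ) : ℝ) * sawQuot (-δ) (sawArg t c) + 2 * t * δ := by
    calc _ ≤ ∑ c ∈ Finset.range ⌊Real.sqrt t⌋₊, (2 * ((c + 1 : ℕ) : ℝ) *
        sawQuot (-δ) (sawArg t c) + 2 * ((c + 1 : ℕ) : ℝ) * δ) := by
          apply Finset.sum_le_sum
          intro c _
          rw [← mul_add]
          gcongr
          linarith [le_sawQuot_neg hδ hδ1 (sawArg t c)]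
      _ ≤ _ := by
          rw [Finset.sum_add_distrib, ← Finset.sum_mul]
          gcongr
          exact sum_two_mul_le ht
  rw [abs_le] at h1 h2
  linarith [h1.2, h2.1]

/-- The divisor bound. -/
theorem exists_card_divisors_le_rpow {ε : ℝ} (hε : 0 < ε) :
    ∃ C : ℝ, 1 ≤ C ∧ ∀ n : ℕ, 1 ≤ n → (n.divisors.card : ℝ) ≤ C * (n : ℝ) ^ ε := by
  obtain ⟨P, hP⟩ := exists_nat_ge ((2 : ℝ) ^ (1 / ε))
  have hl : 0 < Real.log 2 := Real.log_pos (by norm_num)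
  obtain ⟨K, hK⟩ : ∃ K, K = max 1 (1 / (ε * Real.log 2)) := ⟨_, rfl⟩
  have hK1 : 1 ≤ K := hK ▸ le_max_left _ _
  have hK2 : 1 ≤ K * (ε * Real.log 2) := by
    have : 1 / (ε * Real.log 2) ≤ K := hK ▸ le_max_right _ _
    rwa [div_le_iff₀ (by positivity)] at this
  have key : ∀ p a : ℕ, 2 ≤ p →
      ((a + 1 : ℕ) : ℝ) ≤ (if p < P then K else 1) * ((p : ℝ) ^ a) ^ ε := by
    intro p a hp
    have hp0 : (2 : ℝ) ≤ p := by exact_mod_cast hp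
    have e : ((p : ℝ) ^ a) ^ ε = ((p : ℝ) ^ ε) ^ a := by
      rw [← Real.rpow_natCast, ← Real.rpow_natCast, ← Real.rpow_mul (by positivity),
        ← Real.rpow_mul (by positivity), mul_comm]
    split_ifs with h
    · have h1 : (2 : ℝ) ^ ((a : ℝ) * ε) ≤ ((p : ℝ) ^ a) ^ ε := by
        rw [← Real.rpow_natCast, ← Real.rpow_mul (by positivity)]
        exact Real.rpow_le_rpow (by norm_num) hp0 (by positivity)
      have h2 : 1 + (a : ℝ) * ε * Real.log 2 ≤ (2 : ℝ) ^ ((a : ℝ) * ε) := by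
        rw [Real.rpow_def_of_pos (by norm_num)]
        linarith [Real.add_one_le_exp (Real.log 2 * ((a : ℝ) * ε))]
      calc ((a + 1 : ℕ) : ℝ) = 1 + a * 1 := by push_cast; ring
        _ ≤ K + a * (K * (ε * Real.log 2)) := by gcongr
        _ = K * (1 + (a : ℝ) * ε * Real.log 2) := by ring
        _ ≤ _ := by gcongr; exact h2.trans h1
    · have h1 : (2 : ℝ) ≤ (p : ℝ) ^ ε := by
        have hPp : (P : ℝ) ≤ p := by exact_mod_cast not_lt.1 h
        calc (2 : ℝ) = ((2 : ℝ) ^ (1 / ε)) ^ ε := by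
              rw [← Real.rpow_mul (by norm_num), one_div_mul_cancel hε.ne', Real.rpow_one]
          _ ≤ _ := Real.rpow_le_rpow (by positivity) (hP.trans hPp) hε.le
      rw [one_mul, e]
      calc ((a + 1 : ℕ) : ℝ) ≤ ((2 ^ a : ℕ) : ℝ) := by exact_mod_cast Nat.lt_two_pow_self
        _ = 2 ^ a := by push_cast; rfl
        _ ≤ _ := by gcongr
  refine ⟨K ^ P, one_le_pow₀ hK1, fun n hn => ?_⟩
  have hn0 : n ≠ 0 := by omega
  have e1 : (n : ℝ) ^ ε = ∏ p ∈ n.primeFactors, ((p : ℝ) ^ n.factorization p) ^ ε := by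
    rw [Real.finsetProd_rpow _ _ (fun p _ => by positivity)]
    congr 1
    conv_lhs => rw [← Nat.prod_factorization_pow_eq_self hn0]
    rw [Nat.prod_factorization_eq_prod_primeFactors]
    push_cast
    rfl
  rw [Nat.card_divisors hn0, e1]
  push_cast
  calc ∏ p ∈ n.primeFactors, ((n.factorization p : ℝ) + 1) ≤
      ∏ p ∈ n.primeFactors, (if p < P then K else 1) * ((p : ℝ) ^ n.factorization p) ^ ε := by
        apply Finset.prod_le_prod
        · intro p _; positivity
        · intro p hp
          have := key p (n.factorization p) (Nat.prime_of_mem_primeFactors hp).two_le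
          push_cast at this
          exact this
    _ = (∏ p ∈ n.primeFactors, (if p < P then K else 1)) *
        ∏ p ∈ n.primeFactors, ((p : ℝ) ^ n.factorization p) ^ ε := Finset.prod_mul_distrib
    _ ≤ _ := by
        gcongr
        rw [← Finset.prod_filter, Finset.prod_const]
        apply pow_le_pow_right₀ hK1
        calc _ ≤ (Finset.range P).card := Finset.card_le_card fun p hp => by
              simpa using (Finset.mem_filter.1 hp).2
          _ = P := Finset.card_range P

/-- Coefficients indexed by `n = h(h+2m)`. -/
noncomputable def pairCoeff (q : ℕ → ℕ → ℂ) (n : ℕ) : ℂ :=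
  ∑ h ∈ n.divisors, if h ≤ n / h ∧ Even (n / h - h) then
    q h ((n / h - h) / 2) * ampl h ((n / h - h) / 2) else 0

lemma norm_ampl_le {h m n : ℕ} (hh : 1 ≤ h) (hn : h * (h + 2 * m) = n) :
    ‖ampl h m‖ ≤ h * (n : ℝ) ^ (-(5 / 4) : ℝ) := by
  have hk : 0 < h + 2 * m := by omega
  have hh0 : (0 : ℝ) < h := by exact_mod_cast hh
  have hk0 : (0 : ℝ) < ((h + 2 * m : ℕ) : ℝ) := by exact_mod_cast hk
  have e : (h : ℝ) * (n : ℝ) ^ (-(5 / 4) : ℝ) =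
      (h : ℝ) ^ (-(1 / 4) : ℝ) * ((h + 2 * m : ℕ) : ℝ) ^ (-(5 / 4) : ℝ) := by
    rw [← hn, Nat.cast_mul, Real.mul_rpow hh0.le hk0.le, ← mul_assoc]
    congr 1
    nth_rewrite 1 [← Real.rpow_one (h : ℝ)]
    rw [← Real.rpow_add hh0]; norm_num
  rw [e, ampl, norm_mul, norm_cis, mul_one, Complex.norm_real, norm_mul, norm_pow, norm_neg,
    norm_one, one_pow, one_mul, Real.norm_eq_abs, abs_of_nonneg]
  · have h1 : endWeight m ≤ 1 := by unfold endWeight; split_ifs <;> norm_num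
    have h0 : 0 ≤ endWeight m := by unfold endWeight; split_ifs <;> norm_num
    have h2 : 2 / π ≤ 1 := by rw [div_le_one Real.pi_pos]; exact Real.two_le_pi
    calc _ ≤ 1 * (1 * ((h : ℝ) ^ (-(1 / 4) : ℝ) * ((h + 2 * m : ℕ) : ℝ) ^ (-(5 / 4) : ℝ))) := by
          gcongr
      _ = _ := by ring
  · have h0 : 0 ≤ endWeight m := by unfold endWeight; split_ifs <;> norm_num
    positivity

/-- Every summand of `pairCoeff` comes from a pair `(h, m)` with `h(h+2m) = n`. -/
lemma norm_pairCoeff_le {q : ℕ → ℕ → ℂ} {n : ℕ} {W : ℝ} (hW : 0 ≤ W)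
    (h : ∀ h m : ℕ, 1 ≤ h → h * (h + 2 * m) = n → ‖q h m‖ * (h * (n : ℝ) ^ (-(5 / 4) : ℝ)) ≤ W) :
    ‖pairCoeff q n‖ ≤ n.divisors.card * W := by
  rw [pairCoeff]
  calc _ ≤ ∑ d ∈ n.divisors, W := by
        apply (norm_sum_le _ _).trans
        apply Finset.sum_le_sum
        intro d hd
        have hd1 : 1 ≤ d := Nat.pos_of_mem_divisors hd
        split_ifs with hc
        · have e : d * (d + 2 * ((n / d - d) / 2)) = n := by
            rw [Nat.mul_div_cancel' hc.2.two_dvd, Nat.add_sub_cancel' hc.1]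
            exact Nat.mul_div_cancel' (Nat.dvd_of_mem_divisors hd)
          rw [norm_mul]
          exact (mul_le_mul_of_nonneg_left (norm_ampl_le hd1 e) (norm_nonneg _)).trans (h _ _ hd1 e)
        · simpa using hW
    _ = _ := by rw [Finset.sum_const, nsmul_eq_mul]

/-- Regrouping a double sum over `(h, m)` by the value of `h(h+2m)`. -/
lemma sum_range_sum_range_eq_sum_pairCoeff (q : ℕ → ℕ → ℂ) (g : ℕ → ℂ) {H M Y : ℕ}
    (hq : ∀ h m, ¬ (h ≤ H ∧ m < M) → q h m = 0) (hY : H * (H + 2 * M) ≤ Y) :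
    ∑ j ∈ Finset.range H, ∑ m ∈ Finset.range M, q (j + 1) m * ampl (j + 1) m *
      g ((j + 1) * (j + 1 + 2 * m)) = ∑ n ∈ Finset.range (Y + 1), pairCoeff q n * g n := by
  simp only [pairCoeff, Finset.sum_mul]
  rw [← Finset.sum_product', Finset.sum_sigma']
  symm
  apply Finset.sum_bij_ne_zero (i := fun (x : Σ _ : ℕ, ℕ) _ _ => (x.2 - 1, (x.1 / x.2 - x.2) / 2))
  · rintro ⟨n, h⟩ hx hne
    simp only [Finset.mem_sigma, Finset.mem_range] at hx
    have hh : 1 ≤ h := Nat.pos_of_mem_divisors hx.2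
    simp only at hne ⊢
    split_ifs at hne with hc
    · have : q h ((n / h - h) / 2) ≠ 0 := by
        intro h0; apply hne; rw [h0]; simp
      have := not_imp_comm.1 (hq h ((n / h - h) / 2)) this
      simp only [Finset.mem_product, Finset.mem_range]
      omega
    · simp at hne
  · rintro ⟨n, h⟩ hx hne ⟨n', h'⟩ hx' hne' he
    simp only [Finset.mem_sigma, Finset.mem_range] at hx hx'
    have hh : 1 ≤ h := Nat.pos_of_mem_divisors hx.2
    have hh' : 1 ≤ h' := Nat.pos_of_mem_divisors hx'.2
    simp only at hne hne'
    split_ifs at hne with hc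
    swap
    · simp at hne
    split_ifs at hne' with hc'
    swap
    · simp at hne'
    simp only [Prod.mk.injEq] at he
    have hhh : h = h' := by omega
    subst hhh
    have e : n / h = n' / h := by
      obtain ⟨u, hu⟩ := hc.2
      obtain ⟨v, hv⟩ := hc'.2
      omega
    have e1 := Nat.mul_div_cancel' (Nat.dvd_of_mem_divisors hx.2)
    have e2 := Nat.mul_div_cancel' (Nat.dvd_of_mem_divisors hx'.2)
    rw [e, e2] at e1
    rw [e1]
  · rintro ⟨j, m⟩ hx hne
    simp only [Finset.mem_product, Finset.mem_range] at hx
    have hdiv : (j + 1) * (j + 1 + 2 * m) / (j + 1) = j + 1 + 2 * m :=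
      Nat.mul_div_cancel_left _ (by omega)
    have hsub : j + 1 + 2 * m - (j + 1) = 2 * m := by omega
    have hm2 : 2 * m / 2 = m := by omega
    have hev : j + 1 ≤ j + 1 + 2 * m ∧ Even (2 * m) := ⟨by omega, even_two_mul m⟩
    refine ⟨⟨(j + 1) * (j + 1 + 2 * m), j + 1⟩, ?_, ?_, ?_⟩
    · simp only [Finset.mem_sigma, Finset.mem_range, Nat.mem_divisors]
      refine ⟨?_, Dvd.intro _ rfl, by positivity⟩
      have : (j + 1) * (j + 1 + 2 * m) ≤ H * (H + 2 * M) := by gcongr <;> omega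
      omega
    · simp only [hdiv, hsub, hm2, if_pos hev]
      exact hne
    · simp only [hdiv, hsub, hm2]
      rfl
  · rintro ⟨n, h⟩ hx hne
    simp only [Finset.mem_sigma, Finset.mem_range] at hx
    have hh : 1 ≤ h := Nat.pos_of_mem_divisors hx.2
    simp only at hne ⊢
    split_ifs at hne with hc
    · have e : h * (h + 2 * ((n / h - h) / 2)) = n := by
        rw [Nat.mul_div_cancel' hc.2.two_dvd, Nat.add_sub_cancel' hc.1]
        exact Nat.mul_div_cancel' (Nat.dvd_of_mem_divisors hx.2)
      rw [if_pos hc, Nat.sub_add_cancel hh, e]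
    · simp at hne

/-- The smoothing weights, extended by zero. -/
noncomputable def smoothWeight (σ : ℝ) (H M h m : ℕ) : ℂ :=
  if h ≤ H ∧ m < M then kap σ h * ((1 - m / M : ℝ) : ℂ) else 0

lemma trigSum_eq (σ : ℝ) {H M Y : ℕ} (hY : H * (H + 2 * M) ≤ Y) (t : ℝ) :
    trigSum σ H M t = ∑ n ∈ Finset.range (Y + 1),
      pairCoeff (smoothWeight σ H M) n * cis (Real.sqrt (n * t)) := by
  rw [← sum_range_sum_range_eq_sum_pairCoeff (smoothWeight σ H M)
    (fun n => cis (Real.sqrt (n * t))) (fun h m hn => if_neg hn) hY, trigSum]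
  refine Finset.sum_congr rfl fun j hj => Finset.sum_congr rfl fun m hm => ?_
  have : j + 1 ≤ H ∧ m < M := ⟨Finset.mem_range.1 hj, Finset.mem_range.1 hm⟩
  rw [smoothWeight, if_pos this]

lemma norm_one_sub_div_le (m M : ℕ) (h : m < M) : ‖((1 - m / M : ℝ) : ℂ)‖ ≤ 1 := by
  have hM : (0 : ℝ) < M := by exact_mod_cast (by omega : 0 < M)
  have h1 : (m : ℝ) / M ≤ 1 := by rw [div_le_one hM]; exact_mod_cast h.le
  have h2 : (0 : ℝ) ≤ (m : ℝ) / M := by positivity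
  rw [Complex.norm_real, Real.norm_eq_abs, abs_le]
  constructor <;> linarith

lemma norm_smoothWeight_le (σ : ℝ) (H M h m : ℕ) : ‖smoothWeight σ H M h m‖ ≤ 1 := by
  rw [smoothWeight]
  split_ifs with hc
  · rw [norm_mul]
    exact mul_le_one₀ (norm_kap_le_one σ h) (norm_nonneg _) (norm_one_sub_div_le _ _ hc.2)
  · simp

lemma norm_smoothWeight_le_div {σ : ℝ} (hσ : σ ≠ 0) (H M : ℕ) {h : ℕ} (hh : 1 ≤ h) (m : ℕ) :
    ‖smoothWeight σ H M h m‖ ≤ 1 / (|σ| * h) := by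
  rw [smoothWeight]
  split_ifs with hc
  · rw [norm_mul]
    exact mul_le_of_le_one_right (norm_nonneg _) (norm_one_sub_div_le _ _ hc.2) |>.trans
      (norm_kap_le hσ hh)
  · simp; positivity

lemma norm_kap_sub_one_le {σ : ℝ} (hσ : σ ≠ 0) {h : ℕ} (hh : 1 ≤ h) :
    ‖kap σ h - 1‖ ≤ 6 * Real.sqrt (h * |σ|) := by
  have hh0 : (0 : ℝ) < h := by exact_mod_cast hh
  have hσ0 : 0 < |σ| := abs_pos.2 hσ
  have hpi := Real.pi_pos
  have hpi2 := Real.pi_lt_four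
  set x : ℂ := ((2 * π * (h * σ) : ℝ) : ℂ) * Complex.I with hx
  have hxn : ‖x‖ = 2 * π * (h * |σ|) := by
    rw [hx, norm_mul, Complex.norm_I, mul_one, Complex.norm_real, Real.norm_eq_abs, abs_mul,
      abs_mul, abs_mul, abs_of_pos hpi, Nat.abs_cast, abs_of_pos (by norm_num : (0 : ℝ) < 2)]
  have hx0 : x ≠ 0 := by
    rw [← norm_pos_iff, hxn]; positivity
  have e : kap σ h - 1 = (Complex.exp x - 1 - x) / x := by
    have : 2 * π * Complex.I * h * σ = x := by rw [hx]; push_cast; ring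
    rw [kap, this, cis, ← hx, sub_div _ x x, div_self hx0]
  set y := Real.sqrt (h * |σ|) with hy
  have hy0 : 0 < y := Real.sqrt_pos.2 (by positivity)
  have hyy : y ^ 2 = h * |σ| := Real.sq_sqrt (by positivity)
  rw [← hyy] at hxn
  rcases le_or_gt ‖x‖ 1 with h1 | h1
  · have h2 := Complex.norm_exp_sub_one_sub_id_le h1
    rw [e, norm_div]
    calc _ ≤ ‖x‖ ^ 2 / ‖x‖ := by gcongr
      _ = ‖x‖ := by field_simp
      _ ≤ 6 * y := by
        rw [hxn] at h1 ⊢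
        have h3 : π ≥ 3 := Real.pi_gt_three.le
        have hy1 : y ≤ 1 / 2 := by
          by_contra hcon
          push Not at hcon
          nlinarith
        nlinarith
  · calc _ ≤ ‖kap σ h‖ + ‖(1 : ℂ)‖ := norm_sub_le _ _
      _ ≤ 2 := by rw [norm_one]; linarith [norm_kap_le_one σ h]
      _ ≤ 6 * y := by
        rw [hxn] at h1
        by_contra hcon
        push Not at hcon
        have : y < 1 / 3 := by linarith
        have : y ^ 2 < 1 / 9 := by nlinarith
        nlinarith

lemma norm_smoothWeight_sub_one_le {σ : ℝ} (hσ : σ ≠ 0) {H M h m n : ℕ} (hH : 1 ≤ H) (hM : 1 ≤ M)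
    (hh : 1 ≤ h) (hn : h * (h + 2 * m) = n) :
    ‖smoothWeight σ H M h m - 1‖ ≤
      6 * (|σ| ^ (1 / 2 : ℝ) + (M : ℝ) ^ (-(1 / 4) : ℝ) + (H : ℝ) ^ (-(1 / 2) : ℝ)) *
        (n : ℝ) ^ (1 / 4 : ℝ) := by
  have hH0 : (0 : ℝ) < H := by exact_mod_cast hH
  have hM0 : (0 : ℝ) < M := by exact_mod_cast hM
  have hh0 : (0 : ℝ) < h := by exact_mod_cast hh
  have hhn : (h : ℝ) ≤ (n : ℝ) ^ (1 / 2 : ℝ) := by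
    rw [← Real.sqrt_eq_rpow]
    apply Real.le_sqrt_of_sq_le
    rw [← hn]; push_cast; nlinarith [Nat.cast_nonneg (α := ℝ) m]
  have hh4 : (h : ℝ) ^ (1 / 2 : ℝ) ≤ (n : ℝ) ^ (1 / 4 : ℝ) := by
    calc _ ≤ ((n : ℝ) ^ (1 / 2 : ℝ)) ^ (1 / 2 : ℝ) := by gcongr
      _ = _ := by rw [← Real.rpow_mul (by positivity)]; norm_num
  have hmn : (m : ℝ) ≤ n := by
    have : m ≤ n := by rw [← hn]; nlinarith
    exact_mod_cast this
  have hm4 : (m : ℝ) ^ (1 / 4 : ℝ) ≤ (n : ℝ) ^ (1 / 4 : ℝ) := by gcongr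
  have hpos : 0 ≤ (n : ℝ) ^ (1 / 4 : ℝ) := by positivity
  rw [smoothWeight]
  split_ifs with hc
  · have e : kap σ h * ((1 - m / M : ℝ) : ℂ) - 1 = (kap σ h - 1) - kap σ h * ((m / M : ℝ) : ℂ) := by
      push_cast; ring
    rw [e]
    have h1 : ‖kap σ h - 1‖ ≤ 6 * (|σ| ^ (1 / 2 : ℝ) * (n : ℝ) ^ (1 / 4 : ℝ)) := by
      refine (norm_kap_sub_one_le hσ hh).trans ?_
      rw [Real.sqrt_eq_rpow, Real.mul_rpow hh0.le (abs_nonneg σ), mul_comm ((h : ℝ) ^ _)]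
      gcongr
    have h2 : ‖kap σ h * ((m / M : ℝ) : ℂ)‖ ≤ (M : ℝ) ^ (-(1 / 4) : ℝ) * (n : ℝ) ^ (1 / 4 : ℝ) := by
      have hmM0 : (0 : ℝ) ≤ (m : ℝ) / M := by positivity
      have hmM1 : (m : ℝ) / M ≤ 1 := by
        rw [div_le_one hM0]; exact_mod_cast hc.2.le
      rw [norm_mul, Complex.norm_real, Real.norm_of_nonneg hmM0]
      calc _ ≤ 1 * ((m : ℝ) / M) := by gcongr; exact norm_kap_le_one _ _
        _ = ((m : ℝ) / M) ^ (1 : ℝ) := by rw [one_mul, Real.rpow_one]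
        _ ≤ ((m : ℝ) / M) ^ (1 / 4 : ℝ) :=
            Real.rpow_le_rpow_of_exponent_ge' hmM0 hmM1 (by norm_num) (by norm_num)
        _ = (M : ℝ) ^ (-(1 / 4) : ℝ) * (m : ℝ) ^ (1 / 4 : ℝ) := by
            rw [Real.div_rpow (by positivity) (by positivity), Real.rpow_neg hM0.le]
            field_simp
        _ ≤ _ := by gcongr
    calc _ ≤ _ := norm_sub_le _ _
      _ ≤ 6 * (|σ| ^ (1 / 2 : ℝ) * (n : ℝ) ^ (1 / 4 : ℝ)) +
          (M : ℝ) ^ (-(1 / 4) : ℝ) * (n : ℝ) ^ (1 / 4 : ℝ) := add_le_add h1 h2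
      _ ≤ _ := by
        have h5 : 0 ≤ (M : ℝ) ^ (-(1 / 4) : ℝ) * (n : ℝ) ^ (1 / 4 : ℝ) := by positivity
        have h6 : 0 ≤ (H : ℝ) ^ (-(1 / 2) : ℝ) * (n : ℝ) ^ (1 / 4 : ℝ) := by positivity
        nlinarith
  · rw [zero_sub, norm_neg, norm_one]
    have h0 : 0 ≤ |σ| ^ (1 / 2 : ℝ) * (n : ℝ) ^ (1 / 4 : ℝ) := by positivity
    have h5 : 0 ≤ (M : ℝ) ^ (-(1 / 4) : ℝ) * (n : ℝ) ^ (1 / 4 : ℝ) := by positivity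
    have h6 : 0 ≤ (H : ℝ) ^ (-(1 / 2) : ℝ) * (n : ℝ) ^ (1 / 4 : ℝ) := by positivity
    rw [not_and_or, not_le, not_lt] at hc
    rcases hc with hc | hc
    · have : 1 ≤ (H : ℝ) ^ (-(1 / 2) : ℝ) * (n : ℝ) ^ (1 / 4 : ℝ) := by
        calc (1 : ℝ) = (H : ℝ) ^ (-(1 / 2) : ℝ) * (H : ℝ) ^ (1 / 2 : ℝ) := by
              rw [← Real.rpow_add hH0]; norm_num
          _ ≤ (H : ℝ) ^ (-(1 / 2) : ℝ) * (h : ℝ) ^ (1 / 2 : ℝ) := by gcongr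
          _ ≤ _ := by gcongr
      nlinarith
    · have : 1 ≤ (M : ℝ) ^ (-(1 / 4) : ℝ) * (n : ℝ) ^ (1 / 4 : ℝ) := by
        calc (1 : ℝ) = (M : ℝ) ^ (-(1 / 4) : ℝ) * (M : ℝ) ^ (1 / 4 : ℝ) := by
              rw [← Real.rpow_add hM0]; norm_num
          _ ≤ (M : ℝ) ^ (-(1 / 4) : ℝ) * (m : ℝ) ^ (1 / 4 : ℝ) := by gcongr
          _ ≤ _ := by gcongr
      nlinarith

/-- Power decay of `pairCoeff` for weights with a power bound. -/
lemma exists_norm_pairCoeff_le {p : ℝ} (s : ℝ) (hp : p < s) :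
    ∃ C : ℝ, 1 ≤ C ∧ ∀ (q : ℕ → ℕ → ℂ) (D : ℝ) (n : ℕ), 0 ≤ D → 1 ≤ n →
      (∀ h m : ℕ, 1 ≤ h → h * (h + 2 * m) = n →
        ‖q h m‖ * (h * (n : ℝ) ^ (-(5 / 4) : ℝ)) ≤ D * (n : ℝ) ^ (-s)) →
      ‖pairCoeff q n‖ ≤ C * D * (n : ℝ) ^ (-p) := by
  obtain ⟨C, hC1, hC⟩ := exists_card_divisors_le_rpow (sub_pos.2 hp)
  refine ⟨C, hC1, fun q D n hD hn h => ?_⟩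
  have hn0 : (0 : ℝ) < n := by exact_mod_cast hn
  refine (norm_pairCoeff_le (by positivity) h).trans ?_
  calc _ ≤ (C * (n : ℝ) ^ (s - p)) * (D * (n : ℝ) ^ (-s)) := by gcongr; exact hC n hn
    _ = C * D * ((n : ℝ) ^ (s - p) * (n : ℝ) ^ (-s)) := by ring
    _ = _ := by rw [← Real.rpow_add hn0]; ring_nf

lemma cast_le_rpow_half {h m n : ℕ} (hn : h * (h + 2 * m) = n) :
    (h : ℝ) ≤ (n : ℝ) ^ (1 / 2 : ℝ) := by
  rw [← Real.sqrt_eq_rpow]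
  apply Real.le_sqrt_of_sq_le
  rw [← hn]; push_cast; nlinarith [Nat.cast_nonneg (α := ℝ) m, Nat.cast_nonneg (α := ℝ) h]

/-- The coefficients of the limiting trigonometric series. -/
noncomputable def limCoeff (n : ℕ) : ℂ := pairCoeff (fun _ _ => 1) n

lemma pairCoeff_zero (q : ℕ → ℕ → ℂ) : pairCoeff q 0 = 0 := by simp [pairCoeff]

lemma pairCoeff_sub (q r : ℕ → ℕ → ℂ) (n : ℕ) :
    pairCoeff q n - pairCoeff r n = pairCoeff (fun h m => q h m - r h m) n := by
  rw [pairCoeff, pairCoeff, pairCoeff, ← Finset.sum_sub_distrib]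
  refine Finset.sum_congr rfl fun d _ => ?_
  split_ifs <;> ring

theorem exists_coeff_bounds : ∃ B : ℝ, 1 ≤ B ∧
    (∀ n : ℕ, 1 ≤ n → ‖limCoeff n‖ ≤ B * (n : ℝ) ^ (-(7 / 10) : ℝ)) ∧
    ∀ (σ : ℝ) (H M n : ℕ), σ ≠ 0 → 1 ≤ H → 1 ≤ M → 1 ≤ n →
      ‖pairCoeff (smoothWeight σ H M) n‖ ≤ B * (n : ℝ) ^ (-(7 / 10) : ℝ) ∧
      ‖pairCoeff (smoothWeight σ H M) n‖ ≤
        B * |σ| ^ (-(3 / 4) : ℝ) * (n : ℝ) ^ (-(11 / 10) : ℝ) ∧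
      ‖pairCoeff (smoothWeight σ H M) n - limCoeff n‖ ≤
        B * (|σ| ^ (1 / 2 : ℝ) + (M : ℝ) ^ (-(1 / 4) : ℝ) + (H : ℝ) ^ (-(1 / 2) : ℝ)) *
          (n : ℝ) ^ (-(2 / 5) : ℝ) := by
  obtain ⟨C1, hC1, h1⟩ := exists_norm_pairCoeff_le (p := 7 / 10) (3 / 4) (by norm_num)
  obtain ⟨C2, hC2, h2⟩ := exists_norm_pairCoeff_le (p := 11 / 10) (9 / 8) (by norm_num)
  obtain ⟨C3, hC3, h3⟩ := exists_norm_pairCoeff_le (p := 2 / 5) (1 / 2) (by norm_num)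
  have hb : ∀ (q : ℕ → ℕ → ℂ) (n : ℕ), (∀ h m, ‖q h m‖ ≤ 1) → 1 ≤ n →
      ‖pairCoeff q n‖ ≤ C1 * (n : ℝ) ^ (-(7 / 10) : ℝ) := by
    intro q n hq hn
    have hn0 : (0 : ℝ) < n := by exact_mod_cast hn
    have := h1 q 1 n zero_le_one hn fun h m hh hm => by
      calc _ ≤ 1 * ((n : ℝ) ^ (1 / 2 : ℝ) * (n : ℝ) ^ (-(5 / 4) : ℝ)) := by
            gcongr
            · exact hq h m
            · exact cast_le_rpow_half hm
        _ = _ := by rw [← Real.rpow_add hn0]; norm_num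
    simpa using this
  refine ⟨C1 + C2 + 6 * C3, by linarith, fun n hn => ?_, fun σ H M n hσ hH hM hn => ⟨?_, ?_, ?_⟩⟩
  · refine (hb _ n (fun _ _ => by simp) hn).trans ?_
    gcongr
    linarith
  · refine (hb _ n (norm_smoothWeight_le σ H M) hn).trans ?_
    gcongr
    linarith
  · have hn0 : (0 : ℝ) < n := by exact_mod_cast hn
    have hσ0 : 0 < |σ| := abs_pos.2 hσ
    refine (h2 _ (|σ| ^ (-(3 / 4) : ℝ)) n (by positivity) hn fun h m hh hm => ?_).trans ?_
    · have hh0 : (0 : ℝ) < h := by exact_mod_cast hh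
      have e1 : ‖smoothWeight σ H M h m‖ ≤ |σ| ^ (-(3 / 4) : ℝ) * (h : ℝ) ^ (-(3 / 4) : ℝ) := by
        have ha := norm_smoothWeight_le σ H M h m
        have hb := norm_smoothWeight_le_div hσ H M hh m
        calc _ = ‖smoothWeight σ H M h m‖ ^ (1 : ℝ) := (Real.rpow_one _).symm
          _ ≤ ‖smoothWeight σ H M h m‖ ^ (3 / 4 : ℝ) :=
            Real.rpow_le_rpow_of_exponent_ge' (norm_nonneg _) ha (by norm_num) (by norm_num)
          _ ≤ (1 / (|σ| * h)) ^ (3 / 4 : ℝ) := by gcongr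
          _ = _ := by
            rw [one_div, Real.inv_rpow (by positivity), Real.mul_rpow hσ0.le hh0.le, mul_inv,
              Real.rpow_neg hσ0.le, Real.rpow_neg hh0.le]
      have e2 : (h : ℝ) ^ (-(3 / 4) : ℝ) * h ≤ (n : ℝ) ^ (1 / 8 : ℝ) := by
        calc _ = (h : ℝ) ^ (1 / 4 : ℝ) := by
              nth_rewrite 2 [← Real.rpow_one (h : ℝ)]
              rw [← Real.rpow_add hh0]; norm_num
          _ ≤ ((n : ℝ) ^ (1 / 2 : ℝ)) ^ (1 / 4 : ℝ) := by gcongr; exact cast_le_rpow_half hm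
          _ = _ := by rw [← Real.rpow_mul hn0.le]; norm_num
      calc _ ≤ (|σ| ^ (-(3 / 4) : ℝ) * (h : ℝ) ^ (-(3 / 4) : ℝ)) *
             (h * (n : ℝ) ^ (-(5 / 4) : ℝ)) := by
            gcongr
        _ = |σ| ^ (-(3 / 4) : ℝ) * (((h : ℝ) ^ (-(3 / 4) : ℝ) * h) * (n : ℝ) ^ (-(5 / 4) : ℝ)) := by
            ring
        _ ≤ |σ| ^ (-(3 / 4) : ℝ) * ((n : ℝ) ^ (1 / 8 : ℝ) * (n : ℝ) ^ (-(5 / 4) : ℝ)) := by gcongr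
        _ = _ := by rw [← Real.rpow_add hn0]; norm_num
    · gcongr
      linarith
  · have hn0 : (0 : ℝ) < n := by exact_mod_cast hn
    rw [limCoeff, pairCoeff_sub]
    set L := |σ| ^ (1 / 2 : ℝ) + (M : ℝ) ^ (-(1 / 4) : ℝ) + (H : ℝ) ^ (-(1 / 2) : ℝ)
    have hL : 0 ≤ L := by positivity
    refine (h3 _ (6 * L) n (by positivity) hn fun h m hh hm => ?_).trans ?_
    · calc _ ≤ (6 * L * (n : ℝ) ^ (1 / 4 : ℝ)) *
             ((n : ℝ) ^ (1 / 2 : ℝ) * (n : ℝ) ^ (-(5 / 4) : ℝ)) := by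
            gcongr
            · exact norm_smoothWeight_sub_one_le hσ hH hM hh hm
            · exact cast_le_rpow_half hm
        _ = 6 * L * ((n : ℝ) ^ (1 / 4 : ℝ) * (n : ℝ) ^ (1 / 2 : ℝ) * (n : ℝ) ^ (-(5 / 4) : ℝ)) := by
            ring
        _ = _ := by rw [← Real.rpow_add hn0, ← Real.rpow_add hn0]; norm_num
    · calc C3 * (6 * L) * (n : ℝ) ^ (-(2 / 5) : ℝ) =
             6 * C3 * L * (n : ℝ) ^ (-(2 / 5) : ℝ) := by ring
        _ ≤ _ := by gcongr; linarith

/-- A summable weight for the distance of two integers. -/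
noncomputable def distWeight (a b : ℕ) : ℝ := (1 + |(a : ℝ) - b|) ^ (-(6 / 5) : ℝ)

lemma distWeight_nonneg (a b : ℕ) : 0 ≤ distWeight a b := by unfold distWeight; positivity

lemma exists_sum_distWeight_le : ∃ Z : ℝ, 0 ≤ Z ∧ ∀ a N : ℕ,
    ∑ b ∈ Finset.range N, distWeight a b ≤ Z := by
  set f : ℤ → ℝ := fun z => (1 + |(z : ℝ)|) ^ (-(6 / 5) : ℝ) with hf
  have hs : Summable fun n : ℕ => (1 + (n : ℝ)) ^ (-(6 / 5) : ℝ) := by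
    have := (summable_nat_add_iff 1).2 (Real.summable_nat_rpow.2 (by norm_num : -(6 / 5 : ℝ) < -1))
    refine this.congr fun n => ?_
    push_cast
    rw [add_comm]
  have hfs : Summable f := by
    apply Summable.of_nat_of_neg
    · refine hs.congr fun n => ?_
      simp [hf]
    · refine hs.congr fun n => ?_
      simp [hf]
  have hf0 : ∀ z, 0 ≤ f z := fun z => by simp only [hf]; positivity
  refine ⟨∑' z, f z, tsum_nonneg hf0, fun a N => ?_⟩
  have hinj : Set.InjOn (fun b : ℕ => (a : ℤ) - b) (Finset.range N) := by
    intro x _ y _ h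
    simp only at h
    omega
  calc _ = ∑ b ∈ Finset.range N, f ((a : ℤ) - b) := by
        refine Finset.sum_congr rfl fun b _ => ?_
        simp [hf, distWeight]
    _ = ∑ z ∈ (Finset.range N).image (fun b : ℕ => (a : ℤ) - b), f z := by
        rw [Finset.sum_image hinj]
    _ ≤ _ := hfs.sum_le_tsum _ fun z _ => hf0 z

/-- The reciprocal distances of `4P` to the neighbouring squares, with a decaying weight. -/
noncomputable def squareGapWeight (P : ℕ) : ℝ :=
  (P : ℝ) ^ (-(3 / 5) : ℝ) * (1 / ((4 * P - Nat.sqrt (4 * P) ^ 2 + 1 : ℕ) : ℝ) +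
    1 / (((Nat.sqrt (4 * P) + 1) ^ 2 - 4 * P : ℕ) : ℝ))

lemma squareGapWeight_nonneg (P : ℕ) : 0 ≤ squareGapWeight P := by
  unfold squareGapWeight; positivity

lemma summable_card_divisors_mul_div {g : ℕ → ℕ}
    (hinj : Function.Injective fun P => (Nat.sqrt (4 * P), g P))
    (hg : ∀ P, 1 ≤ P → 1 ≤ g P ∧ g P ≤ 3 * Nat.sqrt (4 * P)) :
    Summable fun P : ℕ => (P.divisors.card : ℝ) * ((P : ℝ) ^ (-(3 / 5) : ℝ) * (1 / (g P : ℝ))) := by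
  obtain ⟨C, hC1, hC⟩ := exists_card_divisors_le_rpow (by norm_num : (0 : ℝ) < 1 / 100)
  have h1 : Summable fun n : ℕ => (n : ℝ) ^ (-(113 / 100) : ℝ) :=
    Real.summable_nat_rpow.2 (by norm_num)
  have h2 : Summable fun n : ℕ => (n : ℝ) ^ (-(21 / 20) : ℝ) :=
    Real.summable_nat_rpow.2 (by norm_num)
  have h3 := (h1.mul_of_nonneg h2 (fun n => by positivity) (fun n => by positivity)).comp_injective
    hinj
  refine Summable.of_nonneg_of_le (fun P => by positivity) (fun P => ?_) (h3.mul_left (12 * C))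
  simp only [Function.comp]
  rcases Nat.eq_zero_or_pos P with rfl | hP
  · simp
  obtain ⟨hg1, hg2⟩ := hg P hP
  have hP0 : (0 : ℝ) < P := by exact_mod_cast hP
  set j := Nat.sqrt (4 * P) with hj
  have hj1 : 1 ≤ j := by omega
  have hj0 : (0 : ℝ) < j := by exact_mod_cast hj1
  have hg0 : (0 : ℝ) < g P := by exact_mod_cast hg1
  have hjP : (j : ℝ) ^ 2 / 4 ≤ P := by
    have : j ^ 2 ≤ 4 * P := Nat.sqrt_le' _
    have : (j : ℝ) ^ 2 ≤ 4 * P := by exact_mod_cast this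
    linarith
  have e1 : (P : ℝ) ^ (-(59 / 100) : ℝ) ≤ 4 * (j : ℝ) ^ (-(59 / 50) : ℝ) := by
    calc _ ≤ ((j : ℝ) ^ 2 / 4) ^ (-(59 / 100) : ℝ) :=
          Real.rpow_le_rpow_of_nonpos (by positivity) hjP (by norm_num)
      _ = (4 : ℝ) ^ (59 / 100 : ℝ) * (j : ℝ) ^ (-(59 / 50) : ℝ) := by
          rw [Real.div_rpow (by positivity) (by norm_num),
            Real.rpow_neg (by norm_num : (0 : ℝ) ≤ 4),
            ← Real.rpow_natCast, ← Real.rpow_mul hj0.le, div_inv_eq_mul, mul_comm]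
          norm_num
      _ ≤ _ := by
          gcongr
          calc (4 : ℝ) ^ (59 / 100 : ℝ) ≤ (4 : ℝ) ^ (1 : ℝ) :=
                Real.rpow_le_rpow_of_exponent_le (by norm_num) (by norm_num)
            _ = 4 := Real.rpow_one 4
  have e2 : 1 / (g P : ℝ) ≤ 3 * ((j : ℝ) ^ (1 / 20 : ℝ) * (g P : ℝ) ^ (-(21 / 20) : ℝ)) := by
    calc 1 / (g P : ℝ) = (g P : ℝ) ^ (1 / 20 : ℝ) * (g P : ℝ) ^ (-(21 / 20) : ℝ) := by
          rw [← Real.rpow_add hg0, one_div, ← Real.rpow_neg_one]; norm_num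
      _ ≤ (3 * (j : ℝ)) ^ (1 / 20 : ℝ) * (g P : ℝ) ^ (-(21 / 20) : ℝ) := by
          gcongr
          exact_mod_cast hg2
      _ = (3 : ℝ) ^ (1 / 20 : ℝ) * ((j : ℝ) ^ (1 / 20 : ℝ) * (g P : ℝ) ^ (-(21 / 20) : ℝ)) := by
          rw [Real.mul_rpow (by norm_num) hj0.le]; ring
      _ ≤ _ := by
          gcongr
          calc (3 : ℝ) ^ (1 / 20 : ℝ) ≤ (3 : ℝ) ^ (1 : ℝ) :=
                Real.rpow_le_rpow_of_exponent_le (by norm_num) (by norm_num)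
            _ = 3 := Real.rpow_one 3
  calc _ ≤ (C * (P : ℝ) ^ (1 / 100 : ℝ)) * ((P : ℝ) ^ (-(3 / 5) : ℝ) * (1 / (g P : ℝ))) := by
        gcongr; exact hC P hP
    _ = C * ((P : ℝ) ^ (1 / 100 : ℝ) * (P : ℝ) ^ (-(3 / 5) : ℝ)) * (1 / (g P : ℝ)) := by ring
    _ = C * (P : ℝ) ^ (-(59 / 100) : ℝ) * (1 / (g P : ℝ)) := by
        rw [← Real.rpow_add hP0]; norm_num
    _ ≤ C * (4 * (j : ℝ) ^ (-(59 / 50) : ℝ)) *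
        (3 * ((j : ℝ) ^ (1 / 20 : ℝ) * (g P : ℝ) ^ (-(21 / 20) : ℝ))) := by gcongr
    _ = 12 * C * (((j : ℝ) ^ (-(59 / 50) : ℝ) * (j : ℝ) ^ (1 / 20 : ℝ)) *
        (g P : ℝ) ^ (-(21 / 20) : ℝ)) := by ring
    _ = _ := by rw [← Real.rpow_add hj0]; norm_num

lemma summable_card_divisors_mul_squareGapWeight :
    Summable fun P : ℕ => (P.divisors.card : ℝ) * squareGapWeight P := by
  have hs : ∀ P, Nat.sqrt (4 * P) ^ 2 ≤ 4 * P ∧ 4 * P < (Nat.sqrt (4 * P) + 1) ^ 2 :=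
    fun P => ⟨Nat.sqrt_le' _, Nat.lt_succ_sqrt' _⟩
  have h1 := summable_card_divisors_mul_div
    (g := fun P => 4 * P - Nat.sqrt (4 * P) ^ 2 + 1) (by
      intro P Q h
      simp only [Prod.mk.injEq] at h
      have hP := hs P
      have hQ := hs Q
      rw [h.1] at hP h
      omega) (by
      intro P hP
      have h := hs P
      have : 1 ≤ Nat.sqrt (4 * P) := Nat.sqrt_pos.2 (by omega)
      generalize Nat.sqrt (4 * P) = j at *
      have e : (j + 1) ^ 2 = j ^ 2 + 2 * j + 1 := by ring
      omega)
  have h2 := summable_card_divisors_mul_div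
    (g := fun P => (Nat.sqrt (4 * P) + 1) ^ 2 - 4 * P) (by
      intro P Q h
      simp only [Prod.mk.injEq] at h
      have hP := hs P
      have hQ := hs Q
      rw [h.1] at hP h
      omega) (by
      intro P hP
      have h := hs P
      have : 1 ≤ Nat.sqrt (4 * P) := Nat.sqrt_pos.2 (by omega)
      generalize Nat.sqrt (4 * P) = j at *
      have e : (j + 1) ^ 2 = j ^ 2 + 2 * j + 1 := by ring
      omega)
  refine (h1.add h2).congr fun P => ?_
  simp only [squareGapWeight]
  ring

lemma sum_product_range_mul_le {G : ℕ → ℝ} (hG : ∀ P, 0 ≤ G P) (hG0 : G 0 = 0) (N : ℕ) :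
    ∑ x ∈ Finset.range N ×ˢ Finset.range N, G (x.1 * x.2) ≤
      ∑ P ∈ Finset.range (N * N), (P.divisors.card : ℝ) * G P := by
  have hmaps : ∀ x ∈ Finset.range N ×ˢ Finset.range N, x.1 * x.2 ∈ Finset.range (N * N) := by
    intro x hx
    simp only [Finset.mem_product, Finset.mem_range] at hx ⊢
    exact Nat.mul_lt_mul'' hx.1 hx.2
  rw [← Finset.sum_fiberwise_of_maps_to hmaps]
  apply Finset.sum_le_sum
  intro P _
  rw [Finset.sum_congr rfl (g := fun _ => G P) (fun x hx => by rw [(Finset.mem_filter.1 hx).2]),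
    Finset.sum_const, nsmul_eq_mul]
  rcases Nat.eq_zero_or_pos P with rfl | hP
  · simp [hG0]
  · gcongr
    · exact hG P
    · apply Finset.card_le_card_of_injOn Prod.fst
      · intro x hx
        have hx := (Finset.mem_filter.1 hx).2
        exact Finset.mem_coe.2 (Nat.mem_divisors.2 ⟨Dvd.intro _ hx, hP.ne'⟩)
      · intro x hx y hy hxy
        have hx := (Finset.mem_filter.1 hx).2
        have hy := (Finset.mem_filter.1 hy).2
        have h0 : 0 < x.1 := Nat.pos_of_mul_pos_right (hx ▸ hP)
        refine Prod.ext hxy (Nat.eq_of_mul_eq_mul_left h0 ?_)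
        rw [hx, hxy, hy]

lemma exists_sum_squareGapWeight_le : ∃ C : ℝ, 0 ≤ C ∧ ∀ N : ℕ,
    ∑ x ∈ Finset.range N ×ˢ Finset.range N, squareGapWeight (x.1 * x.2) ≤ C := by
  refine ⟨∑' P : ℕ, (P.divisors.card : ℝ) * squareGapWeight P,
    tsum_nonneg fun P => mul_nonneg (by positivity) (squareGapWeight_nonneg P), fun N => ?_⟩
  refine (sum_product_range_mul_le squareGapWeight_nonneg (by simp [squareGapWeight]) N).trans ?_
  exact summable_card_divisors_mul_squareGapWeight.sum_le_tsum _
    fun P _ => mul_nonneg (by positivity) (squareGapWeight_nonneg P)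

lemma abs_sqrt_sub_sqrt_eq {x y : ℝ} (hx : 0 ≤ x) (hy : 0 < y) :
    |Real.sqrt x - Real.sqrt y| = |x - y| / (Real.sqrt x + Real.sqrt y) := by
  have h1 : 0 < Real.sqrt x + Real.sqrt y := by positivity
  rw [eq_div_iff h1.ne']
  calc |Real.sqrt x - Real.sqrt y| * (Real.sqrt x + Real.sqrt y) =
      |(Real.sqrt x - Real.sqrt y) * (Real.sqrt x + Real.sqrt y)| := by rw [abs_mul, abs_of_pos h1]
    _ = |x - y| := by
      congr 1
      linear_combination Real.sq_sqrt hx - Real.sq_sqrt hy.le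

/-- The weight `x^{-1/5}/d` splits into two summable ones. -/
lemma rpow_neg_mul_inv_le {x d : ℝ} (hx : 0 < x) (hd : 0 < d) :
    x ^ (-(1 / 5) : ℝ) * d⁻¹ ≤ x ^ (-(6 / 5) : ℝ) + d ^ (-(6 / 5) : ℝ) := by
  have h1 : 0 < x ^ (-(6 / 5) : ℝ) := by positivity
  have h2 : 0 < d ^ (-(6 / 5) : ℝ) := by positivity
  rw [← Real.rpow_neg_one d]
  rcases le_total x d with h | h
  · calc _ ≤ x ^ (-(1 / 5) : ℝ) * x ^ (-1 : ℝ) := by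
          gcongr ?_ * ?_
          exact Real.rpow_le_rpow_of_nonpos hx h (by norm_num)
      _ = x ^ (-(6 / 5) : ℝ) := by rw [← Real.rpow_add hx]; norm_num
      _ ≤ _ := by linarith
  · calc _ ≤ d ^ (-(1 / 5) : ℝ) * d ^ (-1 : ℝ) := by
          gcongr ?_ * ?_
          exact Real.rpow_le_rpow_of_nonpos hd h (by norm_num)
      _ = d ^ (-(6 / 5) : ℝ) := by rw [← Real.rpow_add hd]; norm_num
      _ ≤ _ := by linarith

lemma rpow_le_distWeight {d : ℝ} {a b : ℕ} (h : 1 + |(a : ℝ) - b| ≤ 3 * d) :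
    d ^ (-(6 / 5) : ℝ) ≤ 9 * distWeight a b := by
  have hp : 0 < 1 + |(a : ℝ) - b| := by positivity
  calc d ^ (-(6 / 5) : ℝ) ≤ ((1 + |(a : ℝ) - b|) / 3) ^ (-(6 / 5) : ℝ) :=
        Real.rpow_le_rpow_of_nonpos (by positivity) (by linarith) (by norm_num)
    _ = (3 : ℝ) ^ (6 / 5 : ℝ) * distWeight a b := by
        rw [distWeight, Real.div_rpow hp.le (by norm_num),
          Real.rpow_neg (by norm_num : (0 : ℝ) ≤ 3),
          div_inv_eq_mul, mul_comm]
    _ ≤ _ := by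
        have := distWeight_nonneg a b
        gcongr
        calc (3 : ℝ) ^ (6 / 5 : ℝ) ≤ (3 : ℝ) ^ (2 : ℝ) :=
              Real.rpow_le_rpow_of_exponent_le (by norm_num) (by norm_num)
          _ = 9 := by norm_num

lemma rpow_mul_sqrt {n : ℝ} (hn : 0 < n) : n ^ (-(7 / 10) : ℝ) * Real.sqrt n =
    n ^ (-(1 / 5) : ℝ) := by
  rw [Real.sqrt_eq_rpow, ← Real.rpow_add hn]; norm_num

lemma rpow_div_sqrt {n : ℝ} (hn : 0 < n) : n ^ (-(7 / 10) : ℝ) / Real.sqrt n =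
    n ^ (-(6 / 5) : ℝ) := by
  rw [Real.sqrt_eq_rpow, ← Real.rpow_sub hn]; norm_num

lemma rpow_div_abs_sqrt_sub_le {m n : ℕ} (hm : 1 ≤ m) (hmn : m < n) :
    (n : ℝ) ^ (-(7 / 10) : ℝ) / |Real.sqrt m - Real.sqrt n| ≤ 18 * distWeight m n := by
  have hm0 : (0 : ℝ) < m := by exact_mod_cast hm
  have hmn1 : (m : ℝ) + 1 ≤ n := by exact_mod_cast hmn
  have hn0 : (0 : ℝ) < n := by linarith
  have hd : 0 < (n : ℝ) - m := by linarith
  have hs : Real.sqrt m ≤ Real.sqrt n := Real.sqrt_le_sqrt (by linarith)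
  have habs : |(m : ℝ) - n| = n - m := by rw [abs_sub_comm, abs_of_pos hd]
  rw [abs_sqrt_sub_sqrt_eq hm0.le hn0, habs]
  calc (n : ℝ) ^ (-(7 / 10) : ℝ) / ((n - m) / (Real.sqrt m + Real.sqrt n)) =
      (n : ℝ) ^ (-(7 / 10) : ℝ) * (Real.sqrt m + Real.sqrt n) * (n - m : ℝ)⁻¹ := by
        rw [div_div_eq_mul_div, div_eq_mul_inv]
    _ ≤ (n : ℝ) ^ (-(7 / 10) : ℝ) * (2 * Real.sqrt n) * (n - m : ℝ)⁻¹ := by gcongr; linarith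
    _ = 2 * ((n : ℝ) ^ (-(1 / 5) : ℝ) * (n - m : ℝ)⁻¹) := by rw [← rpow_mul_sqrt hn0]; ring
    _ ≤ 2 * ((n - m : ℝ) ^ (-(1 / 5) : ℝ) * (n - m : ℝ)⁻¹) := by
        gcongr 2 * (?_ * _)
        exact Real.rpow_le_rpow_of_nonpos hd (by linarith) (by norm_num)
    _ = 2 * (n - m : ℝ) ^ (-(6 / 5) : ℝ) := by
        rw [← Real.rpow_neg_one (n - m : ℝ), ← Real.rpow_add hd]; norm_num
    _ ≤ 2 * (9 * distWeight m n) := by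
        gcongr
        apply rpow_le_distWeight
        rw [habs]; linarith
    _ = _ := by ring

lemma distWeight_comm (a b : ℕ) : distWeight a b = distWeight b a := by
  rw [distWeight, distWeight, abs_sub_comm]

/-- Convergence of the sum controlling the off-diagonal terms of the second moment. -/
lemma exists_sum_pair_le : ∃ C : ℝ, 0 ≤ C ∧ ∀ N : ℕ,
    ∑ m ∈ Finset.range N, ∑ n ∈ Finset.range N,
      ((m : ℝ) ^ (-(11 / 10) : ℝ) + (n : ℝ) ^ (-(11 / 10) : ℝ)) * distWeight m n ≤ C := by
  obtain ⟨Z, hZ0, hZ⟩ := exists_sum_distWeight_le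
  have hs : Summable fun n : ℕ => (n : ℝ) ^ (-(11 / 10) : ℝ) :=
    Real.summable_nat_rpow.2 (by norm_num)
  refine ⟨2 * ((∑' n : ℕ, (n : ℝ) ^ (-(11 / 10) : ℝ)) * Z), ?_, fun N => ?_⟩
  · have : 0 ≤ ∑' n : ℕ, (n : ℝ) ^ (-(11 / 10) : ℝ) := tsum_nonneg fun n => by positivity
    positivity
  have key : ∑ m ∈ Finset.range N, ∑ n ∈ Finset.range N,
      (m : ℝ) ^ (-(11 / 10) : ℝ) * distWeight m n ≤ (∑' n : ℕ, (n : ℝ) ^ (-(11 / 10) : ℝ)) * Z := by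
    calc _ ≤ ∑ m ∈ Finset.range N, (m : ℝ) ^ (-(11 / 10) : ℝ) * Z := by
          apply Finset.sum_le_sum
          intro m _
          rw [← Finset.mul_sum]
          gcongr
          exact hZ m N
      _ ≤ _ := by
          rw [← Finset.sum_mul]
          gcongr
          exact hs.sum_le_tsum _ fun n _ => by positivity
  have key2 : ∑ m ∈ Finset.range N, ∑ n ∈ Finset.range N,
      (n : ℝ) ^ (-(11 / 10) : ℝ) * distWeight m n ≤ (∑' n : ℕ, (n : ℝ) ^ (-(11 / 10) : ℝ)) * Z := by
    rw [Finset.sum_comm]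
    refine le_trans (le_of_eq ?_) key
    exact Finset.sum_congr rfl fun m _ => Finset.sum_congr rfl fun n _ => by rw [distWeight_comm]
  simp_rw [add_mul, Finset.sum_add_distrib]
  linarith

lemma three_div_le {d u w : ℝ} (hd : 0 < d) (hw : 0 < w) (h : w ≤ 8 * (d * u)) :
    3 / d ≤ 24 * u * (1 / w) := by
  rw [mul_one_div, div_le_div_iff₀ hd hw]
  linarith

lemma rpow_div_abs_add_sub_le {a b : ℕ} (ha : 1 ≤ a) (hb : 1 ≤ b) (n : ℕ) :
    (n : ℝ) ^ (-(7 / 10) : ℝ) / |Real.sqrt a + Real.sqrt b - Real.sqrt n| ≤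
      3 * (n : ℝ) ^ (-(6 / 5) : ℝ) + 27 * distWeight (a + b + Nat.sqrt (4 * (a * b))) n +
      ((if a + b + Nat.sqrt (4 * (a * b)) = n then 24 * Real.sqrt (a * b) *
          (1 / ((4 * (a * b) - Nat.sqrt (4 * (a * b)) ^ 2 + 1 : ℕ) : ℝ)) else 0) +
        (if a + b + Nat.sqrt (4 * (a * b)) + 1 = n then 24 * Real.sqrt (a * b) *
          (1 / (((Nat.sqrt (4 * (a * b)) + 1) ^ 2 - 4 * (a * b) : ℕ) : ℝ)) else 0)) := by
  have ha1 : (1 : ℝ) ≤ a := by exact_mod_cast ha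
  have hb1 : (1 : ℝ) ≤ b := by exact_mod_cast hb
  obtain ⟨P, hP⟩ : ∃ P, P = a * b := ⟨_, rfl⟩
  have hPR : (a : ℝ) * b = P := by rw [hP]; push_cast; rfl
  have hP1 : (1 : ℝ) ≤ P := by rw [← hPR]; nlinarith
  rw [hPR, ← hP]
  set j := Nat.sqrt (4 * P) with hj
  have hj1 : j ^ 2 ≤ 4 * P := Nat.sqrt_le' _
  have hj2 : 4 * P < (j + 1) ^ 2 := Nat.lt_succ_sqrt' _
  clear_value j
  have hD := distWeight_nonneg (a + b + j) n
  have hA : 0 ≤ (if a + b + j = n then 24 * Real.sqrt P *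
      (1 / ((4 * P - j ^ 2 + 1 : ℕ) : ℝ)) else 0) := by split_ifs <;> positivity
  have hB : 0 ≤ (if a + b + j + 1 = n then 24 * Real.sqrt P *
      (1 / (((j + 1) ^ 2 - 4 * P : ℕ) : ℝ)) else 0) := by split_ifs <;> positivity
  have hn6 : 0 ≤ (n : ℝ) ^ (-(6 / 5) : ℝ) := by positivity
  by_cases hΔ : Real.sqrt a + Real.sqrt b - Real.sqrt n = 0
  · rw [hΔ, abs_zero, div_zero]; positivity
  rcases Nat.eq_zero_or_pos n with rfl | hn
  · have e : ((0 : ℕ) : ℝ) ^ (-(7 / 10) : ℝ) = 0 := by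
      rw [Nat.cast_zero]; exact Real.zero_rpow (by norm_num)
    rw [e, zero_div]
    linarith
  have hn0 : (0 : ℝ) < n := by exact_mod_cast hn
  have hn1 : (1 : ℝ) ≤ n := by exact_mod_cast hn
  set u := Real.sqrt P with hu
  have hu2 : u ^ 2 = P := Real.sq_sqrt (by positivity)
  have hu1 : 1 ≤ u := Real.one_le_sqrt.2 hP1
  have huab : u = Real.sqrt a * Real.sqrt b := by rw [hu, ← hPR, Real.sqrt_mul (by positivity)]
  set σ := Real.sqrt a + Real.sqrt b with hσ
  have hσ0 : 0 < σ := by positivity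
  obtain ⟨s, hs⟩ : ∃ s : ℝ, s = a + b + 2 * u := ⟨_, rfl⟩
  have hσs : σ = Real.sqrt s := by
    symm
    rw [Real.sqrt_eq_iff_mul_self_eq_of_pos hσ0, hs, huab, hσ]
    nlinarith [Real.sq_sqrt (by positivity : (0 : ℝ) ≤ a),
      Real.sq_sqrt (by positivity : (0 : ℝ) ≤ b)]
  have hs0 : 0 < s := by rw [hs]; positivity
  have hju : (j : ℝ) ≤ 2 * u := by
    have : (j : ℝ) ^ 2 ≤ 4 * P := by exact_mod_cast hj1
    rw [← hu2] at this
    exact le_of_sq_le_sq (by linarith) (by linarith)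
  have hju2 : 2 * u < j + 1 := by
    have : (4 : ℝ) * P < (j + 1) ^ 2 := by exact_mod_cast hj2
    rw [← hu2] at this
    exact lt_of_pow_lt_pow_left₀ 2 (by positivity) (by linarith)
  set y := Real.sqrt n with hy
  have hy0 : 0 < y := Real.sqrt_pos.2 hn0
  clear_value u y σ
  rcases le_or_gt y (σ / 2) with hyσ | hyσ
  · have h1 : y ≤ |σ - y| := by rw [abs_of_pos (by linarith)]; linarith
    calc _ ≤ (n : ℝ) ^ (-(7 / 10) : ℝ) / y := by gcongr
      _ = (n : ℝ) ^ (-(6 / 5) : ℝ) := by rw [hy]; exact rpow_div_sqrt hn0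
      _ ≤ _ := by linarith
  obtain ⟨d, hd⟩ : ∃ d, d = |s - n| := ⟨_, rfl⟩
  have hd0 : 0 < d := by
    rw [hd, abs_pos]
    intro h0
    apply hΔ
    rw [hσs, hy, sub_eq_zero.1 h0, sub_self]
  have hmain : (n : ℝ) ^ (-(7 / 10) : ℝ) / |σ - y| ≤ 3 * ((n : ℝ) ^ (-(1 / 5) : ℝ) * d⁻¹) := by
    rw [hσs, hy, abs_sqrt_sub_sqrt_eq hs0.le hn0, ← hσs, ← hy, ← hd, div_div_eq_mul_div,
      div_eq_mul_inv, ← rpow_mul_sqrt hn0, ← hy]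
    calc _ ≤ (n : ℝ) ^ (-(7 / 10) : ℝ) * (3 * y) * d⁻¹ := by gcongr; linarith
      _ = _ := by ring
  refine hmain.trans ?_
  rcases le_or_gt 1 d with hd1 | hd1
  · have h1 := rpow_neg_mul_inv_le hn0 hd0
    have h2 : d ^ (-(6 / 5) : ℝ) ≤ 9 * distWeight (a + b + j) n := by
      apply rpow_le_distWeight
      have : |((a + b + j : ℕ) : ℝ) - n| ≤ 1 + d := by
        have e : ((a + b + j : ℕ) : ℝ) - n = -(2 * u - j) + (s - n) := by rw [hs]; push_cast; ring
        rw [e, hd]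
        refine (abs_add_le _ _).trans ?_
        gcongr
        rw [abs_neg, abs_of_nonneg (by linarith)]
        linarith
      linarith
    linarith
  · have hn15 : (n : ℝ) ^ (-(1 / 5) : ℝ) ≤ 1 :=
      Real.rpow_le_one_of_one_le_of_nonpos hn1 (by norm_num)
    have hmain2 : 3 * ((n : ℝ) ^ (-(1 / 5) : ℝ) * d⁻¹) ≤ 3 / d := by
      calc _ ≤ 3 * (1 * d⁻¹) := by gcongr
        _ = 3 / d := by rw [one_mul, div_eq_mul_inv]
    rw [hd, abs_lt] at hd1
    have hcase : a + b + j = n ∨ a + b + j + 1 = n := by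
      have h1 : ((a + b + j : ℕ) : ℝ) < n + 1 := by push_cast; linarith
      have h2 : (n : ℝ) < ((a + b + j + 2 : ℕ) : ℝ) := by push_cast; linarith
      have h1' : a + b + j < n + 1 := by exact_mod_cast h1
      have h2' : n < a + b + j + 2 := by exact_mod_cast h2
      omega
    rcases hcase with h | h
    · rw [if_pos h] at hA ⊢
      have hnR : (n : ℝ) = a + b + j := by rw [← h]; push_cast; ring
      have hde : d = 2 * u - j := by
        rw [hd, hs, hnR, show (a : ℝ) + b + 2 * u - (a + b + j) = 2 * u - j by ring,
          abs_of_nonneg (by linarith)]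
      have hw : ((4 * P - j ^ 2 + 1 : ℕ) : ℝ) = d * (2 * u + j) + 1 := by
        rw [Nat.cast_add, Nat.cast_sub hj1, hde]
        push_cast
        rw [← hu2]; ring
      have hw1 : (2 : ℝ) ≤ ((4 * P - j ^ 2 + 1 : ℕ) : ℝ) := by
        have : (1 : ℝ) < ((4 * P - j ^ 2 + 1 : ℕ) : ℝ) := by
          rw [hw]; linarith [mul_pos hd0
            (by linarith [Nat.cast_nonneg (α := ℝ) j] : 0 < 2 * u + (j : ℝ))]
        have h3 : 1 < 4 * P - j ^ 2 + 1 := by exact_mod_cast this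
        exact_mod_cast (by omega : 2 ≤ 4 * P - j ^ 2 + 1)
      have hfin : 3 / d ≤ 24 * u * (1 / ((4 * P - j ^ 2 + 1 : ℕ) : ℝ)) := by
        apply three_div_le hd0 (by linarith)
        have : d * (2 * u + j) ≤ d * (4 * u) := mul_le_mul_of_nonneg_left (by linarith) hd0.le
        linarith
      linarith
    · rw [if_pos h] at hB ⊢
      have hnR : (n : ℝ) = a + b + j + 1 := by rw [← h]; push_cast; ring
      have hde : d = j + 1 - 2 * u := by
        rw [hd, hs, hnR, show (a : ℝ) + b + 2 * u - (a + b + j + 1) = -(j + 1 - 2 * u) by ring,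
          abs_neg, abs_of_nonneg (by linarith)]
      have hw : (((j + 1) ^ 2 - 4 * P : ℕ) : ℝ) = d * (2 * u + j + 1) := by
        rw [Nat.cast_sub hj2.le, hde]
        push_cast
        rw [← hu2]; ring
      have hfin : 3 / d ≤ 24 * u * (1 / (((j + 1) ^ 2 - 4 * P : ℕ) : ℝ)) := by
        rw [hw]
        have h3 : (0 : ℝ) ≤ j := Nat.cast_nonneg j
        apply three_div_le hd0 (mul_pos hd0 (by linarith))
        have : d * (2 * u + j + 1) ≤ d * (8 * u) := mul_le_mul_of_nonneg_left (by linarith) hd0.le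
        linarith
      linarith

lemma natCast_rpow_nonneg (n : ℕ) (p : ℝ) : 0 ≤ (n : ℝ) ^ p :=
    Real.rpow_nonneg (Nat.cast_nonneg n) p

lemma sum_range_rpow_le {p : ℝ} (hp : p < -1) (N : ℕ) :
    ∑ n ∈ Finset.range N, (n : ℝ) ^ p ≤ ∑' n : ℕ, (n : ℝ) ^ p :=
  (Real.summable_nat_rpow.2 hp).sum_le_tsum _ fun n _ => natCast_rpow_nonneg n p

lemma tsum_natCast_rpow_nonneg (p : ℝ) : 0 ≤ ∑' n : ℕ, (n : ℝ) ^ p :=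
  tsum_nonneg fun n => natCast_rpow_nonneg n p

lemma rpow_mul_sqrt_mul_eq {P : ℕ} (hP : 1 ≤ P) :
    (P : ℝ) ^ (-(11 / 10) : ℝ) * (24 * Real.sqrt P *
        (1 / ((4 * P - Nat.sqrt (4 * P) ^ 2 + 1 : ℕ) : ℝ)) + 24 * Real.sqrt P *
        (1 / (((Nat.sqrt (4 * P) + 1) ^ 2 - 4 * P : ℕ) : ℝ))) = 24 * squareGapWeight P := by
  have hP0 : (0 : ℝ) < P := by exact_mod_cast hP
  have h : (P : ℝ) ^ (-(11 / 10) : ℝ) * Real.sqrt P = (P : ℝ) ^ (-(3 / 5) : ℝ) := by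
    rw [Real.sqrt_eq_rpow, ← Real.rpow_add hP0]; norm_num
  rw [squareGapWeight, ← h]
  ring

lemma exists_sum_rpow_div_abs_add_sub_le : ∃ C : ℝ, 0 ≤ C ∧ ∀ a b : ℕ, ∀ N : ℕ,
    ∑ n ∈ Finset.range N, (a : ℝ) ^ (-(11 / 10) : ℝ) * (b : ℝ) ^ (-(11 / 10) : ℝ) *
      ((n : ℝ) ^ (-(7 / 10) : ℝ) / |Real.sqrt a + Real.sqrt b - Real.sqrt n|) ≤
      C * ((a : ℝ) ^ (-(11 / 10) : ℝ) * (b : ℝ) ^ (-(11 / 10) : ℝ)) +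
        24 * squareGapWeight (a * b) := by
  obtain ⟨Z, hZ0, hZ⟩ := exists_sum_distWeight_le
  have hz0 := tsum_natCast_rpow_nonneg (-(6 / 5))
  refine ⟨3 * (∑' n : ℕ, (n : ℝ) ^ (-(6 / 5) : ℝ)) + 27 * Z, by positivity, fun a b N => ?_⟩
  have hsq := squareGapWeight_nonneg (a * b)
  rcases Nat.eq_zero_or_pos a with rfl | ha
  · simp only [Nat.cast_zero, Real.zero_rpow (show (-(11 / 10) : ℝ) ≠ 0 by norm_num), zero_mul,
      Finset.sum_const_zero, mul_zero, zero_add] at *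
    linarith
  rcases Nat.eq_zero_or_pos b with rfl | hb
  · simp only [Nat.cast_zero, Real.zero_rpow (show (-(11 / 10) : ℝ) ≠ 0 by norm_num), zero_mul,
      Finset.sum_const_zero, mul_zero, zero_add] at *
    linarith
  have hP : 1 ≤ a * b := Nat.mul_pos ha hb
  have key := rpow_mul_sqrt_mul_eq hP
  rw [Nat.cast_mul, Real.mul_rpow (by positivity) (by positivity)] at key
  rw [← Finset.mul_sum, ← key, mul_comm (3 * _ + _), ← mul_add]
  refine mul_le_mul_of_nonneg_left ?_
    (mul_nonneg (natCast_rpow_nonneg _ _) (natCast_rpow_nonneg _ _))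
  refine (Finset.sum_le_sum fun n _ => rpow_div_abs_add_sub_le ha hb n).trans ?_
  rw [Finset.sum_add_distrib, Finset.sum_add_distrib, Finset.sum_add_distrib, ← Finset.mul_sum,
    ← Finset.mul_sum]
  have h1 := sum_range_rpow_le (show -(6 / 5 : ℝ) < -1 by norm_num) N
  have h2 := hZ (a + b + Nat.sqrt (4 * (a * b))) N
  rw [Finset.sum_ite_eq, Finset.sum_ite_eq]
  have h3 : 0 ≤ 24 * Real.sqrt (a * b) *
      (1 / ((4 * (a * b) - Nat.sqrt (4 * (a * b)) ^ 2 + 1 : ℕ) : ℝ)) := by positivity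
  have h4 : 0 ≤ 24 * Real.sqrt (a * b) *
      (1 / (((Nat.sqrt (4 * (a * b)) + 1) ^ 2 - 4 * (a * b) : ℕ) : ℝ)) := by positivity
  gcongr
  · split_ifs
    · exact le_rfl
    · exact h3
  · split_ifs
    · exact le_rfl
    · exact h4

lemma exists_sum_triple_sub_le : ∃ C : ℝ, 0 ≤ C ∧ ∀ N : ℕ,
    ∑ a ∈ Finset.range N, ∑ b ∈ Finset.range N, ∑ n ∈ Finset.range N,
      (a : ℝ) ^ (-(11 / 10) : ℝ) * (b : ℝ) ^ (-(11 / 10) : ℝ) *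
      ((n : ℝ) ^ (-(7 / 10) : ℝ) / |Real.sqrt a + Real.sqrt b - Real.sqrt n|) ≤ C := by
  obtain ⟨K, hK0, hK⟩ := exists_sum_rpow_div_abs_add_sub_le
  obtain ⟨S, hS0, hS⟩ := exists_sum_squareGapWeight_le
  have hz0 := tsum_natCast_rpow_nonneg (-(11 / 10))
  refine ⟨K * ((∑' n : ℕ, (n : ℝ) ^ (-(11 / 10) : ℝ)) * ∑' n : ℕ, (n : ℝ) ^ (-(11 / 10) : ℝ)) +
    24 * S, by positivity, fun N => ?_⟩
  refine (Finset.sum_le_sum fun a _ => Finset.sum_le_sum fun b _ => hK a b N).trans ?_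
  simp_rw [Finset.sum_add_distrib, ← Finset.mul_sum, ← Finset.sum_mul]
  have h1 := sum_range_rpow_le (show -(11 / 10 : ℝ) < -1 by norm_num) N
  have h0 : 0 ≤ ∑ n ∈ Finset.range N, (n : ℝ) ^ (-(11 / 10) : ℝ) :=
    Finset.sum_nonneg fun n _ => natCast_rpow_nonneg n _
  have h2 := hS N
  rw [Finset.sum_product] at h2
  gcongr

lemma exists_sum_triple_add_le : ∃ C : ℝ, 0 ≤ C ∧ ∀ N : ℕ,
    ∑ a ∈ Finset.range N, ∑ b ∈ Finset.range N, ∑ n ∈ Finset.range N,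
      (a : ℝ) ^ (-(11 / 10) : ℝ) * (b : ℝ) ^ (-(11 / 10) : ℝ) *
      ((n : ℝ) ^ (-(7 / 10) : ℝ) / |Real.sqrt a + Real.sqrt b + Real.sqrt n|) ≤ C := by
  have hz0 := tsum_natCast_rpow_nonneg (-(11 / 10))
  have hy0 := tsum_natCast_rpow_nonneg (-(6 / 5))
  refine ⟨(∑' n : ℕ, (n : ℝ) ^ (-(11 / 10) : ℝ)) * (∑' n : ℕ, (n : ℝ) ^ (-(11 / 10) : ℝ)) *
    (∑' n : ℕ, (n : ℝ) ^ (-(6 / 5) : ℝ)), by positivity, fun N => ?_⟩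
  have hterm : ∀ a b n : ℕ, (n : ℝ) ^ (-(7 / 10) : ℝ) / |Real.sqrt a + Real.sqrt b + Real.sqrt n| ≤
      (n : ℝ) ^ (-(6 / 5) : ℝ) := by
    intro a b n
    rcases Nat.eq_zero_or_pos n with rfl | hn
    · rw [Nat.cast_zero, Real.zero_rpow (by norm_num), Real.zero_rpow (by norm_num), zero_div]
    · have hn0 : (0 : ℝ) < n := by exact_mod_cast hn
      rw [← rpow_div_sqrt hn0]
      have : 0 < Real.sqrt n := Real.sqrt_pos.2 hn0
      gcongr
      exact le_trans (by linarith [Real.sqrt_nonneg (a : ℝ), Real.sqrt_nonneg (b : ℝ)])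
        (le_abs_self _)
  calc _ ≤ ∑ a ∈ Finset.range N, ∑ b ∈ Finset.range N, ∑ n ∈ Finset.range N,
      (a : ℝ) ^ (-(11 / 10) : ℝ) * (b : ℝ) ^ (-(11 / 10) : ℝ) * (n : ℝ) ^ (-(6 / 5) : ℝ) := by
        gcongr with a _ b _ n _
        exact hterm a b n
    _ = (∑ n ∈ Finset.range N, (n : ℝ) ^ (-(11 / 10) : ℝ)) *
        (∑ n ∈ Finset.range N, (n : ℝ) ^ (-(11 / 10) : ℝ)) *
        (∑ n ∈ Finset.range N, (n : ℝ) ^ (-(6 / 5) : ℝ)) := by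
        simp_rw [← Finset.mul_sum, ← Finset.sum_mul]
        simp_rw [← Finset.mul_sum, ← Finset.sum_mul]
    _ ≤ _ := by
        have h1 := sum_range_rpow_le (show -(11 / 10 : ℝ) < -1 by norm_num) N
        have h2 := sum_range_rpow_le (show -(6 / 5 : ℝ) < -1 by norm_num) N
        have h0 : 0 ≤ ∑ n ∈ Finset.range N, (n : ℝ) ^ (-(11 / 10) : ℝ) :=
          Finset.sum_nonneg fun n _ => natCast_rpow_nonneg n _
        have h0' : 0 ≤ ∑ n ∈ Finset.range N, (n : ℝ) ^ (-(6 / 5) : ℝ) :=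
          Finset.sum_nonneg fun n _ => natCast_rpow_nonneg n _
        gcongr

/-- The weight of a solution of `√a + √b = √n`, and zero off the solution set. -/
noncomputable def diagWeight (x : ℕ × ℕ × ℕ) : ℝ :=
  if Real.sqrt x.1 + Real.sqrt x.2.1 = Real.sqrt x.2.2 then
    (x.1 : ℝ) ^ (-(2 / 5) : ℝ) * (x.2.1 : ℝ) ^ (-(2 / 5) : ℝ) * (x.2.2 : ℝ) ^ (-(2 / 5) : ℝ) else 0

lemma diagWeight_nonneg (x : ℕ × ℕ × ℕ) : 0 ≤ diagWeight x := by
  unfold diagWeight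
  split_ifs
  · positivity
  · exact le_rfl

lemma eq_of_sqrt_add_sqrt_eq {a b n : ℕ} (h : Real.sqrt a + Real.sqrt b = Real.sqrt n) :
    n = a + b + Nat.sqrt (4 * (a * b)) ∧ Nat.sqrt (4 * (a * b)) ^ 2 = 4 * (a * b) := by
  have ha := Real.sq_sqrt (Nat.cast_nonneg (α := ℝ) a)
  have hb := Real.sq_sqrt (Nat.cast_nonneg (α := ℝ) b)
  have hn := Real.sq_sqrt (Nat.cast_nonneg (α := ℝ) n)
  have h2 : 2 * (Real.sqrt a * Real.sqrt b) = (n : ℝ) - a - b := by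
    rw [← h] at hn
    linarith [hn, ha, hb, show (√(a : ℝ) + √b) ^ 2 = √(a : ℝ) ^ 2 + √b ^ 2 + 2 * (√a * √b) by ring]
  have h3 : 4 * ((a : ℝ) * b) = ((n : ℝ) - a - b) ^ 2 := by
    rw [← h2, mul_pow, mul_pow, ha, hb]; norm_num
  have hge : (a : ℝ) + b ≤ n := by
    have : 0 ≤ Real.sqrt a * Real.sqrt b := by positivity
    linarith
  have hge' : a + b ≤ n := by exact_mod_cast hge
  obtain ⟨k, rfl⟩ := Nat.exists_eq_add_of_le hge'
  have h4 : 4 * (a * b) = k * k := by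
    have : (4 : ℝ) * (a * b) = k * k := by rw [h3]; push_cast; ring
    exact_mod_cast this
  rw [h4, Nat.sqrt_eq]
  exact ⟨rfl, by ring⟩

lemma diagWeight_le (a b n : ℕ) : diagWeight (a, b, n) ≤
    if a + b + Nat.sqrt (4 * (a * b)) = n then squareGapWeight (a * b) else 0 := by
  have h0 : 0 ≤ if a + b + Nat.sqrt (4 * (a * b)) = n then squareGapWeight (a * b) else 0 := by
    split_ifs
    · exact squareGapWeight_nonneg _
    · exact le_rfl
  by_cases h : Real.sqrt a + Real.sqrt b = Real.sqrt n
  swap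
  · rw [diagWeight, if_neg h]; exact h0
  rw [diagWeight, if_pos h]
  obtain ⟨h1, h2⟩ := eq_of_sqrt_add_sqrt_eq h
  dsimp only
  rcases Nat.eq_zero_or_pos a with rfl | ha
  · rw [Nat.cast_zero, Real.zero_rpow (by norm_num), zero_mul, zero_mul]; exact h0
  rcases Nat.eq_zero_or_pos b with rfl | hb
  · rw [Nat.cast_zero, Real.zero_rpow (by norm_num), mul_zero, zero_mul]; exact h0
  rw [if_pos h1.symm]
  have hP : (0 : ℝ) < ((a * b : ℕ) : ℝ) := by exact_mod_cast Nat.mul_pos ha hb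
  have hn : (((a * b : ℕ) : ℝ)) ^ (1 / 2 : ℝ) ≤ n := by
    rw [← Real.sqrt_eq_rpow]
    apply Real.sqrt_le_iff.2
    refine ⟨by positivity, ?_⟩
    have : a * b ≤ n ^ 2 := by
      rw [h1]
      nlinarith [Nat.zero_le (Nat.sqrt (4 * (a * b))), Nat.zero_le a, Nat.zero_le b]
    exact_mod_cast this
  calc _ = ((a * b : ℕ) : ℝ) ^ (-(2 / 5) : ℝ) * (n : ℝ) ^ (-(2 / 5) : ℝ) := by
        rw [Nat.cast_mul, Real.mul_rpow (by positivity) (by positivity)]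
    _ ≤ ((a * b : ℕ) : ℝ) ^ (-(2 / 5) : ℝ) *
        (((a * b : ℕ) : ℝ) ^ (1 / 2 : ℝ)) ^ (-(2 / 5) : ℝ) := by
        gcongr ?_ * ?_
        exact Real.rpow_le_rpow_of_nonpos (by positivity) hn (by norm_num)
    _ = ((a * b : ℕ) : ℝ) ^ (-(3 / 5) : ℝ) := by
        rw [← Real.rpow_mul hP.le, ← Real.rpow_add hP]; norm_num
    _ ≤ squareGapWeight (a * b) := by
        rw [squareGapWeight, h2, Nat.sub_self]
        apply le_mul_of_one_le_right (by positivity)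
        simp

lemma summable_diagWeight : Summable diagWeight := by
  obtain ⟨S, hS0, hS⟩ := exists_sum_squareGapWeight_le
  refine summable_of_sum_le (c := S) diagWeight_nonneg fun u => ?_
  obtain ⟨N, hN⟩ : ∃ N, u ⊆ Finset.range N ×ˢ Finset.range N ×ˢ Finset.range N := by
    refine ⟨∑ x ∈ u, (x.1 + x.2.1 + x.2.2) + 1, fun x hx => ?_⟩
    have := Finset.single_le_sum (f := fun x : ℕ × ℕ × ℕ => x.1 + x.2.1 + x.2.2)
      (fun _ _ => Nat.zero_le _) hx
    simp only [Finset.mem_product, Finset.mem_range]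
    omega
  refine (Finset.sum_le_sum_of_subset_of_nonneg hN fun x _ _ => diagWeight_nonneg x).trans ?_
  refine le_trans ?_ (hS N)
  rw [Finset.sum_product, Finset.sum_product]
  refine Finset.sum_le_sum fun a _ => ?_
  rw [Finset.sum_product]
  refine Finset.sum_le_sum fun b _ => ?_
  refine (Finset.sum_le_sum fun n _ => diagWeight_le a b n).trans ?_
  rw [Finset.sum_ite_eq]
  split_ifs
  · exact le_rfl
  · exact squareGapWeight_nonneg _

lemma integral_rpow_mul_cis_aux {p T Δ : ℝ} (hp : 1 / 2 ≤ p) (hT : 1 ≤ T) (hΔ : 0 < Δ) :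
    ‖∫ t in (1 : ℝ)..T, ((t ^ p : ℝ) : ℂ) * cis (Δ * Real.sqrt t)‖ ≤ T ^ (p + 1 / 2) / Δ := by
  have hpos : ∀ t ∈ Set.Icc 1 T, (0 : ℝ) < t := fun t ht => lt_of_lt_of_le one_pos ht.1
  have h := norm_integral_mul_cis_le_of_nonneg (a := 1) (b := T) hT
    (φ := fun t => Δ * Real.sqrt t) (φ' := fun t => Δ * (1 / (2 * Real.sqrt t)))
    (r := fun t => 2 / Δ * t ^ (p + 1 / 2))
    (r' := fun t => 2 / Δ * ((p + 1 / 2) * t ^ (p + 1 / 2 - 1)))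
    (fun t ht => (Real.hasDerivAt_sqrt (hpos t ht).ne').const_mul Δ)
    (fun t ht => (Real.hasDerivAt_rpow_const (Or.inl (hpos t ht).ne')).const_mul _)
    (by
      refine ContinuousOn.mul continuousOn_const (ContinuousOn.div continuousOn_const ?_ ?_)
      · fun_prop
      · intro t ht
        have := Real.sqrt_pos.2 (hpos t ht)
        positivity)
    (by
      refine ContinuousOn.mul continuousOn_const (ContinuousOn.mul continuousOn_const ?_)
      exact fun t ht =>
        (Real.continuousAt_rpow_const t _ (Or.inl (hpos t ht).ne')).continuousWithinAt)
    (fun t ht => by have := hpos t ht; positivity) (by positivity)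
  have e : ∫ t in (1 : ℝ)..T, ((t ^ p : ℝ) : ℂ) * cis (Δ * Real.sqrt t) =
      ∫ t in (1 : ℝ)..T, (((2 / Δ * t ^ (p + 1 / 2)) * (Δ * (1 / (2 * Real.sqrt t))) : ℝ) : ℂ) *
        cis (Δ * Real.sqrt t) := by
    apply intervalIntegral.integral_congr
    intro t ht
    rw [Set.uIcc_of_le hT] at ht
    have ht0 := hpos t ht
    have hs := Real.sqrt_pos.2 ht0
    dsimp only
    congr 2
    rw [Real.rpow_add ht0, ← Real.sqrt_eq_rpow]
    field_simp
  rw [e]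
  refine h.trans ?_
  have hT0 : 0 < T ^ (p + 1 / 2) := by positivity
  rw [div_mul_eq_mul_div, div_div, div_le_div_iff₀ (by positivity) hΔ]
  have := Real.two_le_pi
  nlinarith [mul_pos hT0 hΔ]

lemma norm_integral_rpow_mul_cis_le {p T Δ : ℝ} (hp : 1 / 2 ≤ p) (hT : 1 ≤ T) (hΔ : Δ ≠ 0) :
    ‖∫ t in (1 : ℝ)..T, ((t ^ p : ℝ) : ℂ) * cis (Δ * Real.sqrt t)‖ ≤ T ^ (p + 1 / 2) / |Δ| := by
  rcases lt_or_gt_of_ne hΔ with h | h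
  · have h2 := integral_rpow_mul_cis_aux hp hT (neg_pos.2 h)
    rw [abs_of_neg h]
    refine le_trans (le_of_eq ?_) h2
    rw [← RCLike.norm_conj, intervalIntegral.integral_of_le hT, ← integral_conj,
      ← intervalIntegral.integral_of_le hT]
    congr 1
    apply intervalIntegral.integral_congr
    intro t _
    dsimp only
    rw [map_mul, Complex.conj_ofReal, neg_mul, cis_neg]
  · rw [abs_of_pos h]
    exact integral_rpow_mul_cis_aux hp hT h

lemma norm_integral_rpow_mul_cis_sub_le {p T : ℝ} (hp : 1 / 2 ≤ p) (hT : 1 ≤ T) (Δ : ℝ) :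
    ‖(∫ t in (1 : ℝ)..T, ((t ^ p : ℝ) : ℂ) * cis (Δ * Real.sqrt t)) -
      (((T ^ (p + 1) - 1) / (p + 1) : ℝ) : ℂ) * (if Δ = 0 then 1 else 0)‖ ≤
      T ^ (p + 1 / 2) / |Δ| := by
  split_ifs with h
  · subst h
    have e : ∫ t in (1 : ℝ)..T, ((t ^ p : ℝ) : ℂ) * cis (0 * Real.sqrt t) =
        (((T ^ (p + 1) - 1) / (p + 1) : ℝ) : ℂ) := by
      simp only [zero_mul, cis_zero, mul_one]
      rw [intervalIntegral.integral_ofReal, integral_rpow (Or.inl (by linarith)), Real.one_rpow]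
    rw [e, mul_one, sub_self, norm_zero, abs_zero, div_zero]
  · rw [mul_zero, sub_zero]
    exact norm_integral_rpow_mul_cis_le hp hT h

lemma continuous_rpow_mul_cis {p : ℝ} (hp : 0 ≤ p) (Δ : ℝ) :
    Continuous fun t : ℝ => ((t ^ p : ℝ) : ℂ) * cis (Δ * Real.sqrt t) := by
  have h1 : Continuous fun t : ℝ => t ^ p := Real.continuous_rpow_const hp
  have h2 : Continuous fun t : ℝ => cis (Δ * Real.sqrt t) := continuous_cis.comp (by fun_prop)
  exact (Complex.continuous_ofReal.comp h1).mul h2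

/-- Weighted mean value of an exponential sum in `√t`. -/
lemma norm_integral_rpow_mul_sum_sub_le {ι : Type*} (s : Finset ι) (c : ι → ℂ) (Δ : ι → ℝ)
    {p T : ℝ} (hp : 1 / 2 ≤ p) (hT : 1 ≤ T) :
    ‖(∫ t in (1 : ℝ)..T, ((t ^ p : ℝ) : ℂ) * ∑ i ∈ s, c i * cis (Δ i * Real.sqrt t)) -
      (((T ^ (p + 1) - 1) / (p + 1) : ℝ) : ℂ) * ∑ i ∈ s, (if Δ i = 0 then c i else 0)‖ ≤
      T ^ (p + 1 / 2) * ∑ i ∈ s, ‖c i‖ / |Δ i| := by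
  have e : ∫ t in (1 : ℝ)..T, ((t ^ p : ℝ) : ℂ) * ∑ i ∈ s, c i * cis (Δ i * Real.sqrt t) =
      ∑ i ∈ s, c i * ∫ t in (1 : ℝ)..T, ((t ^ p : ℝ) : ℂ) * cis (Δ i * Real.sqrt t) := by
    simp_rw [← intervalIntegral.integral_const_mul]
    rw [← intervalIntegral.integral_finsetSum]
    · apply intervalIntegral.integral_congr
      intro t _
      dsimp only
      rw [Finset.mul_sum]
      exact Finset.sum_congr rfl fun i _ => by ring
    · intro i _
      exact ((continuous_rpow_mul_cis (by linarith) (Δ i)).const_mul (c i)).intervalIntegrable _ _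
  rw [e, Finset.mul_sum, ← Finset.sum_sub_distrib, Finset.mul_sum]
  refine norm_sum_le_of_le _ fun i _ => ?_
  have h := norm_integral_rpow_mul_cis_sub_le hp hT (Δ i)
  calc _ = ‖c i * ((∫ t in (1 : ℝ)..T, ((t ^ p : ℝ) : ℂ) * cis (Δ i * Real.sqrt t)) -
      (((T ^ (p + 1) - 1) / (p + 1) : ℝ) : ℂ) * (if Δ i = 0 then 1 else 0))‖ := by
        congr 1
        split_ifs <;> ring
    _ ≤ ‖c i‖ * (T ^ (p + 1 / 2) / |Δ i|) := by rw [norm_mul]; gcongr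
    _ = _ := by ring

/-- The exponential sum with coefficients `A` and frequencies `√n`. -/
noncomputable def rootSum (A : ℕ → ℂ) (N : ℕ) (t : ℝ) : ℂ :=
  ∑ n ∈ Finset.range N, A n * cis (Real.sqrt n * Real.sqrt t)

lemma continuous_rootSum (A : ℕ → ℂ) (N : ℕ) : Continuous (rootSum A N) := by
  unfold rootSum
  refine continuous_finsetSum _ fun n _ => continuous_const.mul (continuous_cis.comp ?_)
  fun_prop

lemma rootSum_mul_conj (A : ℕ → ℂ) (N : ℕ) (t : ℝ) :
    rootSum A N t * (starRingEnd ℂ) (rootSum A N t) =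
      ∑ x ∈ Finset.range N ×ˢ Finset.range N, (A x.1 * (starRingEnd ℂ) (A x.2)) *
        cis ((Real.sqrt x.1 - Real.sqrt x.2) * Real.sqrt t) := by
  rw [rootSum, map_sum, Finset.sum_mul_sum, Finset.sum_product]
  refine Finset.sum_congr rfl fun a _ => Finset.sum_congr rfl fun b _ => ?_
  rw [map_mul, ← cis_neg, sub_mul, sub_eq_add_neg, cis_add]
  ring

lemma rootSum_sq_mul_conj (A : ℕ → ℂ) (N : ℕ) (t : ℝ) :
    rootSum A N t * (rootSum A N t * (starRingEnd ℂ) (rootSum A N t)) =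
      ∑ x ∈ Finset.range N ×ˢ Finset.range N ×ˢ Finset.range N,
        (A x.1 * A x.2.1 * (starRingEnd ℂ) (A x.2.2)) *
        cis ((Real.sqrt x.1 + Real.sqrt x.2.1 - Real.sqrt x.2.2) * Real.sqrt t) := by
  rw [rootSum_mul_conj, rootSum, Finset.sum_mul_sum, Finset.sum_product]
  refine Finset.sum_congr rfl fun a _ => Finset.sum_congr rfl fun b _ => ?_
  rw [add_sub_assoc, add_mul, cis_add]
  ring

lemma rootSum_cube (A : ℕ → ℂ) (N : ℕ) (t : ℝ) :
    rootSum A N t * (rootSum A N t * rootSum A N t) =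
      ∑ x ∈ Finset.range N ×ˢ Finset.range N ×ˢ Finset.range N,
        (A x.1 * A x.2.1 * A x.2.2) *
        cis ((Real.sqrt x.1 + Real.sqrt x.2.1 + Real.sqrt x.2.2) * Real.sqrt t) := by
  rw [rootSum, Finset.sum_mul_sum, Finset.sum_mul_sum, Finset.sum_product]
  refine Finset.sum_congr rfl fun a _ => ?_
  rw [Finset.sum_product]
  refine Finset.sum_congr rfl fun b _ => ?_
  rw [Finset.mul_sum]
  refine Finset.sum_congr rfl fun n _ => ?_
  rw [add_mul, add_mul, cis_add, cis_add]
  ring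

/-- Two decay bounds for a coefficient sequence, the second one with an extra factor `D`. -/
structure CoeffBound (A : ℕ → ℂ) (B D : ℝ) : Prop where
  nonneg_left : 0 ≤ B
  nonneg_right : 0 ≤ D
  slow : ∀ n : ℕ, ‖A n‖ ≤ B * (n : ℝ) ^ (-(7 / 10) : ℝ)
  fast : ∀ n : ℕ, ‖A n‖ ≤ B * D * (n : ℝ) ^ (-(11 / 10) : ℝ)

lemma CoeffBound.zero {A : ℕ → ℂ} {B D : ℝ} (h : CoeffBound A B D) : A 0 = 0 := by
  have := h.slow 0
  rw [Nat.cast_zero, Real.zero_rpow (by norm_num), mul_zero] at this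
  exact norm_le_zero_iff.1 this

lemma CoeffBound.norm_mul_div_le {A : ℕ → ℂ} {B D : ℝ} (h : CoeffBound A B D) {a b : ℕ}
    (hab : a < b) : ‖A a‖ * ‖A b‖ / |Real.sqrt a - Real.sqrt b| ≤
      18 * (B ^ 2 * D) * ((a : ℝ) ^ (-(11 / 10) : ℝ) * distWeight a b) := by
  have hB := h.nonneg_left
  have hD := h.nonneg_right
  rcases Nat.eq_zero_or_pos a with rfl | ha
  · have := distWeight_nonneg 0 b
    rw [h.zero, norm_zero, zero_mul, zero_div]
    positivity
  have h1 := rpow_div_abs_sqrt_sub_le ha hab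
  calc _ ≤ (B * D * (a : ℝ) ^ (-(11 / 10) : ℝ)) * (B * (b : ℝ) ^ (-(7 / 10) : ℝ)) /
        |Real.sqrt a - Real.sqrt b| := by
        gcongr
        · exact h.fast a
        · exact h.slow b
    _ = B ^ 2 * D * (a : ℝ) ^ (-(11 / 10) : ℝ) *
        ((b : ℝ) ^ (-(7 / 10) : ℝ) / |Real.sqrt a - Real.sqrt b|) := by ring
    _ ≤ B ^ 2 * D * (a : ℝ) ^ (-(11 / 10) : ℝ) * (18 * distWeight a b) := by gcongr
    _ = _ := by ring

theorem exists_second_moment_le : ∃ C : ℝ, 0 ≤ C ∧ ∀ (A : ℕ → ℂ) (B D : ℝ), CoeffBound A B D →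
    ∀ (N : ℕ) (T : ℝ), 1 ≤ T → ∫ t in (1 : ℝ)..T, t ^ (3 / 2 : ℝ) * ‖rootSum A N t‖ ^ 2 ≤
      C * B ^ 2 * (T ^ (5 / 2 : ℝ) + D * T ^ (2 : ℝ)) := by
  obtain ⟨S, hS0, hS⟩ := exists_sum_pair_le
  have hz := tsum_natCast_rpow_nonneg (-(7 / 5))
  refine ⟨(∑' n : ℕ, (n : ℝ) ^ (-(7 / 5) : ℝ)) + 18 * S, by positivity, fun A B D h N T hT => ?_⟩
  have hB := h.nonneg_left
  have hD := h.nonneg_right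
  have hmain := norm_integral_rpow_mul_sum_sub_le (Finset.range N ×ˢ Finset.range N)
    (fun x => A x.1 * (starRingEnd ℂ) (A x.2)) (fun x => Real.sqrt x.1 - Real.sqrt x.2)
    (show (1 / 2 : ℝ) ≤ 3 / 2 by norm_num) hT
  simp_rw [← rootSum_mul_conj, Complex.mul_conj', norm_mul, RCLike.norm_conj] at hmain
  have e : ∫ t in (1 : ℝ)..T, ((t ^ (3 / 2 : ℝ) : ℝ) : ℂ) * (‖rootSum A N t‖ : ℂ) ^ 2 =
      ((∫ t in (1 : ℝ)..T, t ^ (3 / 2 : ℝ) * ‖rootSum A N t‖ ^ 2 : ℝ) : ℂ) := by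
    rw [← intervalIntegral.integral_ofReal]
    push_cast
    rfl
  rw [e] at hmain
  have hdiag : ‖∑ x ∈ Finset.range N ×ˢ Finset.range N,
      (if Real.sqrt x.1 - Real.sqrt x.2 = 0 then A x.1 * (starRingEnd ℂ) (A x.2) else 0)‖ ≤
      B ^ 2 * ∑' n : ℕ, (n : ℝ) ^ (-(7 / 5) : ℝ) := by
    rw [Finset.sum_product]
    calc _ ≤ ∑ a ∈ Finset.range N, B ^ 2 * (a : ℝ) ^ (-(7 / 5) : ℝ) := by
          refine norm_sum_le_of_le _ fun a ha => ?_
          have hcond : ∀ b : ℕ, Real.sqrt a - Real.sqrt b = 0 ↔ a = b := by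
            intro b
            rw [sub_eq_zero, Real.sqrt_inj (by positivity) (by positivity), Nat.cast_inj]
          simp only [hcond]
          rw [Finset.sum_ite_eq, if_pos ha, norm_mul, RCLike.norm_conj]
          have h1 := h.slow a
          rcases Nat.eq_zero_or_pos a with rfl | ha0
          · rw [h.zero, norm_zero, zero_mul]; positivity
          have ha0' : (0 : ℝ) < a := by exact_mod_cast ha0
          calc _ ≤ (B * (a : ℝ) ^ (-(7 / 10) : ℝ)) * (B * (a : ℝ) ^ (-(7 / 10) : ℝ)) := by gcongr
            _ = B ^ 2 * ((a : ℝ) ^ (-(7 / 10) : ℝ) * (a : ℝ) ^ (-(7 / 10) : ℝ)) := by ring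
            _ = _ := by rw [← Real.rpow_add ha0']; norm_num
      _ ≤ _ := by
          rw [← Finset.mul_sum]
          gcongr
          exact sum_range_rpow_le (by norm_num) N
  have hoff : ∑ x ∈ Finset.range N ×ˢ Finset.range N,
      ‖A x.1‖ * ‖A x.2‖ / |Real.sqrt x.1 - Real.sqrt x.2| ≤ 18 * (B ^ 2 * D) * S := by
    rw [Finset.sum_product]
    calc _ ≤ ∑ a ∈ Finset.range N, ∑ b ∈ Finset.range N, 18 * (B ^ 2 * D) *
          (((a : ℝ) ^ (-(11 / 10) : ℝ) + (b : ℝ) ^ (-(11 / 10) : ℝ)) * distWeight a b) := by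
          refine Finset.sum_le_sum fun a _ => Finset.sum_le_sum fun b _ => ?_
          have hd := distWeight_nonneg a b
          have ha' := natCast_rpow_nonneg a (-(11 / 10))
          have hb' := natCast_rpow_nonneg b (-(11 / 10))
          rcases lt_trichotomy a b with hab | rfl | hab
          · refine (h.norm_mul_div_le hab).trans ?_
            gcongr
            linarith
          · rw [sub_self, abs_zero, div_zero]; positivity
          · have h2 := h.norm_mul_div_le hab
            rw [mul_comm, abs_sub_comm, distWeight_comm] at h2
            refine h2.trans ?_
            gcongr
            linarith
      _ ≤ _ := by
          simp_rw [← Finset.mul_sum]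
          gcongr
          exact hS N
  have hT1 : T ^ ((3 / 2 : ℝ) + 1) = T ^ (5 / 2 : ℝ) := by norm_num
  have hT2 : T ^ ((3 / 2 : ℝ) + 1 / 2) = T ^ (2 : ℝ) := by norm_num
  rw [hT1, hT2] at hmain
  have hT5 : 1 ≤ T ^ (5 / 2 : ℝ) := Real.one_le_rpow hT (by norm_num)
  have hcoef : ‖(((T ^ (5 / 2 : ℝ) - 1) / (3 / 2 + 1) : ℝ) : ℂ)‖ ≤ T ^ (5 / 2 : ℝ) := by
    rw [Complex.norm_real, Real.norm_eq_abs, abs_of_nonneg (div_nonneg (by linarith) (by norm_num)),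
      div_le_iff₀ (by norm_num)]
    linarith
  have h3 := norm_le_norm_add_norm_sub' (((∫ t in (1 : ℝ)..T, t ^ (3 / 2 : ℝ) *
    ‖rootSum A N t‖ ^ 2 : ℝ) : ℂ)) ((((T ^ (5 / 2 : ℝ) - 1) / (3 / 2 + 1) : ℝ) : ℂ) *
    ∑ x ∈ Finset.range N ×ˢ Finset.range N,
      (if Real.sqrt x.1 - Real.sqrt x.2 = 0 then A x.1 * (starRingEnd ℂ) (A x.2) else 0))
  have h4 : ‖(((T ^ (5 / 2 : ℝ) - 1) / (3 / 2 + 1) : ℝ) : ℂ) *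
    ∑ x ∈ Finset.range N ×ˢ Finset.range N,
      (if Real.sqrt x.1 - Real.sqrt x.2 = 0 then A x.1 * (starRingEnd ℂ) (A x.2) else 0)‖ ≤
      T ^ (5 / 2 : ℝ) * (B ^ 2 * ∑' n : ℕ, (n : ℝ) ^ (-(7 / 5) : ℝ)) := by
    rw [norm_mul]; gcongr
  have h5 : T ^ (2 : ℝ) * ∑ x ∈ Finset.range N ×ˢ Finset.range N,
      ‖A x.1‖ * ‖A x.2‖ / |Real.sqrt x.1 - Real.sqrt x.2| ≤
        T ^ (2 : ℝ) * (18 * (B ^ 2 * D) * S) := by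
    gcongr
  rw [Complex.norm_real] at h3
  have h6 := le_trans (Real.le_norm_self _) h3
  have h7 := h6.trans (add_le_add h4 (hmain.trans h5))
  refine h7.trans ?_
  have h8 : 0 ≤ S * B ^ 2 * T ^ (5 / 2 : ℝ) := by positivity
  have h9 : 0 ≤ (∑' n : ℕ, (n : ℝ) ^ (-(7 / 5) : ℝ)) * B ^ 2 * (D * T ^ (2 : ℝ)) := by positivity
  linarith

/-- The resonant terms `√a + √b = √n` of the third moment. -/
noncomputable def resonance (A : ℕ → ℂ) (x : ℕ × ℕ × ℕ) : ℂ :=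
  if Real.sqrt x.1 + Real.sqrt x.2.1 = Real.sqrt x.2.2 then
    A x.1 * A x.2.1 * (starRingEnd ℂ) (A x.2.2) else 0

lemma CoeffBound.norm_triple_le {A : ℕ → ℂ} {B D : ℝ} (h : CoeffBound A B D) (a b n : ℕ) (Δ : ℝ) :
    ‖A a‖ * ‖A b‖ * ‖A n‖ / |Δ| ≤ B ^ 3 * D ^ 2 * ((a : ℝ) ^ (-(11 / 10) : ℝ) *
      (b : ℝ) ^ (-(11 / 10) : ℝ) * ((n : ℝ) ^ (-(7 / 10) : ℝ) / |Δ|)) := by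
  have hB := h.nonneg_left
  have hD := h.nonneg_right
  calc _ ≤ (B * D * (a : ℝ) ^ (-(11 / 10) : ℝ)) * (B * D * (b : ℝ) ^ (-(11 / 10) : ℝ)) *
        (B * (n : ℝ) ^ (-(7 / 10) : ℝ)) / |Δ| := by
        gcongr
        · exact h.fast a
        · exact h.fast b
        · exact h.slow n
    _ = _ := by ring

lemma re_cube (z : ℂ) : z.re ^ 3 =
    (1 / 4 : ℝ) * (z * (z * z)).re + (3 / 4 : ℝ) * (z * (z * (starRingEnd ℂ) z)).re := by
  simp only [Complex.mul_re, Complex.mul_im, Complex.conj_re, Complex.conj_im]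
  ring

lemma integral_rpow_mul_re {T p : ℝ} {f : ℝ → ℂ} (hp : 0 ≤ p) (hf : Continuous f) :
    ∫ t in (1 : ℝ)..T, t ^ p * (f t).re = (∫ t in (1 : ℝ)..T, ((t ^ p : ℝ) : ℂ) * f t).re := by
  have hc : Continuous fun t : ℝ => ((t ^ p : ℝ) : ℂ) * f t :=
    (Complex.continuous_ofReal.comp (Real.continuous_rpow_const hp)).mul hf
  have := Complex.reCLM.intervalIntegral_comp_comm (hc.intervalIntegrable (μ := volume) 1 T)
  simpa using this

theorem exists_third_moment_sub_le : ∃ C : ℝ, 0 ≤ C ∧ ∀ (A : ℕ → ℂ) (B D : ℝ), CoeffBound A B D →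
    ∀ (N : ℕ) (T : ℝ), 1 ≤ T → |(∫ t in (1 : ℝ)..T, t ^ (9 / 4 : ℝ) * (rootSum A N t).re ^ 3) -
      3 / 13 * (T ^ (13 / 4 : ℝ) - 1) *
        (∑ x ∈ Finset.range N ×ˢ Finset.range N ×ˢ Finset.range N, resonance A x).re| ≤
      C * (B ^ 3 * D ^ 2) * T ^ (11 / 4 : ℝ) := by
  obtain ⟨S, hS0, hS⟩ := exists_sum_triple_sub_le
  obtain ⟨R, hR0, hR⟩ := exists_sum_triple_add_le
  refine ⟨S + R, by positivity, fun A B D h N T hT => ?_⟩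
  have hB := h.nonneg_left
  have hD := h.nonneg_right
  have hT1 : T ^ ((9 / 4 : ℝ) + 1) = T ^ (13 / 4 : ℝ) := by norm_num
  have hT2 : T ^ ((9 / 4 : ℝ) + 1 / 2) = T ^ (11 / 4 : ℝ) := by norm_num
  have h1 := norm_integral_rpow_mul_sum_sub_le (Finset.range N ×ˢ Finset.range N ×ˢ Finset.range N)
    (fun x => A x.1 * A x.2.1 * (starRingEnd ℂ) (A x.2.2))
    (fun x => Real.sqrt x.1 + Real.sqrt x.2.1 - Real.sqrt x.2.2)
    (show (1 / 2 : ℝ) ≤ 9 / 4 by norm_num) hT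
  have h2 := norm_integral_rpow_mul_sum_sub_le (Finset.range N ×ˢ Finset.range N ×ˢ Finset.range N)
    (fun x => A x.1 * A x.2.1 * A x.2.2)
    (fun x => Real.sqrt x.1 + Real.sqrt x.2.1 + Real.sqrt x.2.2)
    (show (1 / 2 : ℝ) ≤ 9 / 4 by norm_num) hT
  have hres : ∑ x ∈ Finset.range N ×ˢ Finset.range N ×ˢ Finset.range N,
      (if Real.sqrt x.1 + Real.sqrt x.2.1 - Real.sqrt x.2.2 = 0 then
        A x.1 * A x.2.1 * (starRingEnd ℂ) (A x.2.2) else 0) =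
      ∑ x ∈ Finset.range N ×ˢ Finset.range N ×ˢ Finset.range N, resonance A x := by
    refine Finset.sum_congr rfl fun x _ => ?_
    rw [resonance]
    simp only [sub_eq_zero]
  have hzero : ∑ x ∈ Finset.range N ×ˢ Finset.range N ×ˢ Finset.range N,
      (if Real.sqrt x.1 + Real.sqrt x.2.1 + Real.sqrt x.2.2 = 0 then
        A x.1 * A x.2.1 * A x.2.2 else 0) = 0 := by
    refine Finset.sum_eq_zero fun x _ => ?_
    split_ifs with hx
    · have hx1 : Real.sqrt x.1 = 0 := by
        linarith [Real.sqrt_nonneg (x.1 : ℝ), Real.sqrt_nonneg (x.2.1 : ℝ),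
          Real.sqrt_nonneg (x.2.2 : ℝ)]
      have hx2 : x.1 = 0 := by
        have := (Real.sqrt_eq_zero (Nat.cast_nonneg x.1)).1 hx1
        exact_mod_cast this
      rw [hx2, h.zero, zero_mul, zero_mul]
    · rfl
  rw [hres, hT1, hT2] at h1
  rw [hzero, mul_zero, sub_zero, hT2] at h2
  simp_rw [← rootSum_sq_mul_conj, norm_mul, RCLike.norm_conj] at h1
  simp_rw [← rootSum_cube, norm_mul] at h2
  have hbound : ∀ g : ℕ → ℕ → ℕ → ℝ, ∀ K : ℝ, (∑ a ∈ Finset.range N, ∑ b ∈ Finset.range N,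
      ∑ n ∈ Finset.range N, (a : ℝ) ^ (-(11 / 10) : ℝ) * (b : ℝ) ^ (-(11 / 10) : ℝ) *
        ((n : ℝ) ^ (-(7 / 10) : ℝ) / |g a b n|) ≤ K) →
      ∑ x ∈ Finset.range N ×ˢ Finset.range N ×ˢ Finset.range N,
        ‖A x.1‖ * ‖A x.2.1‖ * ‖A x.2.2‖ / |g x.1 x.2.1 x.2.2| ≤ B ^ 3 * D ^ 2 * K := by
    intro g K hK
    refine (Finset.sum_le_sum fun x _ => h.norm_triple_le x.1 x.2.1 x.2.2 _).trans ?_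
    rw [← Finset.mul_sum, Finset.sum_product]
    simp_rw [Finset.sum_product]
    gcongr
  have h3 := hbound (fun a b n => Real.sqrt a + Real.sqrt b - Real.sqrt n) S (hS N)
  have h4 := hbound (fun a b n => Real.sqrt a + Real.sqrt b + Real.sqrt n) R (hR N)
  have hT0 : 0 ≤ T ^ (11 / 4 : ℝ) := by positivity
  have h5 := h1.trans (mul_le_mul_of_nonneg_left h3 hT0)
  have h6 := h2.trans (mul_le_mul_of_nonneg_left h4 hT0)
  have hc := continuous_rootSum A N
  have hc1 : Continuous fun t => rootSum A N t * (rootSum A N t * rootSum A N t) := by fun_prop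
  have hc2 : Continuous fun t =>
      rootSum A N t * (rootSum A N t * (starRingEnd ℂ) (rootSum A N t)) :=
    hc.mul (hc.mul (Complex.continuous_conj.comp hc))
  have hp : (0 : ℝ) ≤ 9 / 4 := by norm_num
  have hpc : Continuous fun t : ℝ => t ^ (9 / 4 : ℝ) := Real.continuous_rpow_const hp
  have e : ∫ t in (1 : ℝ)..T, t ^ (9 / 4 : ℝ) * (rootSum A N t).re ^ 3 =
      1 / 4 * (∫ t in (1 : ℝ)..T, ((t ^ (9 / 4 : ℝ) : ℝ) : ℂ) *
        (rootSum A N t * (rootSum A N t * rootSum A N t))).re +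
      3 / 4 * (∫ t in (1 : ℝ)..T, ((t ^ (9 / 4 : ℝ) : ℝ) : ℂ) *
        (rootSum A N t * (rootSum A N t * (starRingEnd ℂ) (rootSum A N t)))).re := by
    rw [← integral_rpow_mul_re hp hc1, ← integral_rpow_mul_re hp hc2,
      ← intervalIntegral.integral_const_mul, ← intervalIntegral.integral_const_mul,
      ← intervalIntegral.integral_add]
    · apply intervalIntegral.integral_congr
      intro t _
      dsimp only
      rw [re_cube]
      ring
    · exact (continuous_const.mul (hpc.mul (Complex.continuous_re.comp hc1))).intervalIntegrable _ _
    · exact (continuous_const.mul (hpc.mul (Complex.continuous_re.comp hc2))).intervalIntegrable _ _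
  rw [e]
  have h7 := (Complex.abs_re_le_norm _).trans h5
  have h8 := (Complex.abs_re_le_norm _).trans h6
  rw [Complex.sub_re, Complex.re_ofReal_mul,
    show (T ^ (13 / 4 : ℝ) - 1) / (9 / 4 + 1) = 4 / 13 * (T ^ (13 / 4 : ℝ) - 1) by ring] at h7
  rw [abs_le] at h7 h8 ⊢
  have h9 : 0 ≤ T ^ (11 / 4 : ℝ) * (B ^ 3 * D ^ 2 * R) := by positivity
  have h10 : 0 ≤ T ^ (11 / 4 : ℝ) * (B ^ 3 * D ^ 2 * S) := by positivity
  constructor <;> linarith [h7.1, h7.2, h8.1, h8.2]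

lemma norm_resonance_le {A : ℕ → ℂ} {B : ℝ} (hB : 0 ≤ B)
    (hA : ∀ n : ℕ, ‖A n‖ ≤ B * (n : ℝ) ^ (-(2 / 5) : ℝ)) (x : ℕ × ℕ × ℕ) :
    ‖resonance A x‖ ≤ B ^ 3 * diagWeight x := by
  rw [resonance, diagWeight]
  split_ifs
  · rw [norm_mul, norm_mul, RCLike.norm_conj]
    calc _ ≤ (B * (x.1 : ℝ) ^ (-(2 / 5) : ℝ)) * (B * (x.2.1 : ℝ) ^ (-(2 / 5) : ℝ)) *
          (B * (x.2.2 : ℝ) ^ (-(2 / 5) : ℝ)) := by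
          gcongr
          · exact hA _
          · exact hA _
          · exact hA _
      _ = _ := by ring
  · simp

lemma norm_resonance_sub_le {A A' : ℕ → ℂ} {B lam : ℝ} (hB : 0 ≤ B) (hlam : 0 ≤ lam)
    (hA : ∀ n : ℕ, ‖A n‖ ≤ B * (n : ℝ) ^ (-(2 / 5) : ℝ))
    (hA' : ∀ n : ℕ, ‖A' n‖ ≤ B * (n : ℝ) ^ (-(2 / 5) : ℝ))
    (hd : ∀ n : ℕ, ‖A n - A' n‖ ≤ B * lam * (n : ℝ) ^ (-(2 / 5) : ℝ)) (x : ℕ × ℕ × ℕ) :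
    ‖resonance A x - resonance A' x‖ ≤ 3 * B ^ 3 * lam * diagWeight x := by
  rw [resonance, resonance, diagWeight]
  split_ifs
  · have e : A x.1 * A x.2.1 * (starRingEnd ℂ) (A x.2.2) -
        A' x.1 * A' x.2.1 * (starRingEnd ℂ) (A' x.2.2) =
        (A x.1 - A' x.1) * A x.2.1 * (starRingEnd ℂ) (A x.2.2) +
        A' x.1 * (A x.2.1 - A' x.2.1) * (starRingEnd ℂ) (A x.2.2) +
        A' x.1 * A' x.2.1 * (starRingEnd ℂ) (A x.2.2 - A' x.2.2) := by
      rw [map_sub]; ring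
    rw [e]
    refine (norm_add₃_le).trans ?_
    simp only [norm_mul, RCLike.norm_conj]
    calc _ ≤ (B * lam * (x.1 : ℝ) ^ (-(2 / 5) : ℝ)) * (B * (x.2.1 : ℝ) ^ (-(2 / 5) : ℝ)) *
          (B * (x.2.2 : ℝ) ^ (-(2 / 5) : ℝ)) +
          (B * (x.1 : ℝ) ^ (-(2 / 5) : ℝ)) * (B * lam * (x.2.1 : ℝ) ^ (-(2 / 5) : ℝ)) *
          (B * (x.2.2 : ℝ) ^ (-(2 / 5) : ℝ)) +
          (B * (x.1 : ℝ) ^ (-(2 / 5) : ℝ)) * (B * (x.2.1 : ℝ) ^ (-(2 / 5) : ℝ)) *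
          (B * lam * (x.2.2 : ℝ) ^ (-(2 / 5) : ℝ)) := by
          gcongr
          · exact hd _
          · exact hA _
          · exact hA _
          · exact hA' _
          · exact hd _
          · exact hA _
          · exact hA' _
          · exact hA' _
          · exact hd _
      _ = _ := by ring
  · simp

lemma summable_resonance {A : ℕ → ℂ} {B : ℝ} (hB : 0 ≤ B)
    (hA : ∀ n : ℕ, ‖A n‖ ≤ B * (n : ℝ) ^ (-(2 / 5) : ℝ)) : Summable (resonance A) :=
  Summable.of_norm_bounded (summable_diagWeight.mul_left _) (norm_resonance_le hB hA)

lemma norm_sum_resonance_sub_tsum_le {A A' : ℕ → ℂ} {B lam : ℝ} (hB : 0 ≤ B) (hlam : 0 ≤ lam)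
    (hA : ∀ n : ℕ, ‖A n‖ ≤ B * (n : ℝ) ^ (-(2 / 5) : ℝ))
    (hA' : ∀ n : ℕ, ‖A' n‖ ≤ B * (n : ℝ) ^ (-(2 / 5) : ℝ))
    (hd : ∀ n : ℕ, ‖A n - A' n‖ ≤ B * lam * (n : ℝ) ^ (-(2 / 5) : ℝ)) {N : ℕ}
    (hN : ∀ n, N ≤ n → A n = 0) :
    ‖(∑ x ∈ Finset.range N ×ˢ Finset.range N ×ˢ Finset.range N, resonance A x) -
      ∑' x, resonance A' x‖ ≤ 3 * B ^ 3 * lam * ∑' x, diagWeight x := by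
  have e : ∑ x ∈ Finset.range N ×ˢ Finset.range N ×ˢ Finset.range N, resonance A x =
      ∑' x, resonance A x := by
    refine (tsum_eq_sum fun x hx => ?_).symm
    rw [resonance]
    split_ifs
    · simp only [Finset.mem_product, Finset.mem_range, not_and_or, not_lt] at hx
      rcases hx with h | h | h <;> rw [hN _ h] <;> simp
    · rfl
  rw [e, ← (summable_resonance hB hA).tsum_sub (summable_resonance hB hA'), ← tsum_mul_left]
  exact tsum_of_norm_bounded (summable_diagWeight.mul_left _).hasSum
    (norm_resonance_sub_le hB hlam hA hA' hd)

lemma pairCoeff_smoothWeight_eq_zero (σ : ℝ) {H M n : ℕ} (hn : H * (H + 2 * M) < n) :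
    pairCoeff (smoothWeight σ H M) n = 0 := by
  rw [pairCoeff]
  refine Finset.sum_eq_zero fun h hh => ?_
  split_ifs with hc
  · rw [smoothWeight, if_neg, zero_mul]
    rintro ⟨h1, h2⟩
    obtain ⟨hc1, c, hc2⟩ := hc
    have h3 : h * (n / h) = n := Nat.mul_div_cancel' (Nat.dvd_of_mem_divisors hh)
    have h4 : n / h ≤ H + 2 * M := by omega
    have h5 := Nat.mul_le_mul h1 h4
    omega
  · rfl

lemma endWeight_pos (m : ℕ) : 0 < endWeight m := by
  unfold endWeight; split_ifs <;> norm_num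

/-- The absolute value of `limCoeff`. -/
noncomputable def limAbs (n : ℕ) : ℝ :=
  ∑ h ∈ n.divisors, if h ≤ n / h ∧ Even (n / h - h) then
    endWeight ((n / h - h) / 2) * (2 / π * ((h : ℝ) ^ (-(1 / 4) : ℝ) *
      ((n / h : ℕ) : ℝ) ^ (-(5 / 4) : ℝ))) else 0

lemma limAbs_nonneg (n : ℕ) : 0 ≤ limAbs n := by
  refine Finset.sum_nonneg fun h _ => ?_
  have := endWeight_pos ((n / h - h) / 2)
  split_ifs <;> positivity

lemma limAbs_sq_pos {k : ℕ} (hk : 1 ≤ k) : 0 < limAbs (k * k) := by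
  have hk0 : (0 : ℝ) < k := by exact_mod_cast hk
  refine Finset.sum_pos' (fun h _ => ?_) ⟨k, ?_, ?_⟩
  · have := endWeight_pos ((k * k / h - h) / 2)
    split_ifs <;> positivity
  · rw [Nat.mem_divisors]
    exact ⟨dvd_mul_right k k, by positivity⟩
  · rw [Nat.mul_div_cancel _ hk, if_pos ⟨le_rfl, by simp⟩]
    have := endWeight_pos ((k - k) / 2)
    positivity

lemma limCoeff_eq (n : ℕ) : limCoeff n = (((-1) ^ n * limAbs n : ℝ) : ℂ) * cis (-(1 / 8)) := by
  rw [limCoeff, pairCoeff, limAbs, Finset.mul_sum, Complex.ofReal_sum, Finset.sum_mul]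
  refine Finset.sum_congr rfl fun h hh => ?_
  split_ifs with hc
  · obtain ⟨hc1, c, hc2⟩ := hc
    have h3 : h * (n / h) = n := Nat.mul_div_cancel' (Nat.dvd_of_mem_divisors hh)
    have h4 : h + 2 * ((n / h - h) / 2) = n / h := by omega
    rw [ampl, h4, one_mul]
    have h5 : (-1 : ℝ) ^ h = (-1) ^ n := by
      rw [neg_one_pow_congr]
      have : n / h = h + (c + c) := by omega
      rw [← h3, this]
      rw [Nat.even_mul, Nat.even_add]
      simp
    rw [h5]
  · simp

lemma resonance_limCoeff_re (x : ℕ × ℕ × ℕ) : (resonance limCoeff x).re =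
    if Real.sqrt x.1 + Real.sqrt x.2.1 = Real.sqrt x.2.2 then
      limAbs x.1 * limAbs x.2.1 * limAbs x.2.2 * Real.cos (π / 4) else 0 := by
  rw [resonance]
  split_ifs with h
  · obtain ⟨h1, h2⟩ := eq_of_sqrt_add_sqrt_eq h
    have hev : Even (Nat.sqrt (4 * (x.1 * x.2.1))) := by
      have : Even (Nat.sqrt (4 * (x.1 * x.2.1)) ^ 2) := by
        rw [h2]; exact (by decide : Even 4).mul_right _
      exact (Nat.even_pow.1 this).1
    have hsign : (-1 : ℝ) ^ x.1 * (-1) ^ x.2.1 * (-1) ^ x.2.2 = 1 := by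
      rw [← pow_add, ← pow_add, h1]
      apply Even.neg_one_pow
      obtain ⟨c, hc⟩ := hev
      exact ⟨x.1 + x.2.1 + c, by omega⟩
    have hcis : cis (-(1 / 8)) * cis (-(1 / 8)) * (starRingEnd ℂ) (cis (-(1 / 8))) =
      cis (-(1 / 8)) := by
      rw [← cis_neg, ← cis_add, ← cis_add]
      norm_num
    rw [limCoeff_eq, limCoeff_eq, limCoeff_eq, map_mul, Complex.conj_ofReal]
    have e : ∀ (u v w : ℝ), (u : ℂ) * cis (-(1 / 8)) * (v * cis (-(1 / 8))) *
        (w * (starRingEnd ℂ) (cis (-(1 / 8)))) = ((u * v * w : ℝ) : ℂ) * cis (-(1 / 8)) := by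
      intro u v w
      rw [← hcis]
      push_cast
      rw [hcis]
      linear_combination (u * v * w : ℂ) * hcis
    rw [e, Complex.re_ofReal_mul, cis_re,
      show 2 * π * (-(1 / 8)) = -(π / 4) by ring, Real.cos_neg]
    calc _ = ((-1 : ℝ) ^ x.1 * (-1) ^ x.2.1 * (-1) ^ x.2.2) *
        (limAbs x.1 * limAbs x.2.1 * limAbs x.2.2 * Real.cos (π / 4)) := by ring
      _ = _ := by rw [hsign, one_mul]
  · rfl

lemma tsum_resonance_limCoeff_re_pos (hs : Summable (resonance limCoeff)) :
    0 < (∑' x, resonance limCoeff x).re := by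
  rw [Complex.re_tsum hs]
  have hcos : 0 < Real.cos (π / 4) := by
    rw [Real.cos_pi_div_four]; positivity
  have hs' : Summable fun x => (resonance limCoeff x).re := (Complex.hasSum_re hs.hasSum).summable
  refine hs'.tsum_pos (fun x => ?_) (1, 1, 4) ?_
  · rw [resonance_limCoeff_re]
    have h1 := limAbs_nonneg x.1
    have h2 := limAbs_nonneg x.2.1
    have h3 := limAbs_nonneg x.2.2
    split_ifs <;> positivity
  · have h4 : Real.sqrt ((4 : ℕ) : ℝ) = 2 := by
      rw [show ((4 : ℕ) : ℝ) = 2 ^ 2 by norm_num]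
      exact Real.sqrt_sq (by norm_num)
    rw [resonance_limCoeff_re, if_pos (by dsimp only; rw [h4]; norm_num)]
    have h1 := limAbs_sq_pos (k := 1) le_rfl
    have h2 := limAbs_sq_pos (k := 2) (by norm_num)
    norm_num at h1 h2
    dsimp only
    positivity

/-- Length of the sum over `m` used up to height `T`. -/
noncomputable def cutoff (T : ℝ) : ℕ := (28 * ⌈T⌉₊ * ⌈T⌉₊) ^ 2

lemma natCeil_le_two_mul {T : ℝ} (hT : 1 ≤ T) : (⌈T⌉₊ : ℝ) ≤ 2 * T := by
  have := Nat.ceil_lt_add_one (show 0 ≤ T by linarith)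
  linarith

lemma le_sqrt_cutoff {t T : ℝ} (ht : t ≤ T) : 28 * (⌈T⌉₊ : ℝ) * t ≤ Real.sqrt (cutoff T) := by
  rw [cutoff, Nat.cast_pow, Real.sqrt_sq (by positivity)]
  push_cast
  gcongr
  exact ht.trans (Nat.le_ceil T)

lemma pow_four_le_cutoff {T : ℝ} (hT : 1 ≤ T) : T ^ (4 : ℝ) ≤ cutoff T := by
  have h := Nat.le_ceil T
  have h2 : T ^ (4 : ℝ) = (T * T) ^ 2 := by
    rw [show (4 : ℝ) = (4 : ℕ) by norm_num, Real.rpow_natCast]; ring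
  rw [h2, cutoff]
  push_cast
  have h3 : T * T ≤ (⌈T⌉₊ : ℝ) * ⌈T⌉₊ := by gcongr
  gcongr
  nlinarith

lemma cutoff_le {T : ℝ} (hT : 1 ≤ T) : (cutoff T : ℝ) ≤ 12544 * T ^ (4 : ℝ) := by
  have h := natCeil_le_two_mul hT
  have h2 : T ^ (4 : ℝ) = T ^ 4 := by
    rw [show (4 : ℝ) = (4 : ℕ) by norm_num, Real.rpow_natCast]
  rw [h2, cutoff]
  push_cast
  calc _ ≤ (28 * (2 * T) * (2 * T)) ^ 2 := by gcongr
    _ = _ := by ring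

lemma one_add_log_le {x T ε C k : ℝ} (hx : 1 ≤ x) (hT : 1 ≤ T) (hε : 0 < ε) (hε1 : ε ≤ 1)
    (hC : 1 ≤ C)
    (hk : 0 ≤ k) (hxT : x ≤ C * T ^ k) : 1 + Real.log x ≤ (1 + C / ε) * T ^ (k * ε) := by
  have hT0 : 0 < T := by linarith
  have h1 : x ^ ε ≤ C * T ^ (k * ε) := by
    calc x ^ ε ≤ (C * T ^ k) ^ ε := by gcongr
      _ = C ^ ε * T ^ (k * ε) := by
        rw [Real.mul_rpow (by linarith) (by positivity), ← Real.rpow_mul hT0.le]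
      _ ≤ C * T ^ (k * ε) := by
        gcongr
        exact Real.rpow_le_self_of_one_le hC hε1
  have h2 := Real.log_le_rpow_div (by linarith : 0 ≤ x) hε
  have h4 : x ^ ε / ε ≤ C * T ^ (k * ε) / ε := by gcongr
  have h5 := Real.one_le_rpow hT (mul_nonneg hk hε.le)
  calc _ ≤ T ^ (k * ε) + C * T ^ (k * ε) / ε := by linarith
    _ = _ := by ring

lemma exists_truncation_error_le : ∃ K : ℝ, 0 ≤ K ∧ ∀ T : ℝ, 2 ≤ T → ∀ t ∈ Set.Icc 1 T,
    2 * Real.sqrt t + 2 * t * T ^ (-(2 / 7) : ℝ) + 2 * t / (T ^ (-(2 / 7) : ℝ) * ⌈T⌉₊) +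
      19 * Real.sqrt t * (1 + Real.log (cutoff T)) * (1 + Real.log ⌈T⌉₊) ≤ K * T ^ (5 / 7 : ℝ) := by
  refine ⟨6 + 19 * (1 + 12544 / (3 / 112)) * (1 + 2 / (3 / 28)), by norm_num, fun T hT t ht => ?_⟩
  have hT1 : 1 ≤ T := by linarith
  have hT0 : 0 < T := by linarith
  have ht0 : 0 < t := by linarith [ht.1]
  have hs : Real.sqrt t ≤ T ^ (1 / 2 : ℝ) := by
    rw [← Real.sqrt_eq_rpow]; exact Real.sqrt_le_sqrt ht.2
  have h1 : 2 * Real.sqrt t ≤ 2 * T ^ (5 / 7 : ℝ) := by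
    have : T ^ (1 / 2 : ℝ) ≤ T ^ (5 / 7 : ℝ) := Real.rpow_le_rpow_of_exponent_le hT1 (by norm_num)
    linarith
  have h2 : 2 * t * T ^ (-(2 / 7) : ℝ) ≤ 2 * T ^ (5 / 7 : ℝ) := by
    calc _ ≤ 2 * T * T ^ (-(2 / 7) : ℝ) := by gcongr; exact ht.2
      _ = 2 * (T ^ (1 : ℝ) * T ^ (-(2 / 7) : ℝ)) := by rw [Real.rpow_one]; ring
      _ = _ := by rw [← Real.rpow_add hT0]; norm_num
  have h3 : 2 * t / (T ^ (-(2 / 7) : ℝ) * ⌈T⌉₊) ≤ 2 * T ^ (5 / 7 : ℝ) := by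
    have : T ^ (2 / 7 : ℝ) ≤ T ^ (5 / 7 : ℝ) := Real.rpow_le_rpow_of_exponent_le hT1 (by norm_num)
    calc _ ≤ 2 * T / (T ^ (-(2 / 7) : ℝ) * T) := by
          gcongr
          · exact ht.2
          · exact Nat.le_ceil T
      _ = 2 * T ^ (2 / 7 : ℝ) := by
          rw [Real.rpow_neg hT0.le]
          field_simp
      _ ≤ _ := by linarith
  have hc1 : (1 : ℝ) ≤ cutoff T :=
    (Real.one_le_rpow hT1 (by norm_num)).trans (pow_four_le_cutoff hT1)
  have hH1 : (1 : ℝ) ≤ ⌈T⌉₊ := hT1.trans (Nat.le_ceil T)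
  have h4 := one_add_log_le (ε := 3 / 112) hc1 hT1 (by norm_num) (by norm_num) (by norm_num)
    (by norm_num) (cutoff_le hT1)
  have h5 := one_add_log_le (ε := 3 / 28) (k := 1) (C := 2) hH1 hT1 (by norm_num) (by norm_num)
    (by norm_num) (by norm_num) (by rw [Real.rpow_one]; exact natCeil_le_two_mul hT1)
  have h6 : 19 * Real.sqrt t * (1 + Real.log (cutoff T)) * (1 + Real.log ⌈T⌉₊) ≤
      19 * (1 + 12544 / (3 / 112)) * (1 + 2 / (3 / 28)) * T ^ (5 / 7 : ℝ) := by
    have hl1 := Real.log_nonneg hc1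
    have hl2 := Real.log_nonneg hH1
    calc _ ≤ 19 * T ^ (1 / 2 : ℝ) * ((1 + 12544 / (3 / 112)) * T ^ ((4 : ℝ) * (3 / 112))) *
          ((1 + 2 / (3 / 28)) * T ^ ((1 : ℝ) * (3 / 28))) := by gcongr
      _ = 19 * (1 + 12544 / (3 / 112)) * (1 + 2 / (3 / 28)) *
          (T ^ (1 / 2 : ℝ) * T ^ ((4 : ℝ) * (3 / 112)) * T ^ ((1 : ℝ) * (3 / 28))) := by ring
      _ = _ := by rw [← Real.rpow_add hT0, ← Real.rpow_add hT0]; norm_num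
  linarith

lemma trigSum_eq_rootSum (σ : ℝ) (H M : ℕ) (t : ℝ) : trigSum σ H M t =
    rootSum (pairCoeff (smoothWeight σ H M)) (H * (H + 2 * M) + 1) t := by
  rw [trigSum_eq σ le_rfl, rootSum]
  refine Finset.sum_congr rfl fun n _ => ?_
  rw [Real.sqrt_mul (Nat.cast_nonneg n)]

lemma smoothing_error_le {T : ℝ} (hT : 2 ≤ T) :
    (T ^ (-(2 / 7) : ℝ)) ^ (1 / 2 : ℝ) + (cutoff T : ℝ) ^ (-(1 / 4) : ℝ) +
      (⌈T⌉₊ : ℝ) ^ (-(1 / 2) : ℝ) ≤ 3 * T ^ (-(1 / 7) : ℝ) := by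
  have hT1 : 1 ≤ T := by linarith
  have hT0 : 0 < T := by linarith
  have h1 : (T ^ (-(2 / 7) : ℝ)) ^ (1 / 2 : ℝ) = T ^ (-(1 / 7) : ℝ) := by
    rw [← Real.rpow_mul hT0.le]; norm_num
  have h2 : (cutoff T : ℝ) ^ (-(1 / 4) : ℝ) ≤ T ^ (-(1 / 7) : ℝ) := by
    calc _ ≤ (T ^ (4 : ℝ)) ^ (-(1 / 4) : ℝ) :=
          Real.rpow_le_rpow_of_nonpos (by positivity) (pow_four_le_cutoff hT1) (by norm_num)
      _ = T ^ (-1 : ℝ) := by rw [← Real.rpow_mul hT0.le]; norm_num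
      _ ≤ _ := Real.rpow_le_rpow_of_exponent_le hT1 (by norm_num)
  have h3 : (⌈T⌉₊ : ℝ) ^ (-(1 / 2) : ℝ) ≤ T ^ (-(1 / 7) : ℝ) := by
    calc _ ≤ T ^ (-(1 / 2) : ℝ) :=
          Real.rpow_le_rpow_of_nonpos hT0 (Nat.le_ceil T) (by norm_num)
      _ ≤ _ := Real.rpow_le_rpow_of_exponent_le hT1 (by norm_num)
  linarith

/-- Moments of the smoothed sums, for the admissible smoothing parameters. -/
theorem exists_trigSum_moments : ∃ b K : ℝ, 0 < b ∧ 0 ≤ K ∧ ∀ T : ℝ, 2 ≤ T → ∀ σ : ℝ,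
    |σ| = T ^ (-(2 / 7) : ℝ) → Continuous (trigSum σ ⌈T⌉₊ (cutoff T)) ∧
    ∫ t in (1 : ℝ)..T, t ^ (3 / 2 : ℝ) * ‖trigSum σ ⌈T⌉₊ (cutoff T) t‖ ^ 2 ≤ K * T ^ (5 / 2 : ℝ) ∧
    |(∫ t in (1 : ℝ)..T, t ^ (9 / 4 : ℝ) * (trigSum σ ⌈T⌉₊ (cutoff T) t).re ^ 3) -
      b * T ^ (13 / 4 : ℝ)| ≤ K * T ^ (45 / 14 : ℝ) := by
  obtain ⟨B, hB1, hlim, hsm⟩ := exists_coeff_bounds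
  obtain ⟨C2, hC2, h2⟩ := exists_second_moment_le
  obtain ⟨C3, hC3, h3⟩ := exists_third_moment_sub_le
  have hB : 0 ≤ B := by linarith
  have hslow : ∀ n : ℕ, 1 ≤ n → (n : ℝ) ^ (-(7 / 10) : ℝ) ≤ (n : ℝ) ^ (-(2 / 5) : ℝ) := by
    intro n hn
    exact Real.rpow_le_rpow_of_exponent_le (by exact_mod_cast hn) (by norm_num)
  have hlim' : ∀ n : ℕ, ‖limCoeff n‖ ≤ B * (n : ℝ) ^ (-(2 / 5) : ℝ) := by
    intro n
    rcases Nat.eq_zero_or_pos n with rfl | hn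
    · rw [limCoeff, pairCoeff_zero, norm_zero]; positivity
    · exact (hlim n hn).trans (mul_le_mul_of_nonneg_left (hslow n hn) hB)
  have hpos := tsum_resonance_limCoeff_re_pos (summable_resonance hB hlim')
  set R := (∑' x, resonance limCoeff x).re with hR
  set W := ∑' x, diagWeight x with hW
  have hW0 : 0 ≤ W := tsum_nonneg diagWeight_nonneg
  refine ⟨3 / 13 * R, 2 * C2 * B ^ 2 + (C3 * B ^ 3 + 9 * B ^ 3 * W + R),
    by positivity, by positivity,
    fun T hT σ hσ => ?_⟩
  have hT1 : 1 ≤ T := by linarith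
  have hT0 : 0 < T := by linarith
  have hσ0 : σ ≠ 0 := by
    rw [← abs_pos, hσ]; positivity
  have hH : 1 ≤ ⌈T⌉₊ := Nat.one_le_ceil_iff.2 hT0
  have hM : 1 ≤ cutoff T := by
    have : (1 : ℝ) ≤ cutoff T := (Real.one_le_rpow hT1 (by norm_num)).trans (pow_four_le_cutoff hT1)
    exact_mod_cast this
  set A := pairCoeff (smoothWeight σ ⌈T⌉₊ (cutoff T)) with hA
  set N := ⌈T⌉₊ * (⌈T⌉₊ + 2 * cutoff T) + 1 with hN
  have hfun : trigSum σ ⌈T⌉₊ (cutoff T) = rootSum A N := funext fun t => trigSum_eq_rootSum _ _ _ t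
  have hA0 : A 0 = 0 := pairCoeff_zero _
  have hD : |σ| ^ (-(3 / 4) : ℝ) = T ^ (3 / 14 : ℝ) := by
    rw [hσ, ← Real.rpow_mul hT0.le]; norm_num
  have hbd : CoeffBound A B (T ^ (3 / 14 : ℝ)) := by
    refine ⟨hB, by positivity, fun n => ?_, fun n => ?_⟩ <;>
      rcases Nat.eq_zero_or_pos n with rfl | hn
    · rw [hA0, norm_zero]; positivity
    · exact (hsm σ _ _ n hσ0 hH hM hn).1
    · rw [hA0, norm_zero]; positivity
    · rw [← hD]; exact (hsm σ _ _ n hσ0 hH hM hn).2.1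
  have hvan : ∀ n, N ≤ n → A n = 0 := fun n hn =>
    pairCoeff_smoothWeight_eq_zero σ (Nat.lt_of_succ_le hn)
  have hA' : ∀ n : ℕ, ‖A n‖ ≤ B * (n : ℝ) ^ (-(2 / 5) : ℝ) := by
    intro n
    rcases Nat.eq_zero_or_pos n with rfl | hn
    · rw [hA0, norm_zero]; positivity
    · exact (hbd.slow n).trans (mul_le_mul_of_nonneg_left (hslow n hn) hB)
  have hdiff : ∀ n : ℕ, ‖A n - limCoeff n‖ ≤
      B * (3 * T ^ (-(1 / 7) : ℝ)) * (n : ℝ) ^ (-(2 / 5) : ℝ) := by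
    intro n
    rcases Nat.eq_zero_or_pos n with rfl | hn
    · rw [hA0, limCoeff, pairCoeff_zero, sub_zero, norm_zero]; positivity
    · have := (hsm σ _ _ n hσ0 hH hM hn).2.2
      rw [hσ] at this
      refine this.trans ?_
      gcongr
      exact smoothing_error_le hT
  have hres := norm_sum_resonance_sub_tsum_le hB (by positivity) hA' hlim' hdiff hvan
  have hre := (Complex.abs_re_le_norm _).trans hres
  rw [Complex.sub_re, ← hR, ← hW] at hre
  have hm2 := h2 A B _ hbd N T hT1
  have hm3 := h3 A B _ hbd N T hT1
  clear_value R W A N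
  rw [hfun]
  refine ⟨continuous_rootSum A N, hm2.trans ?_, ?_⟩
  · have e : T ^ (3 / 14 : ℝ) * T ^ (2 : ℝ) ≤ T ^ (5 / 2 : ℝ) := by
      rw [← Real.rpow_add hT0]
      exact Real.rpow_le_rpow_of_exponent_le hT1 (by norm_num)
    have h5 : 0 ≤ (C3 * B ^ 3 + 9 * B ^ 3 * W + R) * T ^ (5 / 2 : ℝ) := by positivity
    calc _ ≤ C2 * B ^ 2 * (T ^ (5 / 2 : ℝ) + T ^ (5 / 2 : ℝ)) := by gcongr
      _ ≤ _ := by linarith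
  · obtain ⟨X, hX⟩ : ∃ X, X = (∑ x ∈ Finset.range N ×ˢ Finset.range N ×ˢ Finset.range N,
      resonance A x).re := ⟨_, rfl⟩
    rw [← hX] at hre hm3
    have e1 : B ^ 3 * (T ^ (3 / 14 : ℝ)) ^ 2 * T ^ (11 / 4 : ℝ) ≤ B ^ 3 * T ^ (45 / 14 : ℝ) := by
      rw [mul_assoc]
      gcongr
      rw [← Real.rpow_mul_natCast hT0.le, ← Real.rpow_add hT0]
      exact Real.rpow_le_rpow_of_exponent_le hT1 (by norm_num)
    have e2 : T ^ (13 / 4 : ℝ) * T ^ (-(1 / 7) : ℝ) ≤ T ^ (45 / 14 : ℝ) := by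
      rw [← Real.rpow_add hT0]
      exact Real.rpow_le_rpow_of_exponent_le hT1 (by norm_num)
    have e3 : 1 ≤ T ^ (45 / 14 : ℝ) := Real.one_le_rpow hT1 (by norm_num)
    have e4 : 1 ≤ T ^ (13 / 4 : ℝ) := Real.one_le_rpow hT1 (by norm_num)
    have k1 := hm3.trans (show _ ≤ C3 * (B ^ 3 * T ^ (45 / 14 : ℝ)) by
      rw [mul_assoc]; exact mul_le_mul_of_nonneg_left e1 hC3)
    have k2 : |(T ^ (13 / 4 : ℝ) - 1) * (X - R)| ≤ 9 * B ^ 3 * W * T ^ (45 / 14 : ℝ) := by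
      rw [abs_mul, abs_of_nonneg (by linarith)]
      calc _ ≤ T ^ (13 / 4 : ℝ) * (3 * B ^ 3 * (3 * T ^ (-(1 / 7) : ℝ)) * W) := by
            gcongr; linarith
        _ = 9 * B ^ 3 * W * (T ^ (13 / 4 : ℝ) * T ^ (-(1 / 7) : ℝ)) := by ring
        _ ≤ _ := by gcongr
    have k3 : R ≤ R * T ^ (45 / 14 : ℝ) := le_mul_of_one_le_right hpos.le e3
    have k4 : 0 ≤ 2 * C2 * B ^ 2 * T ^ (45 / 14 : ℝ) := by positivity
    have k5 : 0 ≤ 9 * B ^ 3 * W * T ^ (45 / 14 : ℝ) := by positivity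
    have k6 : 3 / 13 * (T ^ (13 / 4 : ℝ) - 1) * X = 3 / 13 * ((T ^ (13 / 4 : ℝ) - 1) * (X - R)) +
      3 / 13 * R * T ^ (13 / 4 : ℝ) - 3 / 13 * R := by ring
    rw [k6] at k1
    rw [abs_le] at k1 k2 ⊢
    constructor <;> linarith [k1.1, k1.2, k2.1, k2.2]

lemma NH_nonneg (t : ℝ) : 0 ≤ NH t := by
  refine tsum_nonneg fun p => ?_
  split_ifs
  · positivity
  · exact le_rfl

lemma intervalIntegrable_RHtwoPi_cube (a b : ℝ) :
    IntervalIntegrable (fun t => RHtwoPi t ^ 3) volume a b := by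
  have hmono : ∀ k : ℕ, Monotone fun t => NH (2 * π * t) ^ k := by
    intro k s t hst
    exact pow_le_pow_left₀ (NH_nonneg _) (NH_mono (by gcongr)) k
  have hint : ∀ k : ℕ, IntervalIntegrable (fun t => NH (2 * π * t) ^ k) volume a b :=
    fun k => (hmono k).intervalIntegrable
  have hg : Continuous fun t : ℝ => -(2 / 3) * t ^ ((3 : ℝ) / 2) + (1 / 2) * t := by
    have : Continuous fun t : ℝ => t ^ ((3 : ℝ) / 2) := Real.continuous_rpow_const (by norm_num)
    fun_prop
  have hterm : ∀ (k : ℕ) (f : ℝ → ℝ), Continuous f →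
      IntervalIntegrable (fun t => NH (2 * π * t) ^ k * f t) volume a b :=
    fun k f hf => (hint k).mul_continuousOn hf.continuousOn
  have h := (((hterm 3 _ (continuous_const (y := 1))).add (hterm 2 _ (hg.const_mul 3))).add
    (hterm 1 _ ((hg.pow 2).const_mul 3))).add (hterm 0 _ (hg.pow 3))
  convert h using 2
  simp only [RHtwoPi, Pi.pow_apply]
  ring

lemma cube_add_le {x E : ℝ} (hE : 0 ≤ E) : (x + E) ^ 3 ≤ x ^ 3 + 5 * E * x ^ 2 + 3 * E ^ 3 := by
  nlinarith [mul_nonneg hE (sq_nonneg (x - E)), pow_nonneg hE 3, mul_nonneg hE (sq_nonneg x)]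

/-- Cubic moments of a function enclosed between two continuous ones. -/
lemma integral_cube_le {f : ℝ → ℝ} {z : ℝ → ℂ} {T E m I : ℝ} (hT : 1 ≤ T) (hE : 0 ≤ E)
    (hf : IntervalIntegrable (fun t => f t ^ 3) volume 1 T) (hz : Continuous z)
    (hfz : ∀ t ∈ Set.Icc 1 T, f t ≤ t ^ (3 / 4 : ℝ) * (z t).re + E)
    (h2 : ∫ t in (1 : ℝ)..T, t ^ (3 / 2 : ℝ) * ‖z t‖ ^ 2 ≤ m)
    (h3 : ∫ t in (1 : ℝ)..T, t ^ (9 / 4 : ℝ) * (z t).re ^ 3 ≤ I) :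
    ∫ t in (1 : ℝ)..T, f t ^ 3 ≤ I + 5 * E * m + 3 * E ^ 3 * T := by
  have hre := Complex.continuous_re.comp hz
  have c3 : Continuous fun t : ℝ => t ^ (9 / 4 : ℝ) * (z t).re ^ 3 :=
    (Real.continuous_rpow_const (by norm_num)).mul (hre.pow 3)
  have c2 : Continuous fun t : ℝ => t ^ (3 / 2 : ℝ) * ‖z t‖ ^ 2 :=
    (Real.continuous_rpow_const (by norm_num)).mul (hz.norm.pow 2)
  have hle : ∀ t ∈ Set.Icc 1 T, f t ^ 3 ≤ t ^ (9 / 4 : ℝ) * (z t).re ^ 3 +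
      5 * E * (t ^ (3 / 2 : ℝ) * ‖z t‖ ^ 2) + 3 * E ^ 3 := by
    intro t ht
    have ht0 : 0 < t := by linarith [ht.1]
    have e3 : (t ^ (3 / 4 : ℝ) * (z t).re) ^ 3 = t ^ (9 / 4 : ℝ) * (z t).re ^ 3 := by
      rw [mul_pow, ← Real.rpow_mul_natCast ht0.le]; norm_num
    have e2 : (t ^ (3 / 4 : ℝ) * (z t).re) ^ 2 ≤ t ^ (3 / 2 : ℝ) * ‖z t‖ ^ 2 := by
      rw [mul_pow, ← Real.rpow_mul_natCast ht0.le]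
      norm_num
      rw [← sq_abs (z t).re]
      gcongr
      exact Complex.abs_re_le_norm _
    have h1 : f t ^ 3 ≤ (t ^ (3 / 4 : ℝ) * (z t).re + E) ^ 3 :=
      (Odd.strictMono_pow (by decide : Odd 3)).monotone (hfz t ht)
    have h5 := mul_le_mul_of_nonneg_left e2 (show 0 ≤ 5 * E by positivity)
    have := cube_add_le (x := t ^ (3 / 4 : ℝ) * (z t).re) hE
    rw [e3] at this
    linarith
  have i3 := c3.intervalIntegrable (μ := volume) 1 T
  have i2 := (c2.const_mul (5 * E)).intervalIntegrable (μ := volume) 1 T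
  calc _ ≤ ∫ t in (1 : ℝ)..T, (t ^ (9 / 4 : ℝ) * (z t).re ^ 3 +
      5 * E * (t ^ (3 / 2 : ℝ) * ‖z t‖ ^ 2) + 3 * E ^ 3) :=
        intervalIntegral.integral_mono_on hT hf
          ((i3.add i2).add intervalIntegrable_const) hle
    _ = (∫ t in (1 : ℝ)..T, t ^ (9 / 4 : ℝ) * (z t).re ^ 3) +
        5 * E * (∫ t in (1 : ℝ)..T, t ^ (3 / 2 : ℝ) * ‖z t‖ ^ 2) + (T - 1) * (3 * E ^ 3) := by
        rw [intervalIntegral.integral_add (i3.add i2) intervalIntegrable_const,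
          intervalIntegral.integral_add i3 i2, intervalIntegral.integral_const_mul,
          intervalIntegral.integral_const, smul_eq_mul]
    _ ≤ _ := by
        have h4 := mul_le_mul_of_nonneg_left h2 (show 0 ≤ 5 * E by positivity)
        have h5 : 0 ≤ 3 * E ^ 3 := by positivity
        linarith

theorem exists_third_moment_RHtwoPi : ∃ b C : ℝ, 0 < b ∧ 0 < C ∧ ∀ T : ℝ, 2 ≤ T →
    |(∫ t in (1 : ℝ)..T, RHtwoPi t ^ 3) - b * T ^ ((13 : ℝ) / 4)| ≤ C * T ^ ((45 : ℝ) / 14) := by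
  obtain ⟨b, K, hb, hK, hmom⟩ := exists_trigSum_moments
  obtain ⟨L, hL, herr⟩ := exists_truncation_error_le
  refine ⟨b, 1 + (K + 5 * L * K + 3 * L ^ 3), hb, by positivity, fun T hT => ?_⟩
  have hT1 : 1 ≤ T := by linarith
  have hT0 : 0 < T := by linarith
  set δ : ℝ := T ^ (-(2 / 7) : ℝ) with hδ
  have hδ0 : 0 < δ := by positivity
  have hδ1 : δ < 1 := Real.rpow_lt_one_of_one_lt_of_neg (by linarith) (by norm_num)
  have hH : 1 ≤ ⌈T⌉₊ := Nat.one_le_ceil_iff.2 hT0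
  have hM : 1 ≤ cutoff T := by
    have : (1 : ℝ) ≤ cutoff T := (Real.one_le_rpow hT1 (by norm_num)).trans (pow_four_le_cutoff hT1)
    exact_mod_cast this
  obtain ⟨c1, m1, t1⟩ := hmom T hT δ (abs_of_pos hδ0)
  obtain ⟨c2, m2, t2⟩ := hmom T hT (-δ) (by rw [abs_neg]; exact abs_of_pos hδ0)
  have hE : 0 ≤ L * T ^ (5 / 7 : ℝ) := by positivity
  rw [abs_le] at t1 t2
  have hup := integral_cube_le hT1 hE (intervalIntegrable_RHtwoPi_cube 1 T) c1
    (fun t ht => (RHtwoPi_le_trigSum ht.1 hδ0 hδ1 hH hM (le_sqrt_cutoff ht.2)).trans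
      (by linarith [herr T hT t ht])) m1 (sub_le_iff_le_add.1 t1.2)
  have hlow := integral_cube_le (f := fun t => -RHtwoPi t)
    (z := fun t => -trigSum (-δ) ⌈T⌉₊ (cutoff T) t) (m := K * T ^ (5 / 2 : ℝ))
    (I := K * T ^ (45 / 14 : ℝ) - b * T ^ (13 / 4 : ℝ)) hT1 hE
    (by
      convert (intervalIntegrable_RHtwoPi_cube 1 T).neg using 2
      simp only [Pi.neg_apply]
      ring)
    c2.neg
    (fun t ht => by
      have h1 := trigSum_le_RHtwoPi ht.1 hδ0 hδ1 hH hM (le_sqrt_cutoff ht.2)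
      rw [Complex.neg_re]
      linarith [herr T hT t ht])
    (by simpa only [norm_neg] using m2)
    (by
      have e : ∀ t : ℝ, t ^ (9 / 4 : ℝ) * (-trigSum (-δ) ⌈T⌉₊ (cutoff T) t).re ^ 3 =
          -(t ^ (9 / 4 : ℝ) * (trigSum (-δ) ⌈T⌉₊ (cutoff T) t).re ^ 3) := by
        intro t; rw [Complex.neg_re]; ring
      simp_rw [e]
      rw [intervalIntegral.integral_neg]
      linarith [t2.1])
  have e : ∀ t : ℝ, (-RHtwoPi t) ^ 3 = -(RHtwoPi t ^ 3) := fun t => by ring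
  simp_rw [e] at hlow
  rw [intervalIntegral.integral_neg] at hlow
  have hE2 : 5 * (L * T ^ (5 / 7 : ℝ)) * (K * T ^ (5 / 2 : ℝ)) = 5 * L * K * T ^ (45 / 14 : ℝ) := by
    have : T ^ (5 / 7 : ℝ) * T ^ (5 / 2 : ℝ) = T ^ (45 / 14 : ℝ) := by
      rw [← Real.rpow_add hT0]; norm_num
    rw [← this]; ring
  have hE3 : 3 * (L * T ^ (5 / 7 : ℝ)) ^ 3 * T ≤ 3 * L ^ 3 * T ^ (45 / 14 : ℝ) := by
    have : (T ^ (5 / 7 : ℝ)) ^ 3 * T ≤ T ^ (45 / 14 : ℝ) := by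
      rw [← Real.rpow_mul_natCast hT0.le]
      nth_rewrite 2 [← Real.rpow_one T]
      rw [← Real.rpow_add hT0]
      exact Real.rpow_le_rpow_of_exponent_le hT1 (by norm_num)
    calc _ = 3 * L ^ 3 * ((T ^ (5 / 7 : ℝ)) ^ 3 * T) := by ring
      _ ≤ _ := by gcongr
  rw [hE2] at hup hlow
  have hp : 0 < T ^ (45 / 14 : ℝ) := by positivity
  rw [abs_le]
  constructor <;> linarith

/-- Third moment of the type II remainder:
`∫₁^T R_H(2πt)³ dt = b₃ T^{13/4} + O_δ(T^{45/14+δ})` with `b₃ > 0`. -/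
theorem third_moment_type_II_remainder :
    ∃ b₃ : ℝ, 0 < b₃ ∧ ∀ δ : ℝ, 0 < δ → ∃ C : ℝ, 0 < C ∧ ∀ T : ℝ, 2 ≤ T →
      |(∫ t in (1:ℝ)..T, RHtwoPi t ^ 3) - b₃ * T ^ ((13 : ℝ) / 4)| ≤
        C * T ^ ((45 : ℝ) / 14 + δ) := by
  obtain ⟨b, C, hb, hC, h⟩ := exists_third_moment_RHtwoPi
  refine ⟨b, hb, fun δ hδ => ⟨C, hC, fun T hT => (h T hT).trans ?_⟩⟩
  exact mul_le_mul_of_nonneg_left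
    (Real.rpow_le_rpow_of_exponent_le (by linarith) (by linarith)) hC.le
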